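/- arXiv:math/0603614 — 4 statements merged into one kernel-verified Lean document; each statement's English description precedes it below -/
import Mathlib

section
/- There exists an absolute constant c > 0 such that for every n-dimensional real normed space X (n ≥ 1), the equilateral number satisfies e(X) ≥ exp(c·√(log n)). -/
/-- A set `S` in a normed space is *equilateral* if there is a common distance `d > 0`
between any two distinct points of `S`. -/
def IsEquilateral {X : Type*} [NormedAddCommGroup X] (S : Set X) : Prop :=
  ∃ d : ℝ, 0 < d ∧ ∀ x ∈ S, ∀ y ∈ S, x ≠ y → ‖x - y‖ = d

/-- Convex functions on `ι → ℝ` that are uniformly close to `d + L * (t i - t₀)` near the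
constant vector `t₀` take the value `d` simultaneously. -/
lemma exists_forall_eq_of_convexOn {ι : Type*} [Fintype ι] (f : ι → (ι → ℝ) → ℝ)
    (hf : ∀ i, ConvexOn ℝ Set.univ (f i)) {d L r t₀ : ℝ} (hL : 0 < L) (hr : 0 < r)
    (h : ∀ i t, (∀ j, |t j - t₀| ≤ 2 * r) → |f i t - (d + L * (t i - t₀))| ≤ L * r / 8) :
    ∃ t : ι → ℝ, (∀ j, |t j - t₀| ≤ r) ∧ ∀ i, f i t = d := by
  classical
  set c : ι → ℝ := fun _ => t₀ with hc
  set g : ι → (ι → ℝ) → ℝ := fun i t => f i t - (d + L * (t i - t₀)) with hg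
  have hball : ∀ t : ι → ℝ, ∀ ρ, 0 ≤ ρ → (dist t c ≤ ρ ↔ ∀ j, |t j - t₀| ≤ ρ) := by
    intro t ρ hρ
    rw [dist_pi_le_iff hρ]
    simp [hc, Real.dist_eq]
  have hgconv : ∀ i, ConvexOn ℝ Set.univ (g i) := by
    intro i
    refine (hf i).sub ⟨convex_univ, ?_⟩
    intro x _ y _ a b _ _ hab
    simp only [Pi.add_apply, Pi.smul_apply, smul_eq_mul]
    obtain rfl : b = 1 - a := by linarith
    nlinarith
  have hlip : ∀ i, ∀ x y : ι → ℝ, dist x c ≤ r → dist y c ≤ r →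
      |g i x - g i y| ≤ L / 2 * dist x y := by
    intro i x y hx hy
    have := ((hgconv i).subset (Set.subset_univ (Metric.ball c (2 * r))) (convex_ball _ _)
      |>.lipschitzOnWith_of_abs_le (ε := r / 2) (M := L * r / 8) (by positivity) (fun t ht => h i t
        ((hball t _ (by positivity)).1 ht.le)))
    have h2 := this.dist_le_mul x (by simp only [Metric.mem_ball]; linarith) y
      (by simp only [Metric.mem_ball]; linarith)
    rw [Real.dist_eq, Real.coe_toNNReal _ (by positivity)] at h2
    convert h2 using 2
    field_simp
    norm_num
  set Φ : (ι → ℝ) → (ι → ℝ) := fun t i => t i - (f i t - d) / L with hΦ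
  have hΦg : ∀ t i, Φ t i = t₀ - g i t / L := by
    intro t i
    simp only [hΦ, hg]
    field_simp
    ring
  have hmaps : Set.MapsTo Φ (Metric.closedBall c r) (Metric.closedBall c r) := by
    intro t ht
    rw [Metric.mem_closedBall, hball _ _ hr.le]
    intro j
    rw [Metric.mem_closedBall] at ht
    have h1 := h j t ((hball t _ (by positivity)).1 (by linarith))
    rw [hΦg, sub_sub_cancel_left, abs_neg, abs_div, abs_of_pos hL, div_le_iff₀ hL]
    refine h1.trans ?_
    nlinarith [mul_pos hL hr]
  have hcontr : ContractingWith (1 / 2) (hmaps.restrict Φ _ _) := by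
    refine ⟨by norm_num, LipschitzWith.of_dist_le_mul ?_⟩
    rintro ⟨x, hx⟩ ⟨y, hy⟩
    simp only [Subtype.dist_eq, Set.MapsTo.val_restrict_apply]
    rw [dist_pi_le_iff (by positivity)]
    intro i
    have h1 := hlip i x y hx hy
    rw [hΦg, hΦg, Real.dist_eq, sub_sub_sub_cancel_left, ← sub_div, abs_div, abs_of_pos hL,
      div_le_iff₀ hL, abs_sub_comm]
    refine h1.trans_eq ?_
    push_cast
    ring
  have hcomplete : IsComplete (Metric.closedBall c r) := Metric.isClosed_closedBall.isComplete
  obtain ⟨y, hy, hfix, -⟩ := hcontr.exists_fixedPoint' hcomplete hmaps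
    (x := c) (Metric.mem_closedBall_self hr.le) (edist_ne_top _ _)
  refine ⟨y, (hball y _ hr.le).1 hy, fun i => ?_⟩
  have h1 := congrFun hfix i
  simp only [hΦ] at h1
  have h2 : (f i y - d) / L = 0 := by linarith
  rw [div_eq_zero_iff] at h2
  rcases h2 with h2 | h2 <;> linarith

/-- If the norms `‖v k - (1 + t) • v l + ∑ j, s j • v j‖` with small `s` are close to an affine
function of `t`, then suitable triangular perturbations of the `v k` are equidistant. -/
lemma exists_equidistant_of_norm_close {X : Type*} [NormedAddCommGroup X] [NormedSpace ℝ X]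
    {m : ℕ} (v : Fin m → X) {d L r t₀ : ℝ} (hL : 0 < L) (hr : 0 < r)
    (h : ∀ k l, l ≠ k → ∀ (t : ℝ) (s : Fin m → ℝ), |t - t₀| ≤ 2 * r → s k = 0 → s l = 0 →
      (∀ j, |s j| ≤ 2 * (|t₀| + 2 * r)) →
      |‖v k - (1 + t) • v l + ∑ j, s j • v j‖ - (d + L * (t - t₀))| ≤ L * r / 8) :
    ∃ p : Fin m → X, ∀ k l, k ≠ l → ‖p k - p l‖ = d := by
  classical
  set c : (Fin m × Fin m → ℝ) → Fin m → Fin m → ℝ :=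
    fun t k l => if l < k then t (k, l) else 0 with hc
  set p : (Fin m × Fin m → ℝ) → Fin m → X := fun t k => v k - ∑ l, c t k l • v l with hp
  set f : Fin m × Fin m → (Fin m × Fin m → ℝ) → ℝ := fun q t =>
    if q.2 < q.1 then ‖p t q.1 - p t q.2‖ else d + L * (t q - t₀) with hf
  have hdiff : ∀ t k l, l < k → p t k - p t l = v k - (1 + t (k, l)) • v l +
      ∑ j, (if j = l then 0 else c t l j - c t k j) • v j := by
    intro t k l hlk
    have h1 : ∑ j, (if j = l then 0 else c t l j - c t k j) • v j =
        ∑ j, c t l j • v j - ∑ j, c t k j • v j + t (k, l) • v l := by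
      rw [← Finset.sum_sub_distrib, ← Finset.add_sum_erase _ _ (Finset.mem_univ l),
        ← Finset.add_sum_erase (Finset.univ) (fun j => c t l j • v j - c t k j • v j)
          (Finset.mem_univ l)]
      have h2 : ∑ x ∈ Finset.univ.erase l, (if x = l then 0 else c t l x - c t k x) • v x =
          ∑ x ∈ Finset.univ.erase l, (c t l x • v x - c t k x • v x) := by
        refine Finset.sum_congr rfl fun x hx => ?_
        rw [if_neg (Finset.ne_of_mem_erase hx), sub_smul]
      rw [h2]
      simp [hc, hlk]
    rw [h1]
    simp only [hp]
    module
  have hconv : ∀ q, ConvexOn ℝ Set.univ (f q) := by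
    rintro ⟨k, l⟩
    refine ⟨convex_univ, ?_⟩
    intro x _ y _ a b ha hb hab
    have hcl : ∀ k l, c (a • x + b • y) k l = a * c x k l + b * c y k l := by
      intro k l
      simp only [hc]
      split_ifs <;> simp
    by_cases hlk : l < k
    · simp only [hf, hlk, if_true, smul_eq_mul]
      have hpl : ∀ k, p (a • x + b • y) k = a • p x k + b • p y k := by
        intro k
        simp only [hp, hcl, add_smul, mul_smul, Finset.sum_add_distrib, ← Finset.smul_sum]
        have : v k = a • v k + b • v k := by rw [← add_smul, hab, one_smul]
        nth_rewrite 1 [this]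
        module
      have : p (a • x + b • y) k - p (a • x + b • y) l =
          a • (p x k - p x l) + b • (p y k - p y l) := by
        rw [hpl, hpl]
        module
      rw [this]
      refine (norm_add_le _ _).trans_eq ?_
      rw [norm_smul, norm_smul, Real.norm_of_nonneg ha, Real.norm_of_nonneg hb]
    · simp only [hf, hlk, if_false, smul_eq_mul, Pi.add_apply, Pi.smul_apply]
      obtain rfl : b = 1 - a := by linarith
      nlinarith
  obtain ⟨t, -, ht⟩ := exists_forall_eq_of_convexOn f hconv (d := d) (t₀ := t₀) hL hr (by
    rintro ⟨k, l⟩ t ht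
    by_cases hlk : l < k
    · simp only [hf, hlk, if_true]
      rw [hdiff t k l hlk]
      have hcb : ∀ k l, |c t k l| ≤ |t₀| + 2 * r := by
        intro k l
        simp only [hc]
        split_ifs
        · have := ht (k, l)
          calc |t (k, l)| = |t₀ + (t (k, l) - t₀)| := by ring_nf
            _ ≤ _ := (abs_add_le _ _).trans (by linarith)
        · simp; positivity
      refine h k l hlk.ne _ _ (ht _) ?_ (by simp) ?_
      · simp [hc, hlk.ne', hlk.le]
      · intro j
        split_ifs
        · simp; positivity
        · refine (abs_sub _ _).trans ?_
          linarith [hcb l j, hcb k j]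
    · simp only [hf, hlk, if_false, sub_self, abs_zero]
      positivity)
  refine ⟨p t, fun k l hkl => ?_⟩
  rcases lt_or_gt_of_ne hkl with hlt | hlt
  · have := ht (l, k)
    simp only [hf, hlt, if_true] at this
    rwa [norm_sub_rev]
  · have := ht (k, l)
    simpa only [hf, hlt, if_true] using this

/-- `UpperSupFamily X C k` says that `X` contains `k` vectors of norm at least one all of whose
combinations with coefficients in `[-1, 1]` have norm at most `C`. -/
def UpperSupFamily (X : Type*) [NormedAddCommGroup X] [NormedSpace ℝ X] (C : ℝ) (k : ℕ) : Prop :=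
  ∃ y : Fin k → X, (∀ i, 1 ≤ ‖y i‖) ∧
    ∀ a : Fin k → ℝ, (∀ i, |a i| ≤ 1) → ‖∑ i, a i • y i‖ ≤ C

namespace UpperSupFamily

variable {X : Type*} [NormedAddCommGroup X] [NormedSpace ℝ X] {C C' : ℝ} {k : ℕ}

lemma mono_right (h : UpperSupFamily X C k) (hC : C ≤ C') : UpperSupFamily X C' k := by
  obtain ⟨y, hy, h⟩ := h
  exact ⟨y, hy, fun a ha => (h a ha).trans hC⟩

lemma of_injective {ι : Type*} [Fintype ι] (y : ι → X) (hy : ∀ i, 1 ≤ ‖y i‖)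
    (h : ∀ a : ι → ℝ, (∀ i, |a i| ≤ 1) → ‖∑ i, a i • y i‖ ≤ C) (e : Fin k ↪ ι) :
    UpperSupFamily X C k := by
  classical
  refine ⟨fun i => y (e i), fun i => hy _, fun a ha => ?_⟩
  have h1 := h (Function.extend e a 0) (by
    intro i
    by_cases hi : ∃ j, e j = i
    · obtain ⟨j, rfl⟩ := hi
      rw [e.injective.extend_apply]
      exact ha j
    · rw [Function.extend_apply' _ _ _ hi]
      simp)
  convert h1 using 2
  rw [← Finset.sum_subset (Finset.subset_univ (Finset.univ.map e))]
  · simp [e.injective.extend_apply]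
  · intro x _ hx
    rw [Function.extend_apply' _ _ _ (by simpa using hx)]
    simp

/-- James' blocking argument. -/
lemma sqrt (hC : 0 < C) (h : UpperSupFamily X (C ^ 2) (k ^ 2)) : UpperSupFamily X C k := by
  rw [sq k] at h
  obtain ⟨y, hy, hyC⟩ := h
  set e : Fin k × Fin k ≃ Fin (k * k) := finProdFinEquiv
  by_cases hblock : ∃ i, ∀ a : Fin k → ℝ, (∀ j, |a j| ≤ 1) → ‖∑ j, a j • y (e (i, j))‖ ≤ C
  · obtain ⟨i, hi⟩ := hblock
    exact ⟨fun j => y (e (i, j)), fun j => hy _, hi⟩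
  push Not at hblock
  choose a ha1 haC using hblock
  refine ⟨fun i => C⁻¹ • ∑ j, a i j • y (e (i, j)), fun i => ?_, fun b hb => ?_⟩
  · rw [norm_smul, norm_inv, Real.norm_of_nonneg hC.le, ← div_eq_inv_mul, one_le_div hC]
    exact (haC i).le
  · have h1 := hyC (fun q => b (e.symm q).1 * a (e.symm q).1 (e.symm q).2) (by
      intro q
      rw [abs_mul]
      exact mul_le_one₀ (hb _) (abs_nonneg _) (ha1 _ _))
    have h2 : ∑ i, b i • C⁻¹ • ∑ j, a i j • y (e (i, j)) =
        C⁻¹ • ∑ q, (b (e.symm q).1 * a (e.symm q).1 (e.symm q).2) • y q := by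
      rw [← e.sum_comp, Fintype.sum_prod_type, Finset.smul_sum]
      refine Finset.sum_congr rfl fun i _ => ?_
      simp only [Equiv.symm_apply_apply, mul_smul, ← Finset.smul_sum]
      rw [smul_comm]
    rw [h2, norm_smul, norm_inv, Real.norm_of_nonneg hC.le, ← div_eq_inv_mul, div_le_iff₀ hC]
    exact h1.trans_eq (sq C)

lemma of_pow (hC : 0 < C) (j : ℕ) (h : UpperSupFamily X (C ^ 2 ^ j) (k ^ 2 ^ j)) :
    UpperSupFamily X C k := by
  induction j with
  | zero => simpa using h
  | succ j ih =>
    refine ih (sqrt (by positivity) ?_)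
    rwa [← pow_mul, ← pow_mul, ← pow_succ]

/-- An almost isometric copy of the basis of `ℓ_∞` can be perturbed to an equilateral set. -/
lemma exists_equidistant {m : ℕ} (h : UpperSupFamily X (1 + 1 / 96) m) :
    ∃ p : Fin m → X, ∀ k l, k ≠ l → ‖p k - p l‖ = 5 / 4 := by
  classical
  obtain ⟨y, hy, hyC⟩ := h
  set v : Fin m → X := fun i => ‖y i‖⁻¹ • y i with hv
  have hypos : ∀ i, 0 < ‖y i‖ := fun i => one_pos.trans_le (hy i)
  have hvnorm : ∀ i, ‖v i‖ = 1 := fun i => by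
    simp [hv, norm_smul, (hypos i).ne']
  have hup : ∀ (b : ℝ), 0 < b → ∀ a : Fin m → ℝ, (∀ i, |a i| ≤ b) →
      ‖∑ i, a i • v i‖ ≤ b * (1 + 1 / 96) := by
    intro b hb a ha
    have h1 := hyC (fun i => b⁻¹ * a i * ‖y i‖⁻¹) (by
      intro i
      rw [abs_mul, abs_mul, abs_inv, abs_inv, abs_of_pos hb, abs_of_pos (hypos i)]
      refine mul_le_one₀ ?_ (by positivity) (inv_le_one_of_one_le₀ (hy i))
      rw [← div_eq_inv_mul, div_le_one hb]
      exact ha i)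
    have h2 : ∑ i, (b⁻¹ * a i * ‖y i‖⁻¹) • y i = b⁻¹ • ∑ i, a i • v i := by
      simp only [hv, Finset.smul_sum, smul_smul, mul_assoc]
    rw [h2, norm_smul, norm_inv, Real.norm_of_nonneg hb.le, ← div_eq_inv_mul, div_le_iff₀ hb] at h1
    linarith
  refine exists_equidistant_of_norm_close v (L := 1) (r := 1 / 8) (t₀ := 1 / 4) (by norm_num)
    (by norm_num) ?_
  intro k l hlk t s ht hsk hsl hs
  rw [abs_le] at ht
  have ht0 : 0 ≤ t := by linarith [ht.1]
  have ht1 : t ≤ 1 / 2 := by linarith [ht.2]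
  have hs1 : ∀ j, |s j| ≤ 1 := fun j => (hs j).trans (by
    rw [abs_of_pos (by norm_num)]; norm_num)
  have hsum : ∀ u : ℝ, v k - u • v l + ∑ j, s j • v j =
      ∑ j, (s j + (Pi.single k 1 - Pi.single l u : Fin m → ℝ) j) • v j := by
    intro u
    simp only [add_smul, Finset.sum_add_distrib, Pi.sub_apply, sub_smul, Finset.sum_sub_distrib]
    simp [Pi.single_apply, ite_smul]
    abel
  have hcoef : ∀ u : ℝ, |u| = 1 + t →
      ‖v k - u • v l + ∑ j, s j • v j‖ ≤ (1 + t) * (1 + 1 / 96) := by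
    intro u hu
    rw [hsum]
    refine hup _ (by linarith) _ fun i => ?_
    by_cases hik : i = k
    · subst hik
      simp [hsk, hlk.symm, ht0]
    by_cases hil : i = l
    · subst hil
      simp [hsl, hlk, hu]
    · simp only [Pi.sub_apply, Pi.single_apply, hik, hil, if_false, sub_zero, add_zero]
      linarith [hs1 i]
  have h1 := hcoef (1 + t) (abs_of_pos (by linarith))
  have h2 := hcoef (-(1 + t)) (by rw [abs_neg]; exact abs_of_pos (by linarith))
  have h3 : 2 * (1 + t) ≤ ‖v k - (1 + t) • v l + ∑ j, s j • v j‖ +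
      ‖v k - (-(1 + t)) • v l + ∑ j, s j • v j‖ := by
    have : (2 * (1 + t)) • v l = (v k - (-(1 + t)) • v l + ∑ j, s j • v j) -
        (v k - (1 + t) • v l + ∑ j, s j • v j) := by module
    calc 2 * (1 + t) = ‖(2 * (1 + t)) • v l‖ := by
          rw [norm_smul, hvnorm, Real.norm_of_nonneg (by linarith), mul_one]
      _ ≤ _ := by rw [this]; exact (norm_sub_le _ _).trans_eq (add_comm _ _)
  rw [abs_le]
  constructor <;> linarith

end UpperSupFamily

open MeasureTheory ProbabilityTheory in
lemma integrable_prod_of_le_sq {E : Type*} [NormedAddCommGroup E] [InnerProductSpace ℝ E]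
    [FiniteDimensional ℝ E] [MeasurableSpace E] [BorelSpace E] {g : E × E → ℝ}
    (hg : Continuous g) (h : ∀ p, |g p| ≤ 8 * (‖p.1‖ ^ 2 + ‖p.2‖ ^ 2)) :
    Integrable g ((stdGaussian E).prod (stdGaussian E)) := by
  have hsq : Integrable (fun x : E => ‖x‖ ^ 2) (stdGaussian E) :=
    (IsGaussian.memLp_two_id (μ := stdGaussian E)).integrable_norm_pow (by norm_num)
  refine (((hsq.comp_fst _).add (hsq.comp_snd _)).const_mul 8).mono' hg.aestronglyMeasurable ?_
  exact Filter.Eventually.of_forall h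

open MeasureTheory ProbabilityTheory in
lemma integral_sq_pos_part_rotation_le {E X : Type*} [NormedAddCommGroup E]
    [InnerProductSpace ℝ E] [FiniteDimensional ℝ E] [MeasurableSpace E] [BorelSpace E]
    [NormedAddCommGroup X] [NormedSpace ℝ X] (T : E →L[ℝ] X) (hT : ‖T‖ ≤ 1) (θ : ℝ) :
    ∫ p, (max 0 (‖T p.1‖ - ‖T (Real.cos θ • p.1 + Real.sin θ • p.2)‖)) ^ 2
      ∂((stdGaussian E).prod (stdGaussian E)) ≤
      2 * (1 - Real.cos θ) ^ 2 * ∫ x, ‖T x‖ ^ 2 ∂(stdGaussian E) + 2 * Real.sin θ ^ 2 := by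
  have hTle : ∀ x, ‖T x‖ ≤ ‖x‖ := fun x => (T.le_of_opNorm_le hT x).trans_eq (one_mul _)
  have hsq : Integrable (fun x : E => ‖T x‖ ^ 2) (stdGaussian E) := by
    refine ((IsGaussian.memLp_two_id (μ := stdGaussian E)).integrable_norm_pow
      (by norm_num)).mono' (by fun_prop) (Filter.Eventually.of_forall fun x => ?_)
    rw [Real.norm_of_nonneg (by positivity)]
    exact pow_le_pow_left₀ (norm_nonneg _) (hTle x) 2
  have hInt : Integrable (fun p : E × E =>
      (max 0 (‖T p.1‖ - ‖T (Real.cos θ • p.1 + Real.sin θ • p.2)‖)) ^ 2)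
      ((stdGaussian E).prod (stdGaussian E)) := by
    refine integrable_prod_of_le_sq (by fun_prop) fun p => ?_
    rw [abs_of_nonneg (by positivity)]
    have h1 : max 0 (‖T p.1‖ - ‖T (Real.cos θ • p.1 + Real.sin θ • p.2)‖) ≤ ‖p.1‖ :=
      max_le (norm_nonneg _) ((sub_le_self _ (norm_nonneg _)).trans (hTle p.1))
    have h2 := pow_le_pow_left₀ (le_max_left _ _) h1 2
    nlinarith [sq_nonneg ‖p.1‖, sq_nonneg ‖p.2‖]
  rw [integral_prod _ hInt]
  calc ∫ x, ∫ y, (max 0 (‖T x‖ - ‖T (Real.cos θ • x + Real.sin θ • y)‖)) ^ 2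
        ∂(stdGaussian E) ∂(stdGaussian E)
      ≤ ∫ x, (2 * (1 - Real.cos θ) ^ 2 * ‖T x‖ ^ 2 + 2 * Real.sin θ ^ 2) ∂(stdGaussian E) := by
        refine integral_mono hInt.integral_prod_left
          ((hsq.const_mul _).add (integrable_const _)) fun x => ?_
        obtain ⟨φ, hφ, hφx⟩ := exists_dual_vector'' ℝ (T x)
        set L : StrongDual ℝ E := φ.comp T with hL
        have hLnorm : ‖L‖ ≤ 1 :=
          (ContinuousLinearMap.opNorm_comp_le _ _).trans (mul_le_one₀ hφ (norm_nonneg _) hT)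
        have hLint : Integrable (fun y => (L y) ^ 2) (stdGaussian E) :=
          (IsGaussian.memLp_dual (stdGaussian E) L 2 (by norm_num)).integrable_sq
        have hLsq : ∫ y, (L y) ^ 2 ∂(stdGaussian E) ≤ 1 := by
          have h1 := variance_of_integral_eq_zero (μ := stdGaussian E) (X := L)
            L.continuous.aemeasurable (integral_strongDual_stdGaussian L)
          rw [← h1, variance_dual_stdGaussian]
          exact pow_le_one₀ (norm_nonneg _) hLnorm
        have hpt : ∀ y, (max 0 (‖T x‖ - ‖T (Real.cos θ • x + Real.sin θ • y)‖)) ^ 2 ≤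
            2 * (1 - Real.cos θ) ^ 2 * ‖T x‖ ^ 2 + 2 * Real.sin θ ^ 2 * (L y) ^ 2 := by
          intro y
          have h1 : φ (T (Real.cos θ • x + Real.sin θ • y)) ≤
              ‖T (Real.cos θ • x + Real.sin θ • y)‖ :=
            (le_abs_self _).trans ((φ.le_of_opNorm_le hφ _).trans_eq (one_mul _))
          have h2 : φ (T (Real.cos θ • x + Real.sin θ • y)) =
              Real.cos θ * ‖T x‖ + Real.sin θ * L y := by
            have : φ (T x) = ‖T x‖ := by simpa using hφx
            simp [hL, this]
          have h3 : max 0 (‖T x‖ - ‖T (Real.cos θ • x + Real.sin θ • y)‖) ≤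
              |(1 - Real.cos θ) * ‖T x‖ - Real.sin θ * L y| :=
            max_le (abs_nonneg _) (le_trans (by linarith) (le_abs_self _))
          refine (pow_le_pow_left₀ (le_max_left _ _) h3 2).trans ?_
          rw [sq_abs]
          nlinarith [sq_nonneg ((1 - Real.cos θ) * ‖T x‖ + Real.sin θ * L y)]
        calc ∫ y, (max 0 (‖T x‖ - ‖T (Real.cos θ • x + Real.sin θ • y)‖)) ^ 2 ∂(stdGaussian E)
            ≤ ∫ y, (2 * (1 - Real.cos θ) ^ 2 * ‖T x‖ ^ 2 + 2 * Real.sin θ ^ 2 * (L y) ^ 2)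
              ∂(stdGaussian E) :=
              integral_mono_of_nonneg (Filter.Eventually.of_forall fun _ => by positivity)
                ((integrable_const _).add (hLint.const_mul _)) (Filter.Eventually.of_forall hpt)
          _ = 2 * (1 - Real.cos θ) ^ 2 * ‖T x‖ ^ 2 +
              2 * Real.sin θ ^ 2 * ∫ y, (L y) ^ 2 ∂(stdGaussian E) := by
              rw [integral_add (integrable_const _) (hLint.const_mul _),
                integral_const_mul (2 * Real.sin θ ^ 2)]
              simp
          _ ≤ _ := by nlinarith [sq_nonneg (Real.sin θ)]
    _ = _ := by
        rw [integral_add (hsq.const_mul _) (integrable_const _), integral_const_mul]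
        simp

open MeasureTheory ProbabilityTheory in
lemma integral_sq_pos_part_sub_le {E X : Type*} [NormedAddCommGroup E]
    [InnerProductSpace ℝ E] [FiniteDimensional ℝ E] [MeasurableSpace E] [BorelSpace E]
    [NormedAddCommGroup X] [NormedSpace ℝ X] (T : E →L[ℝ] X) (hT : ‖T‖ ≤ 1) :
    ∫ p, (max 0 (‖T p.1‖ - ‖T p.2‖)) ^ 2 ∂((stdGaussian E).prod (stdGaussian E)) ≤ 6 := by
  have hTle : ∀ x, ‖T x‖ ≤ ‖x‖ := fun x => (T.le_of_opNorm_le hT x).trans_eq (one_mul _)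
  set V := ∫ x, ‖T x‖ ^ 2 ∂(stdGaussian E) with hV
  have hV0 : 0 ≤ V := integral_nonneg fun _ => by positivity
  obtain ⟨n, hn⟩ := exists_nat_gt (max 1 (4 * V))
  have hn1 : (1 : ℝ) < n := (le_max_left _ _).trans_lt hn
  have hnV : 4 * V < n := (le_max_right _ _).trans_lt hn
  set h : ℝ := Real.pi / 2 / n with hh
  set D : ℕ → E × E → ℝ := fun k p =>
    max 0 (‖T (ContinuousLinearMap.rotation (k * h) p).1‖ -
      ‖T (ContinuousLinearMap.rotation ((k + 1 : ℕ) * h) p).1‖) with hD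
  have hD0 : ∀ k p, 0 ≤ D k p := fun k p => le_max_left _ _
  have hDstep : ∀ k p, D k p = (fun q : E × E =>
      max 0 (‖T q.1‖ - ‖T (Real.cos h • q.1 + Real.sin h • q.2)‖))
        (ContinuousLinearMap.rotation (k * h) p) := by
    intro k p
    have : (ContinuousLinearMap.rotation ((k + 1 : ℕ) * h) p).1 =
        Real.cos h • (ContinuousLinearMap.rotation (k * h) p).1 +
          Real.sin h • (ContinuousLinearMap.rotation (k * h) p).2 := by
      simp only [ContinuousLinearMap.rotation_apply]
      push_cast
      rw [add_mul, one_mul, Real.cos_add, Real.sin_add]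
      module
    simp only [hD, this]
  have hDint : ∀ k, ∫ p, D k p ^ 2 ∂((stdGaussian E).prod (stdGaussian E)) ≤
      2 * (1 - Real.cos h) ^ 2 * V + 2 * Real.sin h ^ 2 := by
    intro k
    have hrot := IsGaussian.map_rotation_eq_self (μ := stdGaussian E)
      (by simp) (k * h)
    refine le_trans (le_of_eq ?_) (integral_sq_pos_part_rotation_le T hT h)
    conv_rhs => rw [← hrot]
    rw [integral_map (by fun_prop) (Continuous.aestronglyMeasurable (by fun_prop))]
    simp only [hDstep]
  have hDcont : ∀ k, Continuous (D k) := fun k => by simp only [hD]; fun_prop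
  have hDI : ∀ k, Integrable (fun p => D k p ^ 2) ((stdGaussian E).prod (stdGaussian E)) := by
    intro k
    refine integrable_prod_of_le_sq ((hDcont k).pow 2) fun p => ?_
    rw [abs_of_nonneg (by positivity)]
    have h1 : D k p ≤ ‖p.1‖ + ‖p.2‖ := by
      refine max_le (by positivity) ?_
      have h2 : ‖(ContinuousLinearMap.rotation (k * h) p).1‖ ≤ ‖p.1‖ + ‖p.2‖ := by
        rw [ContinuousLinearMap.rotation_apply]
        refine (norm_add_le _ _).trans (add_le_add ?_ ?_) <;> rw [norm_smul]
        · exact mul_le_of_le_one_left (norm_nonneg _) (Real.abs_cos_le_one _)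
        · exact mul_le_of_le_one_left (norm_nonneg _) (Real.abs_sin_le_one _)
      linarith [hTle (ContinuousLinearMap.rotation (k * h) p).1,
        norm_nonneg (T (ContinuousLinearMap.rotation ((k + 1 : ℕ) * h) p).1)]
    refine (pow_le_pow_left₀ (hD0 k p) h1 2).trans ?_
    nlinarith [sq_nonneg (‖p.1‖ - ‖p.2‖), sq_nonneg ‖p.1‖, sq_nonneg ‖p.2‖]
  have hpt : ∀ p : E × E, (max 0 (‖T p.1‖ - ‖T p.2‖)) ^ 2 ≤
      n * ∑ k ∈ Finset.range n, D k p ^ 2 := by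
    intro p
    have htel : ‖T p.1‖ - ‖T p.2‖ = ∑ k ∈ Finset.range n,
        (‖T (ContinuousLinearMap.rotation (k * h) p).1‖ -
          ‖T (ContinuousLinearMap.rotation ((k + 1 : ℕ) * h) p).1‖) := by
      rw [Finset.sum_range_sub' (fun k : ℕ => ‖T (ContinuousLinearMap.rotation (k * h) p).1‖)]
      have : (n : ℝ) * h = Real.pi / 2 := by rw [hh]; field_simp
      simp [ContinuousLinearMap.rotation_apply, this]
    have h1 : max 0 (‖T p.1‖ - ‖T p.2‖) ≤ ∑ k ∈ Finset.range n, D k p := by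
      refine max_le (Finset.sum_nonneg fun k _ => hD0 k p) ?_
      rw [htel]
      exact Finset.sum_le_sum fun k _ => le_max_right _ _
    refine (pow_le_pow_left₀ (le_max_left _ _) h1 2).trans ?_
    simpa using sq_sum_le_card_mul_sum_sq (s := Finset.range n) (f := fun k => D k p)
  have hh0 : 0 ≤ h := by positivity
  have hnh : n * h = Real.pi / 2 := by rw [hh]; field_simp
  have hcos : (1 - Real.cos h) ^ 2 ≤ (h ^ 2 / 2) ^ 2 :=
    pow_le_pow_left₀ (by linarith [Real.cos_le_one h])
      (by linarith [Real.one_sub_sq_div_two_le_cos (x := h)]) 2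
  have hsin : Real.sin h ^ 2 ≤ h ^ 2 := by
    rw [sq_le_sq, abs_of_nonneg hh0]
    exact Real.abs_sin_le_abs.trans_eq (abs_of_nonneg hh0)
  calc ∫ p, (max 0 (‖T p.1‖ - ‖T p.2‖)) ^ 2 ∂((stdGaussian E).prod (stdGaussian E))
      ≤ ∫ p, n * ∑ k ∈ Finset.range n, D k p ^ 2 ∂((stdGaussian E).prod (stdGaussian E)) :=
        integral_mono_of_nonneg (Filter.Eventually.of_forall fun _ => by positivity)
          ((integrable_finsetSum _ fun k _ => hDI k).const_mul _)
          (Filter.Eventually.of_forall hpt)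
    _ = n * ∑ k ∈ Finset.range n, ∫ p, D k p ^ 2 ∂((stdGaussian E).prod (stdGaussian E)) := by
        rw [integral_const_mul, integral_finsetSum _ fun k _ => hDI k]
    _ ≤ n * ∑ k ∈ Finset.range n, (2 * (1 - Real.cos h) ^ 2 * V + 2 * Real.sin h ^ 2) := by
        gcongr with k
        exact hDint k
    _ = n * (n * (2 * (1 - Real.cos h) ^ 2 * V + 2 * Real.sin h ^ 2)) := by
        rw [Finset.sum_const, Finset.card_range, nsmul_eq_mul]
    _ ≤ n * (n * (2 * (h ^ 2 / 2) ^ 2 * V + 2 * h ^ 2)) := by gcongr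
    _ = (n * h) ^ 2 * (h ^ 2 * V / 2 + 2) := by ring
    _ ≤ 6 := by
        have hpi : (Real.pi / 2) ^ 2 ≤ 5 / 2 := by nlinarith [Real.pi_lt_d2, Real.pi_pos]
        have h5 : h ^ 2 * V ≤ 5 / 8 := by
          have h6 : h ^ 2 * n ^ 2 ≤ 5 / 2 := by rw [← mul_pow, mul_comm, hnh]; exact hpi
          have h7 : 4 * V ≤ n ^ 2 := by nlinarith
          nlinarith [mul_le_mul_of_nonneg_left h7 (sq_nonneg h)]
        rw [hnh]
        nlinarith [sq_nonneg (Real.pi / 2)]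

/-- A Poincaré inequality: the norm of a Gaussian vector with weak variance at most one has
bounded variance. -/
lemma ProbabilityTheory.integral_norm_sub_mean_sq_stdGaussian_le {E X : Type*}
    [NormedAddCommGroup E] [InnerProductSpace ℝ E] [FiniteDimensional ℝ E] [MeasurableSpace E]
    [BorelSpace E] [NormedAddCommGroup X] [NormedSpace ℝ X] (T : E →L[ℝ] X) (hT : ‖T‖ ≤ 1) :
    ∫ x, (‖T x‖ - ∫ y, ‖T y‖ ∂(stdGaussian E)) ^ 2 ∂(stdGaussian E) ≤ 6 := by
  open MeasureTheory in
  have hTle : ∀ x, ‖T x‖ ≤ ‖x‖ := fun x => (T.le_of_opNorm_le hT x).trans_eq (one_mul _)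
  set γ := stdGaussian E
  have hmem : MemLp (fun x => ‖T x‖) 2 γ :=
    (IsGaussian.memLp_two_id (μ := γ)).mono (by fun_prop)
      (Filter.Eventually.of_forall fun x => by simpa using hTle x)
  have hI : Integrable (fun x => ‖T x‖) γ := hmem.integrable (by norm_num)
  have hI2 : Integrable (fun x => ‖T x‖ ^ 2) γ := hmem.integrable_sq
  set M := ∫ y, ‖T y‖ ∂γ with hM
  have h1 : ∫ x, (‖T x‖ - M) ^ 2 ∂γ = ∫ x, ‖T x‖ ^ 2 ∂γ - M ^ 2 := by
    have : ∀ x, (‖T x‖ - M) ^ 2 = ‖T x‖ ^ 2 - 2 * M * ‖T x‖ + M ^ 2 := fun x => by ring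
    simp only [this]
    have hA : Integrable (fun x => ‖T x‖ ^ 2 - 2 * M * ‖T x‖) γ := hI2.sub (hI.const_mul _)
    rw [integral_add hA (integrable_const _),
      integral_sub hI2 (hI.const_mul _), integral_const_mul, ← hM]
    simp
    ring
  have hpos : ∀ p : E × E, (‖T p.1‖ - ‖T p.2‖) ^ 2 =
      (max 0 (‖T p.1‖ - ‖T p.2‖)) ^ 2 + (max 0 (‖T p.2‖ - ‖T p.1‖)) ^ 2 := by
    intro p
    rcases le_total ‖T p.1‖ ‖T p.2‖ with h | h
    · rw [max_eq_left (sub_nonpos.2 h), max_eq_right (sub_nonneg.2 h)]; ring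
    · rw [max_eq_right (sub_nonneg.2 h), max_eq_left (sub_nonpos.2 h)]; ring
  have hle : ∀ p : E × E, (max 0 (‖T p.1‖ - ‖T p.2‖)) ≤ ‖p.1‖ := fun p =>
    max_le (norm_nonneg _) (by linarith [hTle p.1, norm_nonneg (T p.2)])
  have hposI : Integrable (fun p : E × E => (max 0 (‖T p.1‖ - ‖T p.2‖)) ^ 2) (γ.prod γ) := by
    refine integrable_prod_of_le_sq (by fun_prop) fun p => ?_
    rw [abs_of_nonneg (by positivity)]
    nlinarith [pow_le_pow_left₀ (le_max_left _ _) (hle p) 2, sq_nonneg ‖p.1‖, sq_nonneg ‖p.2‖]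
  have h2 : ∫ p, (‖T p.1‖ - ‖T p.2‖) ^ 2 ∂(γ.prod γ) ≤ 12 := by
    have hswap : ∫ p, (max 0 (‖T p.2‖ - ‖T p.1‖)) ^ 2 ∂(γ.prod γ) =
        ∫ p, (max 0 (‖T p.1‖ - ‖T p.2‖)) ^ 2 ∂(γ.prod γ) :=
      integral_prod_swap (μ := γ) (ν := γ) (fun p : E × E => (max 0 (‖T p.1‖ - ‖T p.2‖)) ^ 2)
    simp only [hpos]
    have hS : Integrable (fun p : E × E => (max 0 (‖T p.2‖ - ‖T p.1‖)) ^ 2) (γ.prod γ) :=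
      hposI.swap
    rw [integral_add hposI hS, hswap]
    linarith [integral_sq_pos_part_sub_le T hT]
  have h3 : ∫ p, (‖T p.1‖ - ‖T p.2‖) ^ 2 ∂(γ.prod γ) =
      2 * ∫ x, ‖T x‖ ^ 2 ∂γ - 2 * M ^ 2 := by
    have : ∀ p : E × E, (‖T p.1‖ - ‖T p.2‖) ^ 2 =
        ‖T p.1‖ ^ 2 + ‖T p.2‖ ^ 2 - 2 * (‖T p.1‖ * ‖T p.2‖) := fun x => by ring
    simp only [this]
    have hF : Integrable (fun p : E × E => ‖T p.1‖ ^ 2) (γ.prod γ) := hI2.comp_fst _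
    have hS : Integrable (fun p : E × E => ‖T p.2‖ ^ 2) (γ.prod γ) := hI2.comp_snd _
    have hP : Integrable (fun p : E × E => 2 * (‖T p.1‖ * ‖T p.2‖)) (γ.prod γ) :=
      (hI.mul_prod hI).const_mul _
    have hB : Integrable (fun p : E × E => ‖T p.1‖ ^ 2 + ‖T p.2‖ ^ 2) (γ.prod γ) := hF.add hS
    rw [integral_sub hB hP, integral_add hF hS, integral_const_mul,
      integral_prod_mul (fun x => ‖T x‖) (fun x => ‖T x‖),
      integral_fun_fst (fun x => ‖T x‖ ^ 2), integral_fun_snd (fun x => ‖T x‖ ^ 2)]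
    simp
    ring
  linarith

open MeasureTheory ProbabilityTheory in
lemma ProbabilityTheory.map_sum_smul_pi_stdGaussian {E : Type*} [NormedAddCommGroup E]
    [InnerProductSpace ℝ E] [FiniteDimensional ℝ E] [MeasurableSpace E] [BorelSpace E] {m : ℕ}
    (a : Fin m → ℝ) :
    (Measure.pi fun _ : Fin m => stdGaussian E).map (fun ω => ∑ j, a j • ω j) =
      (stdGaussian E).map (fun x => √(∑ j, a j ^ 2) • x) := by
  apply Measure.ext_of_charFun
  have hind := iIndepFun_pi (μ := fun _ : Fin m => stdGaussian E)
    (X := fun j x => a j • x) (fun j => by fun_prop)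
  rw [hind.charFun_map_fun_sum_eq_prod (fun j => Measurable.aemeasurable (by fun_prop))]
  ext t
  have h1 : ∀ j, (Measure.pi fun _ : Fin m => stdGaussian E).map (fun ω => a j • ω j) =
      (stdGaussian E).map (fun x => a j • x) := by
    intro j
    have h2 := (measurePreserving_eval (fun _ : Fin m => stdGaussian E) j).map_eq
    conv_rhs => rw [← h2]
    rw [Measure.map_map (by fun_prop) (by fun_prop)]
    rfl
  simp only [Finset.prod_apply, h1, charFun_map_smul, charFun_stdGaussian]
  rw [← Complex.exp_sum]
  congr 1
  simp only [norm_smul, Real.norm_eq_abs]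
  push_cast
  simp only [mul_pow]
  rw [← Finset.sum_div, Finset.sum_neg_distrib, ← Finset.sum_mul]
  congr 3
  norm_cast
  rw [sq_abs, Real.sq_sqrt (Finset.sum_nonneg fun _ _ => sq_nonneg _)]
  simp

/-- Finitely many combinations of suitable vectors simultaneously have nearly the expected norm. -/
lemma exists_forall_norm_sum_smul_close {E X κ : Type*} [NormedAddCommGroup E]
    [InnerProductSpace ℝ E] [FiniteDimensional ℝ E] [MeasurableSpace E] [BorelSpace E]
    [NormedAddCommGroup X] [NormedSpace ℝ X] [Fintype κ] (T : E →L[ℝ] X) (hT : ‖T‖ ≤ 1) {m : ℕ}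
    (a : κ → Fin m → ℝ) :
    ∃ v : Fin m → X, ∀ q,
      (‖∑ j, a q j • v j‖ - √(∑ j, a q j ^ 2) * ∫ x, ‖T x‖ ∂(ProbabilityTheory.stdGaussian E)) ^ 2 ≤
        6 * ∑ q, ∑ j, a q j ^ 2 := by
  open MeasureTheory ProbabilityTheory in
  set γ := stdGaussian E
  set M := ∫ x, ‖T x‖ ∂γ
  set w : κ → ℝ := fun q => √(∑ j, a q j ^ 2)
  have hw2 : ∀ q, w q ^ 2 = ∑ j, a q j ^ 2 := fun q =>
    Real.sq_sqrt (Finset.sum_nonneg fun _ _ => sq_nonneg _)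
  have hw0 : ∀ q, 0 ≤ w q := fun q => Real.sqrt_nonneg _
  set μ := Measure.pi fun _ : Fin m => γ
  have hTle : ∀ x, ‖T x‖ ≤ ‖x‖ := fun x => (T.le_of_opNorm_le hT x).trans_eq (one_mul _)
  have hmem : MemLp (fun x => ‖T x‖) 2 γ :=
    (IsGaussian.memLp_two_id (μ := γ)).mono (by fun_prop)
      (Filter.Eventually.of_forall fun x => by simpa using hTle x)
  have hI : Integrable (fun x => (‖T x‖ - M) ^ 2) γ := (hmem.sub (memLp_const M)).integrable_sq
  have heq : ∀ q x, (‖T (w q • x)‖ - w q * M) ^ 2 = w q ^ 2 * (‖T x‖ - M) ^ 2 := by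
    intro q x
    rw [map_smul, norm_smul, Real.norm_of_nonneg (hw0 q)]
    ring
  have hmap : ∀ q, (γ.map fun x => w q • x) = μ.map (fun ω => ∑ j, a q j • ω j) :=
    fun q => (map_sum_smul_pi_stdGaussian (a q)).symm
  have hInt : ∀ q, Integrable (fun ω : Fin m → E => (‖T (∑ j, a q j • ω j)‖ - w q * M) ^ 2) μ := by
    intro q
    have h1 : Integrable (fun x => (‖T x‖ - w q * M) ^ 2) (γ.map fun x => w q • x) := by
      rw [integrable_map_measure (Continuous.aestronglyMeasurable (by fun_prop)) (by fun_prop)]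
      refine (hI.const_mul (w q ^ 2)).congr (Filter.Eventually.of_forall fun x => ?_)
      exact (heq q x).symm
    rw [hmap, integrable_map_measure (Continuous.aestronglyMeasurable (by fun_prop))
      (Measurable.aemeasurable (by fun_prop))] at h1
    exact h1
  have hval : ∀ q, ∫ ω : Fin m → E, (‖T (∑ j, a q j • ω j)‖ - w q * M) ^ 2 ∂μ ≤ 6 * w q ^ 2 := by
    intro q
    have h1 : ∫ x, (‖T x‖ - w q * M) ^ 2 ∂(γ.map fun x => w q • x) =
        w q ^ 2 * ∫ x, (‖T x‖ - M) ^ 2 ∂γ := by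
      rw [integral_map (by fun_prop) (Continuous.aestronglyMeasurable (by fun_prop))]
      simp only [heq]
      rw [integral_const_mul]
    rw [hmap, integral_map (Measurable.aemeasurable (by fun_prop))
      (Continuous.aestronglyMeasurable (by fun_prop))] at h1
    rw [h1]
    have := integral_norm_sub_mean_sq_stdGaussian_le T hT
    nlinarith [sq_nonneg (w q)]
  obtain ⟨ω, hω⟩ := exists_le_integral
    (integrable_finsetSum Finset.univ fun q _ => hInt q)
  refine ⟨fun j => T (ω j), fun q => ?_⟩
  rw [integral_finsetSum _ fun q _ => hInt q] at hω
  have h2 : ∑ q, ∫ ω : Fin m → E, (‖T (∑ j, a q j • ω j)‖ - w q * M) ^ 2 ∂μ ≤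
      6 * ∑ q, ∑ j, a q j ^ 2 := by
    rw [Finset.mul_sum]
    refine Finset.sum_le_sum fun q _ => ?_
    rw [← hw2]
    exact hval q
  refine le_trans ?_ (hω.trans h2)
  have h3 : ∑ j, a q j • T (ω j) = T (∑ j, a q j • ω j) := by simp
  rw [h3]
  exact Finset.single_le_sum
    (f := fun q => (‖T (∑ j, a q j • ω j)‖ - w q * M) ^ 2) (fun _ _ => sq_nonneg _)
    (Finset.mem_univ q)

lemma norm_add_sum_smul_le_of_norm_add_smul_le {X ι : Type*} [NormedAddCommGroup X]
    [NormedSpace ℝ X] [Fintype ι] {y : X} {v : ι → X} {s : ι → ℝ} {σ B : ℝ} (hσ : 0 < σ)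
    (hy : ‖y‖ ≤ B) (h : ∀ j, s j ≠ 0 → ‖y + σ • v j‖ ≤ B ∧ ‖y - σ • v j‖ ≤ B)
    (hs : ∑ j, |s j| ≤ σ) : ‖y + ∑ j, s j • v j‖ ≤ B := by
  obtain ⟨φ, hφ, hφx⟩ := exists_dual_vector'' ℝ (y + ∑ j, s j • v j)
  have hle : ∀ x, φ x ≤ ‖x‖ := fun x =>
    (le_abs_self _).trans ((φ.le_of_opNorm_le hφ x).trans_eq (one_mul _))
  have hyB : φ y ≤ B := (hle y).trans hy
  have hterm : ∀ j, s j * φ (v j) ≤ |s j| * ((B - φ y) / σ) := by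
    intro j
    by_cases hj : s j = 0
    · simp [hj]
    obtain ⟨h1, h2⟩ := h j hj
    have h3 := (hle _).trans h1
    have h4 := (hle _).trans h2
    simp only [map_add, map_sub, map_smul, smul_eq_mul] at h3 h4
    have h5 : |φ (v j)| ≤ (B - φ y) / σ := by
      rw [le_div_iff₀ hσ]
      refine le_trans (le_of_eq ?_) (abs_le.2 ⟨by linarith, by linarith⟩ : |σ * φ (v j)| ≤ _)
      rw [abs_mul, abs_of_pos hσ, mul_comm]
    calc s j * φ (v j) ≤ |s j| * |φ (v j)| := (le_abs_self _).trans_eq (abs_mul _ _)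
      _ ≤ _ := by gcongr
  have h6 : ‖y + ∑ j, s j • v j‖ = φ y + ∑ j, s j * φ (v j) := by
    have : φ (y + ∑ j, s j • v j) = ‖y + ∑ j, s j • v j‖ := by simpa using hφx
    rw [← this]
    simp
  have h7 : ∑ j, s j * φ (v j) ≤ σ * ((B - φ y) / σ) := by
    refine (Finset.sum_le_sum fun j _ => hterm j).trans ?_
    rw [← Finset.sum_mul]
    exact mul_le_mul_of_nonneg_right hs (div_nonneg (by linarith) hσ.le)
  rw [mul_div_cancel₀ _ hσ.ne'] at h7
  linarith

lemma exists_forall_norm_sub_smul_add_smul_close {E X : Type*} [NormedAddCommGroup E]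
    [InnerProductSpace ℝ E] [FiniteDimensional ℝ E] [MeasurableSpace E] [BorelSpace E]
    [NormedAddCommGroup X] [NormedSpace ℝ X] (T : E →L[ℝ] X) (hT : ‖T‖ ≤ 1) {m : ℕ} (hm : 1 ≤ m)
    {τ σ : ℝ} (hτ : 0 ≤ τ) (hτ1 : τ ≤ 1) (hσ : 0 ≤ σ) (hσ1 : σ ≤ 1) :
    ∃ v : Fin m → X, ∀ k l j, ∀ s₁ s₂ : SignType, k ≠ l → (j ≠ k ∧ j ≠ l ∨ s₂ = 0) →
      |‖v k - (1 + τ * (s₁ : ℝ)) • v l + (σ * (s₂ : ℝ)) • v j‖ -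
        √(1 + (1 + τ * (s₁ : ℝ)) ^ 2 + (σ * (s₂ : ℝ)) ^ 2) *
          ∫ x, ‖T x‖ ∂(ProbabilityTheory.stdGaussian E)| ≤ 32 * (m : ℝ) ^ 2 := by
  classical
  set M := ∫ x, ‖T x‖ ∂(ProbabilityTheory.stdGaussian E)
  have hm1 : (1 : ℝ) ≤ m := by exact_mod_cast hm
  set a : Fin m × Fin m × Fin m × SignType × SignType → Fin m → ℝ := fun q =>
    Pi.single q.1 1 - Pi.single q.2.1 (1 + τ * (q.2.2.2.1 : ℝ)) +
      Pi.single q.2.2.1 (σ * (q.2.2.2.2 : ℝ)) with ha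
  have hsign : ∀ s : SignType, |(s : ℝ)| ≤ 1 := by
    intro s; cases s <;> simp
  have hsingle : ∀ (i : Fin m) (x : ℝ), ∑ j, (Pi.single i x : Fin m → ℝ) j ^ 2 = x ^ 2 := by
    intro i x
    rw [Finset.sum_eq_single i] <;> simp +contextual
  have haw : ∀ q, ∑ j, a q j ^ 2 ≤ 18 := by
    rintro ⟨k, l, j, s₁, s₂⟩
    have h1 := abs_le.1 (hsign s₁)
    have h2 := abs_le.1 (hsign s₂)
    calc ∑ i, a (k, l, j, s₁, s₂) i ^ 2
        ≤ ∑ i, 3 * ((Pi.single k 1 : Fin m → ℝ) i ^ 2 +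
          (Pi.single l (1 + τ * (s₁ : ℝ)) : Fin m → ℝ) i ^ 2 +
          (Pi.single j (σ * (s₂ : ℝ)) : Fin m → ℝ) i ^ 2) := by
          refine Finset.sum_le_sum fun i _ => ?_
          simp only [ha, Pi.add_apply, Pi.sub_apply]
          generalize (Pi.single k 1 : Fin m → ℝ) i = x
          generalize (Pi.single l (1 + τ * (s₁ : ℝ)) : Fin m → ℝ) i = y
          generalize (Pi.single j (σ * (s₂ : ℝ)) : Fin m → ℝ) i = z
          nlinarith [sq_nonneg (x + y), sq_nonneg (y + z), sq_nonneg (x - z)]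
      _ = 3 * (1 + (1 + τ * (s₁ : ℝ)) ^ 2 + (σ * (s₂ : ℝ)) ^ 2) := by
          rw [← Finset.mul_sum, Finset.sum_add_distrib, Finset.sum_add_distrib]
          simp only [hsingle]
          ring
      _ ≤ 18 := by
          have h3 : (1 + τ * (s₁ : ℝ)) ^ 2 ≤ 4 := by
            rw [← sq_abs, show (4 : ℝ) = 2 ^ 2 by norm_num]
            refine pow_le_pow_left₀ (abs_nonneg _) ((abs_add_le _ _).trans ?_) 2
            rw [abs_mul, abs_one, abs_of_nonneg hτ]
            nlinarith [hsign s₁, abs_nonneg (s₁ : ℝ)]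
          have h4 : (σ * (s₂ : ℝ)) ^ 2 ≤ 1 := by
            rw [← sq_abs, abs_mul, abs_of_nonneg hσ]
            exact pow_le_one₀ (by positivity) (mul_le_one₀ hσ1 (abs_nonneg _) (hsign s₂))
          linarith
  obtain ⟨v, hv⟩ := exists_forall_norm_sum_smul_close T hT a
  have hclose : ∀ q, |‖∑ j, a q j • v j‖ - √(∑ j, a q j ^ 2) * M| ≤ 32 * (m : ℝ) ^ 2 := by
    intro q
    refine abs_le_of_sq_le_sq ((hv q).trans ?_) (by positivity)
    have h1 : ∑ q, ∑ j, a q j ^ 2 ≤ 9 * (m : ℝ) ^ 3 * 18 := by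
      refine (Finset.sum_le_card_nsmul _ _ _ fun q _ => haw q).trans_eq ?_
      have : Fintype.card SignType = 3 := rfl
      simp [this]
      ring
    have h2 : (m : ℝ) ^ 3 ≤ m ^ 4 := pow_le_pow_right₀ hm1 (by norm_num)
    nlinarith
  have hcomb : ∀ k l j s₁ s₂, ∑ i, a (k, l, j, s₁, s₂) i • v i =
      v k - (1 + τ * (s₁ : ℝ)) • v l + (σ * (s₂ : ℝ)) • v j := by
    intro k l j s₁ s₂
    simp only [ha, Pi.add_apply, Pi.sub_apply, add_smul, sub_smul, Finset.sum_add_distrib,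
      Finset.sum_sub_distrib]
    simp [Pi.single_apply, ite_smul, add_smul]
  have hmul : ∀ (k l : Fin m) (x y : ℝ) i, (k ≠ l ∨ y = 0) →
      (Pi.single k x : Fin m → ℝ) i * (Pi.single l y : Fin m → ℝ) i = 0 := by
    rintro k l x y i (h | rfl)
    · rcases eq_or_ne i k with rfl | hik
      · simp [h]
      · simp [hik]
    · simp
  have hweight : ∀ k l j s₁ s₂, k ≠ l → (j ≠ k ∧ j ≠ l ∨ s₂ = 0) →
      ∑ i, a (k, l, j, s₁, s₂) i ^ 2 =
        1 + (1 + τ * (s₁ : ℝ)) ^ 2 + (σ * (s₂ : ℝ)) ^ 2 := by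
    intro k l j s₁ s₂ hkl hj
    have h1 : ∀ i, a (k, l, j, s₁, s₂) i ^ 2 = (Pi.single k 1 : Fin m → ℝ) i ^ 2 +
          (Pi.single l (1 + τ * (s₁ : ℝ)) : Fin m → ℝ) i ^ 2 +
          (Pi.single j (σ * (s₂ : ℝ)) : Fin m → ℝ) i ^ 2 := by
      intro i
      have h2 := hmul k l 1 (1 + τ * (s₁ : ℝ)) i (Or.inl hkl)
      have h3 := hmul k j 1 (σ * (s₂ : ℝ)) i (hj.imp (fun h => h.1.symm) fun h => by simp [h])
      have h4 := hmul l j (1 + τ * (s₁ : ℝ)) (σ * (s₂ : ℝ)) i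
        (hj.imp (fun h => h.2.symm) fun h => by simp [h])
      simp only [ha, Pi.add_apply, Pi.sub_apply]
      linear_combination (-2) * h2 + 2 * h3 - 2 * h4
    simp only [h1, Finset.sum_add_distrib, hsingle]
    ring
  refine ⟨v, fun k l j s₁ s₂ hkl hj => ?_⟩
  have h1 := hclose (k, l, j, s₁, s₂)
  rwa [hcomb, hweight _ _ _ _ _ hkl hj] at h1

/-- If the expected norm of a Gaussian vector is large compared to its weak variance, then
independent copies can be perturbed to an equilateral set. -/
lemma exists_equidistant_of_le_integral_norm {E X : Type*} [NormedAddCommGroup E]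
    [InnerProductSpace ℝ E] [FiniteDimensional ℝ E] [MeasurableSpace E] [BorelSpace E]
    [NormedAddCommGroup X] [NormedSpace ℝ X] (T : E →L[ℝ] X) (hT : ‖T‖ ≤ 1) {m : ℕ} (hm : 1 ≤ m)
    (hM : 500000 * (m : ℝ) ^ 4 ≤ ∫ x, ‖T x‖ ∂(ProbabilityTheory.stdGaussian E)) :
    ∃ d : ℝ, 0 < d ∧ ∃ p : Fin m → X, ∀ k l, k ≠ l → ‖p k - p l‖ = d := by
  classical
  set M := ∫ x, ‖T x‖ ∂(ProbabilityTheory.stdGaussian E)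
  have hm1 : (1 : ℝ) ≤ m := by exact_mod_cast hm
  have hM0 : 0 < M := lt_of_lt_of_le (by positivity) hM
  set B := √2 * M with hB
  have hBM : M ≤ B := le_mul_of_one_le_left hM0.le (Real.one_le_sqrt.2 (by norm_num))
  have hB0 : 0 < B := hM0.trans_le hBM
  set τ : ℝ := 1 / (80 * (m : ℝ) ^ 2) with hτ
  have hτ0 : 0 < τ := by positivity
  have hτm : τ * (80 * (m : ℝ) ^ 2) = 1 := by rw [hτ]; field_simp
  have hm2 : (1 : ℝ) ≤ (m : ℝ) ^ 2 := one_le_pow₀ hm1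
  have hτ1 : τ ≤ 1 / 80 := by nlinarith
  set σ : ℝ := 2 * τ * m with hσ
  have hσ0 : 0 < σ := by positivity
  have hσ1 : σ ≤ 1 := by nlinarith
  set D : ℝ := 32 * (m : ℝ) ^ 2 with hD
  have hsign : ∀ s : SignType, |(s : ℝ)| ≤ 1 := by
    intro s; cases s <;> simp
  obtain ⟨v, hclose⟩ := exists_forall_norm_sub_smul_add_smul_close T hT hm hτ0.le
    (hτ1.trans (by norm_num)) hσ0.le hσ1
  have hsqrt : ∀ x : ℝ, -2 ≤ x → √(2 + x) * M ≤ B * (1 + x / 4) := by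
    intro x hx
    rw [hB, mul_right_comm]
    refine mul_le_mul_of_nonneg_right ?_ hM0.le
    refine Real.sqrt_le_iff.2 ⟨mul_nonneg (Real.sqrt_nonneg _) (by linarith), ?_⟩
    rw [mul_pow, Real.sq_sqrt (by norm_num)]
    nlinarith [sq_nonneg x]
  set e : ℝ := B * (τ ^ 2 + σ ^ 2) / 4 + D with he
  have herr : e + 2 * D ≤ B / 2 * (τ / 2) / 8 := by
    have h1 : τ ^ 2 + σ ^ 2 ≤ τ / 16 := by
      have : σ ^ 2 = 4 * τ * (τ * m ^ 2) := by rw [hσ]; ring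
      have h2 : τ * (m : ℝ) ^ 2 = 1 / 80 := by linarith
      rw [this, h2]
      nlinarith
    have h3 : 3 * D ≤ B * τ / 64 := by
      have h4 : 500000 * (m : ℝ) ^ 4 * τ ≤ B * τ := by
        gcongr
        exact hM.trans hBM
      have h5 : 500000 * (m : ℝ) ^ 4 * τ = 6250 * (m : ℝ) ^ 2 := by
        linear_combination 6250 * (m : ℝ) ^ 2 * hτm
      rw [h5] at h4
      rw [hD]
      nlinarith [sq_nonneg (m : ℝ)]
    have h6 := mul_le_mul_of_nonneg_left h1 hB0.le
    rw [he]
    nlinarith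
  have hend : ∀ k l, l ≠ k → ∀ s : Fin m → ℝ, s k = 0 → s l = 0 → (∀ j, |s j| ≤ 2 * τ) →
      ∀ ε : SignType, |(ε : ℝ)| = 1 →
      ‖v k - (1 + τ * (ε : ℝ)) • v l + ∑ j, s j • v j‖ ≤ B * (1 + τ * ε / 2) + e := by
    intro k l hlk s hsk hsl hs ε hε
    have hε2 : (ε : ℝ) ^ 2 = 1 := by rw [← sq_abs, hε, one_pow]
    have hε1 := abs_le.1 hε.le
    have hbound : ∀ j s₂, (j ≠ k ∧ j ≠ l ∨ s₂ = 0) →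
        ‖v k - (1 + τ * (ε : ℝ)) • v l + (σ * ((s₂ : SignType) : ℝ)) • v j‖ ≤
          B * (1 + τ * ε / 2) + e := by
      intro j s₂ hj
      have h1 := hclose k l j ε s₂ hlk.symm hj
      have h2 := (abs_le.1 h1).2
      have h3 : (σ * (s₂ : ℝ)) ^ 2 ≤ σ ^ 2 := by
        rw [mul_pow]
        refine mul_le_of_le_one_right (sq_nonneg _) ?_
        rw [← sq_abs]
        exact pow_le_one₀ (abs_nonneg _) (hsign s₂)
      have h4 := hsqrt (2 * τ * ε + τ ^ 2 + (σ * (s₂ : ℝ)) ^ 2)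
        (by nlinarith [sq_nonneg τ, sq_nonneg (σ * (s₂ : ℝ))])
      have h5 : 1 + (1 + τ * (ε : ℝ)) ^ 2 + (σ * (s₂ : ℝ)) ^ 2 =
          2 + (2 * τ * ε + τ ^ 2 + (σ * (s₂ : ℝ)) ^ 2) := by
        linear_combination τ ^ 2 * hε2
      rw [h5] at h2
      have h6 := mul_le_mul_of_nonneg_left h3 hB0.le
      rw [he]
      linarith
    refine norm_add_sum_smul_le_of_norm_add_smul_le hσ0 ?_ ?_ ?_
    · simpa using hbound k 0 (Or.inr rfl)
    · intro j hj
      have hj' : j ≠ k ∧ j ≠ l := ⟨fun h => hj (h ▸ hsk), fun h => hj (h ▸ hsl)⟩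
      have h1 := hbound j 1 (Or.inl hj')
      have h2 := hbound j (-1) (Or.inl hj')
      refine ⟨by simpa using h1, by simpa [sub_eq_add_neg] using h2⟩
    · refine (Finset.sum_le_card_nsmul _ _ _ fun j _ => hs j).trans_eq ?_
      simp [hσ]
      ring
  have hupper : ∀ k l, l ≠ k → ∀ (t : ℝ) (s : Fin m → ℝ), |t| ≤ τ → s k = 0 → s l = 0 →
      (∀ j, |s j| ≤ 2 * τ) →
      ‖v k - (1 + t) • v l + ∑ j, s j • v j‖ ≤ B * (1 + t / 2) + e := by
    intro k l hlk t s ht hsk hsl hs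
    have h1 := hend k l hlk s hsk hsl hs 1 (by simp)
    have h2 := hend k l hlk s hsk hsl hs (-1) (by simp)
    obtain ⟨ht1, ht2⟩ := abs_le.1 ht
    set α := (τ + t) / (2 * τ) with hα
    have hα0 : 0 ≤ α := div_nonneg (by linarith) (by linarith)
    have hα1 : α ≤ 1 := (div_le_one (by linarith)).2 (by linarith)
    have hαt : t = α * τ - (1 - α) * τ := by rw [hα]; field_simp; ring
    have h3 : v k - (1 + t) • v l + ∑ j, s j • v j =
        α • (v k - (1 + τ * ((1 : SignType) : ℝ)) • v l + ∑ j, s j • v j) +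
        (1 - α) • (v k - (1 + τ * ((-1 : SignType) : ℝ)) • v l + ∑ j, s j • v j) := by
      rw [hαt]
      simp only [SignType.coe_one, SignType.coe_neg]
      module
    rw [h3]
    refine (norm_add_le _ _).trans ?_
    rw [norm_smul, norm_smul, Real.norm_of_nonneg hα0, Real.norm_of_nonneg (by linarith)]
    refine (add_le_add (mul_le_mul_of_nonneg_left h1 hα0)
      (mul_le_mul_of_nonneg_left h2 (by linarith))).trans_eq ?_
    rw [hαt]
    simp only [SignType.coe_one, SignType.coe_neg]
    ring
  refine ⟨B, hB0, exists_equidistant_of_norm_close v (L := B / 2) (r := τ / 2) (t₀ := 0)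
    (by positivity) (by positivity) ?_⟩
  intro k l hlk t s ht hsk hsl hs
  rw [sub_zero, mul_div_cancel₀ _ two_ne_zero] at ht
  have hs' : ∀ j, |s j| ≤ 2 * τ := fun j => (hs j).trans_eq (by rw [abs_zero]; ring)
  have h1 := hupper k l hlk t s ht hsk hsl hs'
  have h2 := hupper k l hlk (-t) (-s) (by rwa [abs_neg]) (by simp [hsk]) (by simp [hsl])
    (by simpa using hs')
  have h3 := hclose k l k 0 0 hlk.symm (Or.inr rfl)
  have h4 : (1 : ℝ) + (1 + τ * ((0 : SignType) : ℝ)) ^ 2 + (σ * ((0 : SignType) : ℝ)) ^ 2 = 2 := by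
    simp; norm_num
  rw [h4] at h3
  have h5 : 2 * ‖v k - v l‖ ≤ ‖v k - (1 + t) • v l + ∑ j, s j • v j‖ +
      ‖v k - (1 + -t) • v l + ∑ j, (-s) j • v j‖ := by
    have : (2 : ℝ) • (v k - v l) = (v k - (1 + t) • v l + ∑ j, s j • v j) +
        (v k - (1 + -t) • v l + ∑ j, (-s) j • v j) := by
      simp only [Pi.neg_apply, neg_smul, Finset.sum_neg_distrib]
      module
    calc 2 * ‖v k - v l‖ = ‖(2 : ℝ) • (v k - v l)‖ := by rw [norm_smul]; simp
      _ ≤ _ := by rw [this]; exact norm_add_le _ _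
  have h6 := (abs_le.1 h3).1
  simp only [SignType.coe_zero, mul_zero, add_zero, one_smul, zero_smul] at h6
  rw [abs_le]
  constructor <;> linarith

lemma Submodule.det_id_add_starProjection {E : Type*} [NormedAddCommGroup E]
    [InnerProductSpace ℝ E] [FiniteDimensional ℝ E] (V : Submodule ℝ E) :
    LinearMap.det ((ContinuousLinearMap.id ℝ E + V.starProjection : E →L[ℝ] E) : E →ₗ[ℝ] E) =
      2 ^ Module.finrank ℝ V := by
  set f : E →ₗ[ℝ] E := ((ContinuousLinearMap.id ℝ E + V.starProjection : E →L[ℝ] E) : E →ₗ[ℝ] E)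
  have hf : ∀ x, f x = x + V.starProjection x := fun x => by simp [f]
  have hfV : ∀ x ∈ V, f x = (2 : ℝ) • x := fun x hx => by
    rw [hf, V.starProjection_eq_self_iff.2 hx, two_smul]
  have hV : V ≤ V.comap f := fun x hx => by
    rw [Submodule.mem_comap, hfV x hx]
    exact V.smul_mem _ hx
  rw [LinearMap.det_eq_det_mul_det V f hV]
  have h1 : f.restrict hV = (2 : ℝ) • LinearMap.id := by
    ext x
    simp [hfV x x.2]
  have h2 : V.mapQ V f hV = LinearMap.id := by
    ext x
    simp only [LinearMap.comp_apply, Submodule.mkQ_apply, Submodule.mapQ_apply, LinearMap.id_apply]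
    rw [Submodule.Quotient.eq, hf, add_sub_cancel_left]
    exact V.starProjection_apply_mem x
  rw [h1, h2, LinearMap.det_smul, LinearMap.det_id, LinearMap.det_id, mul_one, mul_one]

/-- A linear contraction from a Euclidean space of maximal volume cannot be small on a subspace of
more than half the dimension. -/
lemma exists_le_norm_apply_of_isMaxOn_det {E X : Type*} [NormedAddCommGroup E]
    [InnerProductSpace ℝ E] [FiniteDimensional ℝ E] [NormedAddCommGroup X] [NormedSpace ℝ X]
    (e : X →L[ℝ] E) {T : E →L[ℝ] X} (hT : ‖T‖ ≤ 1) (hdet : (e.comp T).det ≠ 0)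
    (hmax : ∀ S : E →L[ℝ] X, ‖S‖ ≤ 1 → |(e.comp S).det| ≤ |(e.comp T).det|)
    (V : Submodule ℝ E) (hV : Module.finrank ℝ E < 2 * Module.finrank ℝ V) :
    ∃ u ∈ V, ‖u‖ = 1 ∧ 1 / 2 ≤ ‖T u‖ := by
  by_contra! hcon
  have hTle : ∀ x, ‖T x‖ ≤ ‖x‖ := fun x => (T.le_of_opNorm_le hT x).trans_eq (one_mul _)
  have hTV : ∀ x ∈ V, ‖T x‖ ≤ ‖x‖ / 2 := by
    intro x hx
    rcases eq_or_ne x 0 with rfl | hx0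
    · simp
    have hn : 0 < ‖x‖ := norm_pos_iff.2 hx0
    have h1 := hcon (‖x‖⁻¹ • x) (V.smul_mem _ hx) (by simp [norm_smul, hn.ne'])
    rw [map_smul, norm_smul, norm_inv, norm_norm, ← div_eq_inv_mul, div_lt_iff₀ hn] at h1
    linarith
  set P := V.starProjection
  set c : ℝ := (√2)⁻¹ with hc
  have hc0 : 0 < c := by positivity
  have hc2 : c ^ 2 = 1 / 2 := by rw [hc, inv_pow, Real.sq_sqrt (by norm_num)]; norm_num
  set A : E →L[ℝ] E := c • (ContinuousLinearMap.id ℝ E + P) with hA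
  have hS : ‖T.comp A‖ ≤ 1 := by
    refine ContinuousLinearMap.opNorm_le_bound _ zero_le_one fun x => ?_
    rw [one_mul]
    set p := P x with hp
    set q := Vᗮ.starProjection x with hq
    have hx : p + q = x := V.starProjection_add_starProjection_orthogonal x
    have hx2 : ‖x‖ ^ 2 = ‖p‖ ^ 2 + ‖q‖ ^ 2 := V.norm_sq_eq_add_norm_sq_starProjection x
    have h1 : (T.comp A) x = c • ((2 : ℝ) • T p + T q) := by
      have : A x = c • ((2 : ℝ) • p + q) := by
        simp only [hA, smul_apply, add_apply,
          ContinuousLinearMap.id_apply]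
        rw [← hp, two_smul]
        nth_rewrite 1 [← hx]
        congr 1
        abel
      rw [ContinuousLinearMap.comp_apply, this]
      simp
    have h2 : ‖(2 : ℝ) • T p + T q‖ ≤ ‖p‖ + ‖q‖ := by
      refine (norm_add_le _ _).trans (add_le_add ?_ (hTle q))
      rw [norm_smul, Real.norm_ofNat]
      linarith [hTV p (V.starProjection_apply_mem x)]
    rw [h1, norm_smul, Real.norm_of_nonneg hc0.le]
    refine abs_le_of_sq_le_sq' ?_ (norm_nonneg _) |>.2
    have h3 := pow_le_pow_left₀ (norm_nonneg _) h2 2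
    rw [mul_pow, hc2, hx2]
    nlinarith [sq_nonneg (‖p‖ - ‖q‖)]
  have h1 := hmax _ hS
  have h2 : (e.comp (T.comp A)).det = (e.comp T).det * A.det := by
    exact LinearMap.det_comp ((e.comp T : E →L[ℝ] E) : E →ₗ[ℝ] E) (A : E →ₗ[ℝ] E)
  have h3 : 1 < A.det := by
    have h4 : A.det = c ^ Module.finrank ℝ E * 2 ^ Module.finrank ℝ V := by
      rw [ContinuousLinearMap.det, hA, ContinuousLinearMap.toLinearMap_smul, LinearMap.det_smul,
        V.det_id_add_starProjection]
    have h5 : 1 < A.det ^ 2 := by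
      rw [h4, mul_pow, ← pow_mul, mul_comm _ 2, pow_mul, hc2, ← pow_mul, mul_comm _ 2, one_div,
        inv_pow, ← div_eq_inv_mul, one_lt_div (by positivity)]
      exact pow_lt_pow_right₀ (by norm_num) hV
    have h6 : 0 ≤ A.det := by rw [h4]; positivity
    exact (one_lt_sq_iff₀ h6).1 h5
  rw [h2, abs_mul] at h1
  have h4 : 0 < |(e.comp T).det| := abs_pos.2 hdet
  have h5 := le_abs_self A.det
  nlinarith

/-- A form of the Dvoretzky–Rogers lemma. -/
lemma exists_contraction_half_le_norm_apply_single (X : Type*) [NormedAddCommGroup X]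
    [NormedSpace ℝ X] [FiniteDimensional ℝ X] :
    ∃ N : ℕ, Module.finrank ℝ X ≤ 2 * N ∧ ∃ T : EuclideanSpace ℝ (Fin N) →L[ℝ] X,
      ‖T‖ ≤ 1 ∧ ∀ i, 1 / 2 ≤ ‖T (EuclideanSpace.single i 1)‖ := by
  set n := Module.finrank ℝ X with hn
  let E := EuclideanSpace ℝ (Fin n)
  have hE : Module.finrank ℝ E = n := by simp [E]
  let e : X ≃L[ℝ] E := ContinuousLinearEquiv.ofFinrankEq hE.symm
  have : ProperSpace (E →L[ℝ] X) := FiniteDimensional.proper_real _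
  have hcont : Continuous fun S : E →L[ℝ] X => |((e : X →L[ℝ] E).comp S).det| :=
    (ContinuousLinearMap.continuous_det.comp (by fun_prop)).abs
  obtain ⟨T, hT, hmax⟩ := (isCompact_closedBall (0 : E →L[ℝ] X) 1).exists_isMaxOn
    ⟨0, by simp⟩ hcont.continuousOn
  rw [mem_closedBall_zero_iff] at hT
  have hmax' : ∀ S : E →L[ℝ] X, ‖S‖ ≤ 1 →
      |((e : X →L[ℝ] E).comp S).det| ≤ |((e : X →L[ℝ] E).comp T).det| :=
    fun S hS => hmax (mem_closedBall_zero_iff.2 hS)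
  have hdet : ((e : X →L[ℝ] E).comp T).det ≠ 0 := by
    set c : ℝ := (‖(e.symm : E →L[ℝ] X)‖ + 1)⁻¹ with hc
    have hc0 : 0 < c := by positivity
    have h1 := hmax' (c • (e.symm : E →L[ℝ] X)) (by
      rw [norm_smul, Real.norm_of_nonneg hc0.le, hc, ← div_eq_inv_mul, div_le_one (by positivity)]
      linarith)
    have h2 : (e : X →L[ℝ] E).comp (c • (e.symm : E →L[ℝ] X)) =
        c • ContinuousLinearMap.id ℝ E := by
      ext x
      simp
    have h3 : ((e : X →L[ℝ] E).comp (c • (e.symm : E →L[ℝ] X))).det = c ^ n := by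
      rw [h2, ContinuousLinearMap.det, ContinuousLinearMap.toLinearMap_smul, LinearMap.det_smul, hE,
        ContinuousLinearMap.coe_id, LinearMap.det_id, mul_one]
    rw [h3] at h1
    intro h4
    rw [h4, abs_zero] at h1
    have : 0 < c ^ n := by positivity
    linarith [le_abs_self (c ^ n)]
  have hgreedy : ∀ k : ℕ, 2 * k ≤ n + 1 → ∃ u : Fin k → E, Orthonormal ℝ u ∧
      ∀ i, 1 / 2 ≤ ‖T (u i)‖ := by
    intro k
    induction k with
    | zero => exact fun _ => ⟨Fin.elim0, ⟨fun i => i.elim0, fun i => i.elim0⟩, fun i => i.elim0⟩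
    | succ k ih =>
      intro hk
      obtain ⟨u, hu, huT⟩ := ih (by omega)
      set U := Submodule.span ℝ (Set.range u) with hU
      have h1 : Module.finrank ℝ U = k := by
        rw [hU, finrank_span_eq_card hu.linearIndependent, Fintype.card_fin]
      have h2 := U.finrank_add_finrank_orthogonal
      obtain ⟨w, hw, hw1, hwT⟩ := exists_le_norm_apply_of_isMaxOn_det (e : X →L[ℝ] E) hT hdet hmax'
        Uᗮ (by omega)
      refine ⟨Matrix.vecCons w u, orthonormal_vecCons_iff.2 ⟨hw1, fun i => ?_, hu⟩, fun i => ?_⟩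
      · have hi : u i ∈ U := Submodule.subset_span ⟨i, rfl⟩
        exact Submodule.inner_left_of_mem_orthogonal hi hw
      · refine Fin.cases ?_ (fun i => ?_) i
        · simpa using hwT
        · simpa using huT i
  obtain ⟨u, hu, huT⟩ := hgreedy ((n + 1) / 2) (by omega)
  refine ⟨(n + 1) / 2, by omega, ?_⟩
  set J : EuclideanSpace ℝ (Fin ((n + 1) / 2)) →ₗ[ℝ] E :=
    (Fintype.linearCombination ℝ u) ∘ₗ (WithLp.linearEquiv 2 ℝ (Fin ((n + 1) / 2) → ℝ)).toLinearMap
  have hJ : ∀ x, J x = ∑ i, x i • u i := fun x => rfl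
  have hJn : ∀ x, ‖J x‖ = ‖x‖ := by
    intro x
    rw [← sq_eq_sq₀ (norm_nonneg _) (norm_nonneg _), ← real_inner_self_eq_norm_sq, hJ,
      hu.inner_sum, EuclideanSpace.real_norm_sq_eq]
    simp [sq]
  set J' := J.mkContinuous 1 (fun x => by rw [hJn, one_mul])
  refine ⟨T.comp J', ?_, fun i => ?_⟩
  · exact (ContinuousLinearMap.opNorm_comp_le _ _).trans
      (mul_le_one₀ hT (norm_nonneg _) (J.mkContinuous_norm_le zero_le_one _))
  · have : J' (EuclideanSpace.single i 1) = u i := by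
      change J (EuclideanSpace.single i 1) = u i
      rw [hJ]
      simp
    rw [ContinuousLinearMap.comp_apply, this]
    exact huT i

lemma ProbabilityTheory.integral_abs_gaussianReal_pos :
    0 < ∫ x, |x| ∂(gaussianReal 0 1) := by
  open MeasureTheory in
  have hInt : Integrable (fun x : ℝ => |x|) (gaussianReal 0 1) :=
    ((memLp_id_gaussianReal 1).integrable (by norm_num)).abs
  rw [integral_pos_iff_support_of_nonneg (fun x => abs_nonneg x) hInt]
  have h1 : Function.support (fun x : ℝ => |x|) = {0}ᶜ := by
    ext x
    simp
  have : NullSingletonClass (gaussianReal 0 1) := nullSingletonClass_gaussianReal one_ne_zero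
  rw [h1, prob_compl_eq_one_sub (measurableSet_singleton 0), measure_singleton]
  simp

open MeasureTheory ProbabilityTheory in
/-- Rademacher averages are dominated by Gaussian averages. -/
lemma integral_abs_mul_sum_norm_le {ι X : Type*} [Fintype ι] [DecidableEq ι] [NormedAddCommGroup X]
    [NormedSpace ℝ X] [FiniteDimensional ℝ X] (x : ι → X) :
    (∫ t, |t| ∂(gaussianReal 0 1)) * ∑ ε : ι → ℤˣ, ‖∑ i, ((ε i : ℤ) : ℝ) • x i‖ ≤
      Fintype.card (ι → ℤˣ) *
        ∫ g : ι → ℝ, ‖∑ i, g i • x i‖ ∂(Measure.pi fun _ => gaussianReal 0 1) := by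
  set μ := Measure.pi fun _ : ι => gaussianReal 0 1
  set c := ∫ t, |t| ∂(gaussianReal 0 1)
  have hc0 : 0 ≤ c := integral_nonneg fun _ => abs_nonneg _
  have habs : Integrable (fun x : ℝ => |x|) (gaussianReal 0 1) :=
    ((memLp_id_gaussianReal 1).integrable (by norm_num)).abs
  have hcoord : ∀ i, Integrable (fun g : ι → ℝ => |g i|) μ := fun i =>
    (measurePreserving_eval (fun _ : ι => gaussianReal 0 1) i).integrable_comp_of_integrable habs
  have hcoordval : ∀ i, ∫ g : ι → ℝ, |g i| ∂μ = c := fun i =>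
    integral_comp_eval (μ := fun _ : ι => gaussianReal 0 1) (i := i) habs.aestronglyMeasurable
  have hvec : ∀ ε : ι → ℤˣ, Integrable (fun g : ι → ℝ => ∑ i, (((ε i : ℤ) : ℝ) * |g i|) • x i) μ :=
    fun ε => integrable_finsetSum _ fun i _ => ((hcoord i).const_mul _).smul_const _
  have hsign : ∀ ε : ι → ℤˣ, ∫ g : ι → ℝ, ‖∑ i, (((ε i : ℤ) : ℝ) * g i) • x i‖ ∂μ =
      ∫ g : ι → ℝ, ‖∑ i, g i • x i‖ ∂μ := by
    intro ε
    have hmp : MeasurePreserving (fun (g : ι → ℝ) i => ((ε i : ℤ) : ℝ) * g i) μ μ := by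
      refine measurePreserving_pi _ _ fun i => ⟨by fun_prop, ?_⟩
      rw [gaussianReal_map_const_mul]
      rcases Int.units_eq_one_or (ε i) with h | h <;> simp [h]
    conv_rhs => rw [← hmp.map_eq]
    rw [integral_map hmp.measurable.aemeasurable (Continuous.aestronglyMeasurable (by fun_prop))]
  have hInt : ∀ ε : ι → ℤˣ, Integrable (fun g : ι → ℝ => ‖∑ i, (((ε i : ℤ) : ℝ) * g i) • x i‖) μ := by
    intro ε
    refine Integrable.norm (integrable_finsetSum _ fun i _ => Integrable.smul_const ?_ _)
    refine Integrable.const_mul ?_ _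
    exact (hcoord i).mono (Measurable.aestronglyMeasurable (by fun_prop)) (by simp)
  have hpt : ∀ g : ι → ℝ, ∑ ε : ι → ℤˣ, ‖∑ i, (((ε i : ℤ) : ℝ) * g i) • x i‖ =
      ∑ ε : ι → ℤˣ, ‖∑ i, (((ε i : ℤ) : ℝ) * |g i|) • x i‖ := by
    intro g
    set s : ι → ℤˣ := fun i => if g i < 0 then -1 else 1 with hs
    rw [← Equiv.sum_comp (Equiv.mulRight s)]
    refine Finset.sum_congr rfl fun ε _ => ?_
    congr 1
    refine Finset.sum_congr rfl fun i _ => ?_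
    congr 1
    simp only [Equiv.coe_mulRight, Pi.mul_apply, Units.val_mul, Int.cast_mul, hs]
    split_ifs with h
    · rw [abs_of_neg h]; simp
    · rw [abs_of_nonneg (not_lt.1 h)]; simp
  calc c * ∑ ε : ι → ℤˣ, ‖∑ i, ((ε i : ℤ) : ℝ) • x i‖
      = ∑ ε : ι → ℤˣ, ‖∫ g : ι → ℝ, ∑ i, (((ε i : ℤ) : ℝ) * |g i|) • x i ∂μ‖ := by
        rw [Finset.mul_sum]
        refine Finset.sum_congr rfl fun ε _ => ?_
        rw [integral_finsetSum _ fun i _ => ((hcoord i).const_mul _).smul_const _]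
        simp only [integral_smul_const, integral_const_mul, hcoordval]
        rw [← Real.norm_of_nonneg hc0, ← norm_smul, Real.norm_of_nonneg hc0, Finset.smul_sum]
        simp only [smul_smul, mul_comm c]
    _ ≤ ∑ ε : ι → ℤˣ, ∫ g : ι → ℝ, ‖∑ i, (((ε i : ℤ) : ℝ) * |g i|) • x i‖ ∂μ :=
        Finset.sum_le_sum fun ε _ => norm_integral_le_integral_norm _
    _ = ∫ g : ι → ℝ, ∑ ε : ι → ℤˣ, ‖∑ i, (((ε i : ℤ) : ℝ) * |g i|) • x i‖ ∂μ :=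
        (integral_finsetSum _ fun ε _ => (hvec ε).norm).symm
    _ = ∑ ε : ι → ℤˣ, ∫ g : ι → ℝ, ‖∑ i, (((ε i : ℤ) : ℝ) * g i) • x i‖ ∂μ := by
        simp only [← hpt]
        exact integral_finsetSum _ fun ε _ => hInt ε
    _ = _ := by
        simp only [hsign, Finset.sum_const, Finset.card_univ, nsmul_eq_mul]

lemma sum_norm_sum_mem_le {ι X : Type*} [Fintype ι] [DecidableEq ι] [NormedAddCommGroup X]
    [NormedSpace ℝ X] (x : ι → X) (A : Finset ι) :
    ∑ ε : ι → ℤˣ, ‖∑ i ∈ A, ((ε i : ℤ) : ℝ) • x i‖ ≤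
      ∑ ε : ι → ℤˣ, ‖∑ i, ((ε i : ℤ) : ℝ) • x i‖ := by
  set δ : ι → ℤˣ := fun i => if i ∈ A then 1 else -1 with hδ
  have h1 : ∀ ε : ι → ℤˣ, 2 * ‖∑ i ∈ A, ((ε i : ℤ) : ℝ) • x i‖ ≤
      ‖∑ i, ((ε i : ℤ) : ℝ) • x i‖ + ‖∑ i, (((ε * δ) i : ℤ) : ℝ) • x i‖ := by
    intro ε
    have h2 : (2 : ℝ) • ∑ i ∈ A, ((ε i : ℤ) : ℝ) • x i =
        ∑ i, ((ε i : ℤ) : ℝ) • x i + ∑ i, (((ε * δ) i : ℤ) : ℝ) • x i := by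
      rw [← Finset.sum_add_distrib, ← Finset.sum_subset (Finset.subset_univ A), Finset.smul_sum]
      · refine Finset.sum_congr rfl fun i hi => ?_
        simp [hδ, hi, two_smul]
      · intro i _ hi
        simp [hδ, hi]
    calc _ = ‖(2 : ℝ) • ∑ i ∈ A, ((ε i : ℤ) : ℝ) • x i‖ := by rw [norm_smul]; simp
      _ ≤ _ := by rw [h2]; exact norm_add_le _ _
  have h3 := Finset.sum_le_sum fun (ε : ι → ℤˣ) (_ : ε ∈ Finset.univ) => h1 ε
  rw [← Finset.mul_sum, Finset.sum_add_distrib] at h3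
  have h4 := Equiv.sum_comp (Equiv.mulRight δ) fun ε : ι → ℤˣ => ‖∑ i, ((ε i : ℤ) : ℝ) • x i‖
  simp only [Equiv.coe_mulRight] at h4
  linarith

lemma ciSup_add_abs_add_ciSup_sub_abs_le {Φ : Type*} [Nonempty Φ] {a b : Φ → ℝ}
    (h₁ : BddAbove (Set.range fun φ => a φ + b φ)) (h₂ : BddAbove (Set.range fun φ => a φ - b φ)) :
    (⨆ φ, (a φ + |b φ|)) + (⨆ φ, (a φ - |b φ|)) ≤ (⨆ φ, (a φ + b φ)) + ⨆ φ, (a φ - b φ) := by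
  rw [← le_sub_iff_add_le]
  refine ciSup_le fun φ => ?_
  rw [le_sub_comm]
  refine ciSup_le fun ψ => ?_
  have h3 := le_ciSup h₁
  have h4 := le_ciSup h₂
  rcases abs_cases (b φ) with ⟨h, -⟩ | ⟨h, -⟩
  · linarith [h3 φ, h4 ψ, le_abs_self (b ψ)]
  · linarith [h4 φ, h3 ψ, neg_abs_le (b ψ)]

/-- Replacing one function by its absolute value does not increase a Rademacher average. -/
lemma sum_ciSup_update_abs_le {ι Φ : Type*} [Fintype ι] [DecidableEq ι] [Nonempty Φ]
    (f : ι → Φ → ℝ) {C : ℝ} (hf : ∀ i φ, |f i φ| ≤ C) (k : ι) :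
    ∑ ε : ι → ℤˣ, ⨆ φ, ∑ i, ((ε i : ℤ) : ℝ) * Function.update f k (fun φ => |f k φ|) i φ ≤
      ∑ ε : ι → ℤˣ, ⨆ φ, ∑ i, ((ε i : ℤ) : ℝ) * f i φ := by
  have hbdd : ∀ ε : ι → ℤˣ, BddAbove (Set.range fun φ => ∑ i, ((ε i : ℤ) : ℝ) * f i φ) := by
    intro ε
    refine ⟨∑ i : ι, C, ?_⟩
    rintro _ ⟨φ, rfl⟩
    refine Finset.sum_le_sum fun i _ => (le_abs_self _).trans ?_
    rw [abs_mul]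
    rcases Int.units_eq_one_or (ε i) with h | h <;> simpa [h] using hf i φ
  set δ : ι → ℤˣ := Function.update 1 k (-1) with hδ
  have key : ∀ ε : ι → ℤˣ,
      (⨆ φ, ∑ i, ((ε i : ℤ) : ℝ) * Function.update f k (fun φ => |f k φ|) i φ) +
      (⨆ φ, ∑ i, (((ε * δ) i : ℤ) : ℝ) * Function.update f k (fun φ => |f k φ|) i φ) ≤
      (⨆ φ, ∑ i, ((ε i : ℤ) : ℝ) * f i φ) + ⨆ φ, ∑ i, (((ε * δ) i : ℤ) : ℝ) * f i φ := by
    intro ε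
    set a : Φ → ℝ := fun φ => ∑ i ∈ Finset.univ.erase k, ((ε i : ℤ) : ℝ) * f i φ with ha
    have h1 : ∀ φ, ∑ i, ((ε i : ℤ) : ℝ) * f i φ = a φ + ((ε k : ℤ) : ℝ) * f k φ :=
      fun φ => (Finset.sum_erase_add _ _ (Finset.mem_univ k)).symm
    have hcongr : ∀ φ, ∑ i ∈ Finset.univ.erase k, (((ε * δ) i : ℤ) : ℝ) * f i φ = a φ := by
      intro φ
      refine Finset.sum_congr rfl fun i hi => ?_
      simp [hδ, Finset.ne_of_mem_erase hi]
    have h2 : ∀ φ, ∑ i, (((ε * δ) i : ℤ) : ℝ) * f i φ = a φ - ((ε k : ℤ) : ℝ) * f k φ := by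
      intro φ
      rw [← Finset.sum_erase_add _ _ (Finset.mem_univ k), hcongr]
      simp [hδ, sub_eq_add_neg]
    have h3 : ∀ φ, ∑ i, ((ε i : ℤ) : ℝ) * Function.update f k (fun φ => |f k φ|) i φ =
        a φ + ((ε k : ℤ) : ℝ) * |f k φ| := by
      intro φ
      rw [← Finset.sum_erase_add _ _ (Finset.mem_univ k), Function.update_self]
      congr 1
      refine Finset.sum_congr rfl fun i hi => ?_
      rw [Function.update_of_ne (Finset.ne_of_mem_erase hi)]
    have h4 : ∀ φ, ∑ i, (((ε * δ) i : ℤ) : ℝ) * Function.update f k (fun φ => |f k φ|) i φ =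
        a φ - ((ε k : ℤ) : ℝ) * |f k φ| := by
      intro φ
      rw [← Finset.sum_erase_add _ _ (Finset.mem_univ k), Function.update_self, ← hcongr φ]
      simp only [sub_eq_add_neg]
      congr 1
      · refine Finset.sum_congr rfl fun i hi => ?_
        rw [Function.update_of_ne (Finset.ne_of_mem_erase hi)]
      · simp [hδ]
    have hb1 := hbdd ε
    have hb2 := hbdd (ε * δ)
    simp only [h1, h2] at hb1 hb2
    simp only [h1, h2, h3, h4]
    rcases Int.units_eq_one_or (ε k) with h | h
    · simp only [h, Units.val_one, Int.cast_one, one_mul] at hb1 hb2 ⊢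
      exact ciSup_add_abs_add_ciSup_sub_abs_le hb1 hb2
    · simp only [h, Units.val_neg, Units.val_one, Int.cast_neg, Int.cast_one, neg_mul, one_mul,
        sub_neg_eq_add, ← sub_eq_add_neg] at hb1 hb2 ⊢
      linarith [ciSup_add_abs_add_ciSup_sub_abs_le hb2 hb1]
  have h5 := Finset.sum_le_sum fun (ε : ι → ℤˣ) (_ : ε ∈ Finset.univ) => key ε
  rw [Finset.sum_add_distrib, Finset.sum_add_distrib] at h5
  have h6 := Equiv.sum_comp (Equiv.mulRight δ) fun ε : ι → ℤˣ =>
    ⨆ φ, ∑ i, ((ε i : ℤ) : ℝ) * f i φ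
  have h7 := Equiv.sum_comp (Equiv.mulRight δ) fun ε : ι → ℤˣ =>
    ⨆ φ, ∑ i, ((ε i : ℤ) : ℝ) * Function.update f k (fun φ => |f k φ|) i φ
  simp only [Equiv.coe_mulRight] at h6 h7
  linarith

/-- A contraction principle for Rademacher averages. -/
lemma sum_ciSup_abs_le {ι Φ : Type*} [Fintype ι] [DecidableEq ι] [Nonempty Φ]
    (f : ι → Φ → ℝ) {C : ℝ} (hf : ∀ i φ, |f i φ| ≤ C) :
    ∑ ε : ι → ℤˣ, ⨆ φ, ∑ i, ((ε i : ℤ) : ℝ) * |f i φ| ≤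
      ∑ ε : ι → ℤˣ, ⨆ φ, ∑ i, ((ε i : ℤ) : ℝ) * f i φ := by
  have key : ∀ B : Finset ι,
      ∑ ε : ι → ℤˣ, ⨆ φ, ∑ i, ((ε i : ℤ) : ℝ) * (if i ∈ B then |f i φ| else f i φ) ≤
      ∑ ε : ι → ℤˣ, ⨆ φ, ∑ i, ((ε i : ℤ) : ℝ) * f i φ := by
    intro B
    induction B using Finset.induction_on with
    | empty => simp
    | insert k B hk ih =>
      refine le_trans (le_of_eq ?_) ((sum_ciSup_update_abs_le
        (fun i φ => if i ∈ B then |f i φ| else f i φ) (C := C) (fun i φ => ?_) k).trans ih)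
      · refine Finset.sum_congr rfl fun ε _ => iSup_congr fun φ => Finset.sum_congr rfl fun i _ => ?_
        rcases eq_or_ne i k with rfl | hik
        · simp [hk]
        · simp [hik]
      · split_ifs
        · simpa using hf i φ
        · exact hf i φ
  simpa using key Finset.univ

section Halving

variable {ι X : Type*} [Fintype ι] [DecidableEq ι] [NormedAddCommGroup X] [NormedSpace ℝ X]

/-- If the Rademacher average of a family is small, then one half of the family has essentially
half the weak `ℓ¹` norm. -/
lemma exists_subset_sum_abs_le (x : ι → X) {R W : ℝ} (A : Finset ι)
    (hR : ∑ ε : ι → ℤˣ, ‖∑ i ∈ A, ((ε i : ℤ) : ℝ) • x i‖ ≤ Fintype.card (ι → ℤˣ) * R)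
    (hW : ∀ φ : StrongDual ℝ X, ‖φ‖ ≤ 1 → ∑ i ∈ A, |φ (x i)| ≤ W) :
    ∃ A' ⊆ A, A.card ≤ 2 * A'.card ∧
      ∀ φ : StrongDual ℝ X, ‖φ‖ ≤ 1 → ∑ i ∈ A', |φ (x i)| ≤ W / 2 + R := by
  let Φ := {φ : StrongDual ℝ X // ‖φ‖ ≤ 1}
  have : Nonempty Φ := ⟨⟨0, by simp⟩⟩
  have hφ : ∀ (φ : Φ) y, |φ.1 y| ≤ ‖y‖ := fun φ y =>
    (φ.1.le_of_opNorm_le φ.2 y).trans_eq (one_mul _)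
  set f : ι → Φ → ℝ := fun i φ => if i ∈ A then φ.1 (x i) else 0 with hf
  set S : (ι → ℤˣ) → ℝ := fun ε => ⨆ φ, ∑ i, ((ε i : ℤ) : ℝ) * |f i φ| with hS
  have hfC : ∀ i φ, |f i φ| ≤ ∑ i, ‖x i‖ := by
    intro i φ
    refine le_trans ?_ (Finset.single_le_sum (f := fun i => ‖x i‖) (fun i _ => norm_nonneg _)
      (Finset.mem_univ i))
    simp only [hf]
    split_ifs
    · exact hφ φ _
    · simp
  have hSsum : ∑ ε, S ε ≤ Fintype.card (ι → ℤˣ) * R := by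
    refine ((sum_ciSup_abs_le f hfC).trans (Finset.sum_le_sum fun ε _ => ?_)).trans hR
    refine ciSup_le fun φ => ?_
    have : ∑ i, ((ε i : ℤ) : ℝ) * f i φ = φ.1 (∑ i ∈ A, ((ε i : ℤ) : ℝ) • x i) := by
      simp [hf, mul_ite]
    rw [this]
    exact (le_abs_self _).trans (hφ φ _)
  have hbdd : ∀ ε : ι → ℤˣ, BddAbove (Set.range fun φ => ∑ i, ((ε i : ℤ) : ℝ) * |f i φ|) := by
    intro ε
    refine ⟨∑ i : ι, ∑ i, ‖x i‖, ?_⟩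
    rintro _ ⟨φ, rfl⟩
    refine Finset.sum_le_sum fun i _ => (le_abs_self _).trans ?_
    rw [abs_mul]
    rcases Int.units_eq_one_or (ε i) with h | h <;> simpa [h] using hfC i φ
  have hSle : ∀ ε (φ : Φ), ∑ i ∈ A, ((ε i : ℤ) : ℝ) * |φ.1 (x i)| ≤ S ε := by
    intro ε φ
    refine le_trans (le_of_eq ?_) (le_ciSup (hbdd ε) φ)
    simp only [hf, apply_ite abs, abs_zero, mul_ite, mul_zero, Finset.sum_ite_mem,
      Finset.univ_inter]
  have hS0 : ∀ ε, 0 ≤ S ε := by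
    intro ε
    simpa using hSle ε ⟨0, by simp⟩
  have hneg : ∑ ε : ι → ℤˣ, S (-ε) = ∑ ε, S ε := Equiv.sum_comp (Equiv.neg (ι → ℤˣ)) S
  obtain ⟨ε, hε⟩ : ∃ ε, S ε + S (-ε) ≤ 2 * R := by
    by_contra! hcon
    have h1 := Finset.sum_lt_sum_of_nonempty (s := (Finset.univ : Finset (ι → ℤˣ)))
      Finset.univ_nonempty fun ε _ => hcon ε
    rw [Finset.sum_add_distrib, hneg, Finset.sum_const, Finset.card_univ, nsmul_eq_mul] at h1
    linarith
  have hhalf : ∀ ε : ι → ℤˣ, S ε ≤ 2 * R → ∀ φ : StrongDual ℝ X, ‖φ‖ ≤ 1 →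
      ∑ i ∈ A with ε i = 1, |φ (x i)| ≤ W / 2 + R := by
    intro ε hε φ hφ1
    have h1 := hSle ε ⟨φ, hφ1⟩
    have h2 := hW φ hφ1
    have h3 : 2 * ∑ i ∈ A with ε i = 1, |φ (x i)| =
        ∑ i ∈ A, |φ (x i)| + ∑ i ∈ A, ((ε i : ℤ) : ℝ) * |φ (x i)| := by
      rw [Finset.sum_filter, Finset.mul_sum, ← Finset.sum_add_distrib]
      refine Finset.sum_congr rfl fun i _ => ?_
      rcases Int.units_eq_one_or (ε i) with h | h
      · simp [h, two_mul]
      · simp [h]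
    simp only at h1
    linarith
  have hcard : A.card ≤ (A.filter fun i => ε i = 1).card + (A.filter fun i => (-ε) i = 1).card := by
    rw [← Finset.card_filter_add_card_filter_not (s := A) (fun i => ε i = 1)]
    gcongr with i
    intro h
    rw [Pi.neg_apply, (Int.units_eq_one_or (ε i)).resolve_left h, neg_neg]
  rcases le_total (A.filter fun i => (-ε) i = 1).card (A.filter fun i => ε i = 1).card with h | h
  · exact ⟨_, Finset.filter_subset _ _, by omega, hhalf ε (by linarith [hS0 (-ε)])⟩
  · exact ⟨_, Finset.filter_subset _ _, by omega, hhalf (-ε) (by linarith [hS0 ε])⟩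

lemma exists_card_sum_abs_le (x : ι → X) {R W : ℝ}
    (hR : ∀ A : Finset ι,
      ∑ ε : ι → ℤˣ, ‖∑ i ∈ A, ((ε i : ℤ) : ℝ) • x i‖ ≤ Fintype.card (ι → ℤˣ) * R)
    (hW : ∀ φ : StrongDual ℝ X, ‖φ‖ ≤ 1 → ∑ i, |φ (x i)| ≤ W) (j : ℕ) :
    ∃ A : Finset ι, Fintype.card ι ≤ 2 ^ j * A.card ∧
      ∀ φ : StrongDual ℝ X, ‖φ‖ ≤ 1 → ∑ i ∈ A, |φ (x i)| ≤ W / 2 ^ j + 2 * R := by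
  have hR0 : 0 ≤ R := by
    have h1 := hR ∅
    simp only [Finset.sum_empty, norm_zero, Finset.sum_const_zero] at h1
    exact nonneg_of_mul_nonneg_right h1 (by exact_mod_cast Fintype.card_pos)
  induction j with
  | zero => exact ⟨Finset.univ, by simp, fun φ hφ => by linarith [hW φ hφ]⟩
  | succ j ih =>
    obtain ⟨A, hA, hAW⟩ := ih
    obtain ⟨A', -, hA', hAW'⟩ := exists_subset_sum_abs_le x A (hR A) hAW
    refine ⟨A', ?_, fun φ hφ => (hAW' φ hφ).trans_eq ?_⟩
    · calc Fintype.card ι ≤ 2 ^ j * A.card := hA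
        _ ≤ 2 ^ j * (2 * A'.card) := by gcongr
        _ = _ := by ring
    · rw [pow_succ]
      field_simp
      ring

end Halving

open ProbabilityTheory in
/-- If a Gaussian vector built from large vectors has small expected norm, then many of the vectors
satisfy an upper `ℓ_∞` estimate. -/
lemma UpperSupFamily.of_integral_norm {X : Type*} [NormedAddCommGroup X] [NormedSpace ℝ X]
    [FiniteDimensional ℝ X] {N k : ℕ} (hk : 1 ≤ k) (hN : 4 * k ^ 2 ≤ N)
    (T : EuclideanSpace ℝ (Fin N) →L[ℝ] X) (hT : ‖T‖ ≤ 1)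
    (hTe : ∀ i, 1 / 2 ≤ ‖T (EuclideanSpace.single i 1)‖) :
    UpperSupFamily X (4 + 4 * ((∫ x, ‖T x‖ ∂(stdGaussian (EuclideanSpace ℝ (Fin N)))) /
      ∫ t, |t| ∂(gaussianReal 0 1))) k := by
  set c := ∫ t, |t| ∂(gaussianReal 0 1)
  have hc : 0 < c := integral_abs_gaussianReal_pos
  set M := ∫ x, ‖T x‖ ∂(stdGaussian (EuclideanSpace ℝ (Fin N))) with hM
  set x : Fin N → X := fun i => T (EuclideanSpace.single i 1) with hx
  have hTx : ∀ a : Fin N → ℝ, T (WithLp.toLp 2 a) = ∑ i, a i • x i := by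
    intro a
    have : WithLp.toLp 2 a = ∑ i, a i • EuclideanSpace.single i (1 : ℝ) := by
      ext j
      simp [Pi.single_apply]
    rw [this]
    simp [hx]
  have hMpi : M = ∫ g : Fin N → ℝ, ‖∑ i, g i • x i‖
      ∂(MeasureTheory.Measure.pi fun _ => gaussianReal 0 1) := by
    rw [hM, ← map_pi_eq_stdGaussian, MeasureTheory.integral_map
      (Measurable.aemeasurable (by fun_prop)) (Continuous.aestronglyMeasurable (by fun_prop))]
    simp only [hTx]
  have hR : ∀ A : Finset (Fin N), ∑ ε : Fin N → ℤˣ, ‖∑ i ∈ A, ((ε i : ℤ) : ℝ) • x i‖ ≤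
      Fintype.card (Fin N → ℤˣ) * (M / c) := by
    intro A
    refine (sum_norm_sum_mem_le x A).trans ?_
    have h1 := integral_abs_mul_sum_norm_le x
    rw [← hMpi] at h1
    rw [← mul_div_assoc, le_div_iff₀ hc, mul_comm]
    exact h1
  have hW : ∀ φ : StrongDual ℝ X, ‖φ‖ ≤ 1 → ∑ i, |φ (x i)| ≤ √N := by
    intro φ hφ
    set a : Fin N → ℝ := fun i => SignType.sign (φ (x i)) with ha
    have h1 : ∑ i, |φ (x i)| = φ (T (WithLp.toLp 2 a)) := by
      rw [hTx]
      simp [ha, sign_mul_self]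
    have h2 : ‖(WithLp.toLp 2 a : EuclideanSpace ℝ (Fin N))‖ ≤ √N := by
      rw [EuclideanSpace.norm_eq]
      refine Real.sqrt_le_sqrt ?_
      calc ∑ i, ‖(WithLp.toLp 2 a : EuclideanSpace ℝ (Fin N)) i‖ ^ 2 ≤ ∑ i : Fin N, (1 : ℝ) := by
            refine Finset.sum_le_sum fun i _ => pow_le_one₀ (norm_nonneg _) ?_
            simp only [ha, Real.norm_eq_abs]
            cases SignType.sign (φ (x i)) <;> simp
        _ = N := by simp
    rw [h1]
    calc φ (T (WithLp.toLp 2 a)) ≤ ‖φ (T (WithLp.toLp 2 a))‖ := le_abs_self _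
      _ ≤ 1 * ‖T (WithLp.toLp 2 a)‖ := φ.le_of_opNorm_le hφ _
      _ ≤ 1 * (1 * ‖(WithLp.toLp 2 a : EuclideanSpace ℝ (Fin N))‖) := by
          gcongr
          exact T.le_of_opNorm_le hT _
      _ ≤ √N := by linarith
  have hN0 : N ≠ 0 := by
    have : 1 ≤ k ^ 2 := Nat.one_le_pow _ _ hk
    omega
  set j := Nat.log 4 N with hj
  have hj1 : 4 ^ j ≤ N := Nat.pow_log_le_self 4 hN0
  have hj2 : N < 4 ^ (j + 1) := Nat.lt_pow_succ_log_self (by norm_num) N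
  obtain ⟨A, hA, hAW⟩ := exists_card_sum_abs_le x hR hW j
  have h4 : 4 ^ j = 2 ^ j * 2 ^ j := by
    rw [← mul_pow]
    norm_num
  have hkA : k ≤ A.card := by
    have h1 : 2 ^ j ≤ A.card := by
      rw [Fintype.card_fin] at hA
      rw [h4] at hj1
      exact Nat.le_of_mul_le_mul_left (hj1.trans hA) (by positivity)
    refine le_trans (le_of_lt ?_) h1
    rw [pow_succ, h4] at hj2
    by_contra! h
    have h5 := Nat.mul_le_mul h h
    rw [sq] at hN
    omega
  have hsqrt : √N / 2 ^ j ≤ 2 := by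
    rw [div_le_iff₀ (by positivity)]
    refine Real.sqrt_le_iff.2 ⟨by positivity, ?_⟩
    have : (N : ℝ) < 4 ^ (j + 1) := by exact_mod_cast hj2
    refine this.le.trans_eq ?_
    rw [mul_pow, ← pow_mul, mul_comm j 2, pow_mul, pow_succ]
    norm_num
    ring
  obtain ⟨e⟩ : Nonempty (Fin k ↪ A) := Function.Embedding.nonempty_of_card_le (by simpa using hkA)
  refine UpperSupFamily.of_injective (ι := A) (fun i => (2 : ℝ) • x i) (fun i => ?_)
    (fun a ha => ?_) e
  · rw [norm_smul, Real.norm_ofNat]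
    linarith [hTe i]
  · obtain ⟨φ, hφ, hφx⟩ := exists_dual_vector'' ℝ (∑ i : A, a i • (2 : ℝ) • x i)
    have h1 : φ (∑ i : A, a i • (2 : ℝ) • x i) = ‖∑ i : A, a i • (2 : ℝ) • x i‖ := by
      simpa using hφx
    rw [← h1, map_sum]
    calc ∑ i : A, φ (a i • (2 : ℝ) • x i) ≤ ∑ i : A, 2 * |φ (x i)| := by
          refine Finset.sum_le_sum fun i _ => ?_
          simp only [map_smul, smul_eq_mul]
          calc a i * (2 * φ (x i)) ≤ |a i * (2 * φ (x i))| := le_abs_self _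
            _ = |a i| * (2 * |φ (x i)|) := by rw [abs_mul, abs_mul, abs_two]
            _ ≤ _ := mul_le_of_le_one_left (by positivity) (ha i)
      _ = 2 * ∑ i ∈ A, |φ (x i)| := by
          rw [← Finset.mul_sum, Finset.sum_coe_sort A fun i => |φ (x i)|]
      _ ≤ _ := by linarith [hAW φ hφ]

/-- An `n`-dimensional normed space contains `m` equidistant points as soon as `log n` is at least
an absolute constant times `(log m) ^ 2`. -/
lemma exists_const_equidistant_of_sq_log_le :
    ∃ K : ℝ, 0 < K ∧ ∀ (X : Type*) [NormedAddCommGroup X] [NormedSpace ℝ X]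
      [FiniteDimensional ℝ X] (m : ℕ), 2 ≤ m → 0 < Module.finrank ℝ X →
      K * Real.log m ^ 2 ≤ Real.log (Module.finrank ℝ X) →
      ∃ d : ℝ, 0 < d ∧ ∃ p : Fin m → X, ∀ k l, k ≠ l → ‖p k - p l‖ = d := by
  set c := ∫ t, |t| ∂(ProbabilityTheory.gaussianReal 0 1) with hc
  have hc0 : 0 < c := ProbabilityTheory.integral_abs_gaussianReal_pos
  set B : ℝ := 4 + 2000000 / c with hB
  have hB4 : 4 ≤ B := le_add_of_nonneg_right (by positivity)
  have hlogB : 0 ≤ Real.log B := Real.log_nonneg (by linarith)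
  have hlog2 : 0 < Real.log 2 := Real.log_pos one_lt_two
  set a : ℝ := Real.log B / Real.log 2 + 4 with ha
  have ha4 : 4 ≤ a := le_add_of_nonneg_left (by positivity)
  set q : ℝ := 1 + 1 / 96 with hq
  have hq0 : 0 < q := by norm_num [hq]
  have hlogq : 0 < Real.log q := Real.log_pos (by norm_num [hq])
  have hlogq1 : Real.log q ≤ 1 := by
    have := Real.log_le_sub_one_of_pos hq0
    rw [hq] at this ⊢
    linarith
  refine ⟨3 / Real.log 2 + 4 * (a / Real.log q), by positivity, ?_⟩
  intro X _ _ _ m hm hn hK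
  obtain ⟨N, hN, T, hT, hTe⟩ := exists_contraction_half_le_norm_apply_single X
  by_cases hM : 500000 * (m : ℝ) ^ 4 ≤
      ∫ x, ‖T x‖ ∂(ProbabilityTheory.stdGaussian (EuclideanSpace ℝ (Fin N)))
  · exact exists_equidistant_of_le_integral_norm T hT (by omega) hM
  push Not at hM
  have hm0 : (0 : ℝ) < m := by exact_mod_cast (by omega : 0 < m)
  have hm2 : (2 : ℝ) ≤ m := by exact_mod_cast hm
  set L := Real.log m with hL
  have hL2 : Real.log 2 ≤ L := Real.log_le_log two_pos hm2
  have hL0 : 0 < L := hlog2.trans_le hL2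
  set x : ℝ := a * L / Real.log q with hx
  have hx1 : 1 ≤ x := by
    rw [hx, one_le_div₀ hlogq]
    nlinarith [Real.log_two_gt_d9]
  obtain ⟨i, hi1, hi2⟩ := exists_nat_pow_near hx1 (one_lt_two (α := ℝ))
  have hj : (2 : ℝ) ^ (i + 1) ≤ 2 * x := by
    rw [pow_succ]
    linarith
  have hcard : 4 * (m ^ 2 ^ (i + 1)) ^ 2 ≤ N := by
    have h1 : (8 : ℝ) * (m ^ 2 ^ (i + 1)) ^ 2 ≤ Module.finrank ℝ X := by
      have hn' : (0 : ℝ) < Module.finrank ℝ X := by exact_mod_cast hn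
      rw [← Real.log_le_log_iff (by positivity) hn']
      refine le_trans ?_ hK
      rw [Real.log_mul (by norm_num) (by positivity), Real.log_pow, Real.log_pow,
        show (8 : ℝ) = 2 ^ 3 by norm_num, Real.log_pow]
      push_cast
      have h2 : 3 * Real.log 2 ≤ 3 / Real.log 2 * L ^ 2 := by
        rw [div_mul_eq_mul_div, le_div_iff₀ hlog2]
        nlinarith
      have h3 : 2 * ((2 : ℝ) ^ (i + 1) * L) ≤ 4 * (a / Real.log q) * L ^ 2 := by
        calc 2 * ((2 : ℝ) ^ (i + 1) * L) ≤ 2 * ((2 * x) * L) := by gcongr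
          _ = _ := by
            rw [hx]
            ring
      rw [add_mul]
      exact add_le_add h2 h3
    have h2 : 8 * (m ^ 2 ^ (i + 1)) ^ 2 ≤ Module.finrank ℝ X := by exact_mod_cast h1
    omega
  have hC : 4 + 4 * ((∫ x, ‖T x‖ ∂(ProbabilityTheory.stdGaussian (EuclideanSpace ℝ (Fin N)))) / c)
      ≤ q ^ 2 ^ (i + 1) := by
    have hm4 : (1 : ℝ) ≤ (m : ℝ) ^ 4 := one_le_pow₀ (by linarith)
    calc 4 + 4 * ((∫ x, ‖T x‖ ∂(ProbabilityTheory.stdGaussian (EuclideanSpace ℝ (Fin N)))) / c)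
        ≤ 4 * (m : ℝ) ^ 4 + 4 * ((500000 * (m : ℝ) ^ 4) / c) := by
          gcongr
          linarith
      _ = B * (m : ℝ) ^ 4 := by
          rw [hB]
          ring
      _ ≤ q ^ 2 ^ (i + 1) := by
          rw [← Real.log_le_log_iff (by positivity) (by positivity),
            Real.log_mul (by positivity) (by positivity), Real.log_pow, Real.log_pow]
          push_cast
          calc Real.log B + 4 * L ≤ a * L := by
                rw [ha, add_mul, div_mul_eq_mul_div]
                gcongr
                rw [le_div_iff₀ hlog2]
                gcongr
            _ = x * Real.log q := by
                rw [hx]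
                field_simp
            _ ≤ _ := by gcongr
  have hfam := (UpperSupFamily.of_integral_norm (Nat.one_le_pow _ _ (by omega)) hcard T hT
    hTe).mono_right hC
  exact ⟨5 / 4, by norm_num, (UpperSupFamily.of_pow hq0 (i + 1) hfam).exists_equidistant⟩

lemma exists_isEquilateral_card_eq {X : Type*} [NormedAddCommGroup X] {m : ℕ} {d : ℝ} (hd : 0 < d)
    (p : Fin m → X) (hp : ∀ k l, k ≠ l → ‖p k - p l‖ = d) :
    ∃ S : Finset X, IsEquilateral (S : Set X) ∧ S.card = m := by
  have hinj : Function.Injective p := fun k l hkl => by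
    by_contra h
    have := hp k l h
    rw [hkl, sub_self, norm_zero] at this
    exact hd.ne this
  refine ⟨Finset.univ.map ⟨p, hinj⟩, ⟨d, hd, ?_⟩, by simp⟩
  intro x hx y hy hxy
  simp only [Finset.coe_map, Function.Embedding.coeFn_mk, Finset.coe_univ, Set.image_univ,
    Set.mem_range] at hx hy
  obtain ⟨k, rfl⟩ := hx
  obtain ⟨l, rfl⟩ := hy
  exact hp k l (ne_of_apply_ne p hxy)

/-- There is an absolute constant `c > 0` such that every `n`-dimensional real normed
space (`n ≥ 1`) contains an equilateral set of at least `exp (c √(log n))` points,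
i.e. its equilateral number is at least `exp (c √(log n))`. -/
theorem equilateral_number_ge_exp_sqrt_log :
    ∃ c : ℝ, 0 < c ∧
      ∀ (X : Type*) [NormedAddCommGroup X] [NormedSpace ℝ X] [FiniteDimensional ℝ X]
        (n : ℕ), 1 ≤ n → Module.finrank ℝ X = n →
        ∃ S : Finset X, IsEquilateral (S : Set X) ∧
          Real.exp (c * Real.sqrt (Real.log n)) ≤ (S.card : ℝ) := by
  obtain ⟨K, hK, h⟩ := exists_const_equidistant_of_sq_log_le
  refine ⟨1 / (2 * √K), by positivity, ?_⟩
  intro X _ _ _ n hn hX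
  set s := √(Real.log n) / √K with hs
  have hs0 : 0 ≤ s := by positivity
  have hexp : 1 / (2 * √K) * √(Real.log n) = s / 2 := by
    rw [hs]
    ring
  have hsq : Real.exp (s / 2) * Real.exp (s / 2) = Real.exp s := by
    rw [← Real.exp_add, add_halves]
  have hone : 1 ≤ Real.exp (s / 2) := Real.one_le_exp (by positivity)
  rw [hexp]
  rcases lt_or_ge (Real.exp s) 2 with hlt | hge
  · have : Nontrivial X := Module.nontrivial_of_finrank_pos (R := ℝ) (by omega)
    obtain ⟨x, hx⟩ := exists_ne (0 : X)
    obtain ⟨S, hS, hcard⟩ := exists_isEquilateral_card_eq (norm_pos_iff.2 hx) ![0, x] (by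
      intro k l hkl
      fin_cases k <;> fin_cases l <;> simp_all)
    refine ⟨S, hS, ?_⟩
    rw [hcard]
    push_cast
    nlinarith
  · have hm : 2 ≤ ⌊Real.exp s⌋₊ := Nat.le_floor (by exact_mod_cast hge)
    have hle : (⌊Real.exp s⌋₊ : ℝ) ≤ Real.exp s := Nat.floor_le (Real.exp_pos s).le
    have hm2 : (2 : ℝ) ≤ ⌊Real.exp s⌋₊ := by exact_mod_cast hm
    obtain ⟨d, hd, p, hp⟩ := h X ⌊Real.exp s⌋₊ hm (by omega) (by
      have hlog : Real.log ⌊Real.exp s⌋₊ ≤ s :=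
        (Real.log_le_iff_le_exp (by linarith)).2 hle
      have hlog0 : 0 ≤ Real.log ⌊Real.exp s⌋₊ := Real.log_nonneg (by linarith)
      calc K * Real.log ⌊Real.exp s⌋₊ ^ 2 ≤ K * s ^ 2 := by gcongr
        _ = Real.log (Module.finrank ℝ X) := by
          rw [hs, div_pow, Real.sq_sqrt hK.le, Real.sq_sqrt (Real.log_natCast_nonneg n), hX]
          field_simp)
    obtain ⟨S, hS, hcard⟩ := exists_isEquilateral_card_eq hd p hp
    refine ⟨S, hS, ?_⟩
    rw [hcard]
    have hlt := Nat.lt_floor_add_one (Real.exp s)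
    nlinarith
end

section
/- Let X be an n-dimensional real normed space whose Banach–Mazur distance to ℓ∞^n satisfies d(X, ℓ∞^n) ≤ 3/2. Then e(X) ≥ n + 1, i.e., X contains an equilateral set of n + 1 points. -/
/-- The Banach–Mazur distance `d(X, Y) = inf ‖T‖ ‖T⁻¹‖`, the infimum taken over all
(continuous) linear isomorphisms `T : X → Y`. -/
noncomputable def BMdist (X Y : Type*) [NormedAddCommGroup X] [NormedSpace ℝ X]
    [NormedAddCommGroup Y] [NormedSpace ℝ Y] : ℝ :=
  sInf {r : ℝ | ∃ T : X ≃L[ℝ] Y, r = ‖(T : X →L[ℝ] Y)‖ * ‖(T.symm : Y →L[ℝ] X)‖}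

open Set Filter Topology

/-- The vertex with `k`-th coordinate `y k` for `k < j`, `j`-th coordinate `-b`, and all later
coordinates zero. -/
def simplexPoint {n : ℕ} (j : ℕ) (b : ℝ) (y : Fin n → ℝ) : Fin n → ℝ :=
  fun k => if (k : ℕ) < j then y k else if (k : ℕ) = j then -b else 0

lemma continuous_simplexPoint {n : ℕ} (j : ℕ) (b : ℝ) :
    Continuous (simplexPoint (n := n) j b) := by
  refine continuous_pi fun k => ?_
  unfold simplexPoint
  split_ifs <;> fun_prop

lemma norm_simplexPoint_sub_le {n : ℕ} (j : ℕ) {b b' : ℝ} {y y' : Fin n → ℝ} {r : ℝ}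
    (hr : 0 ≤ r) (hb : |b - b'| ≤ r) (hy : ‖y - y'‖ ≤ r) :
    ‖simplexPoint j b y - simplexPoint j b' y'‖ ≤ r := by
  rw [pi_norm_le_iff_of_nonneg hr] at hy ⊢
  intro k
  have hk := hy k
  simp only [simplexPoint, Pi.sub_apply, Real.norm_eq_abs] at hk ⊢
  split_ifs
  · exact hk
  · rwa [neg_sub_neg, abs_sub_comm]
  · simpa using hr

section

variable {X : Type*} [NormedAddCommGroup X] [NormedSpace ℝ X] {n : ℕ}

/-- If `w` and `w'` have norm one and `w` is dominated by its `i`-th coordinate, then moving from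
`w` to `w'` cannot increase the `i`-th coordinate by more than the other ones change. -/
lemma apply_sub_le_of_norm_map_eq_one (S : (Fin n → ℝ) →L[ℝ] X) (hS : ∀ v, ‖S v‖ ≤ ‖v‖)
    {w w' : Fin n → ℝ} {i : Fin n} {δ : ℝ} (hδ : 0 ≤ δ) (hw : ‖S w‖ = 1) (hw' : ‖S w'‖ = 1)
    (h1 : 1 ≤ w i) (h2 : w i ≤ 3 / 2)
    (hk : ∀ k ≠ i, |w k| ≤ 1 / 2 ∧ |w' k - w k| ≤ δ ∨ |w k| < 1 ∧ w' k = w k) :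
    w' i - w i ≤ δ := by
  by_contra! hlt
  set r := w' i - w i with hr
  have hpos : 0 < r + δ := by linarith
  set t := 1 / (r + δ) with ht
  have htpos : 0 < t := by positivity
  have hsum : t * r + t * δ = 1 := by rw [ht]; field_simp
  have htr : t * δ < t * r := mul_lt_mul_of_pos_left hlt htpos
  have htδ : 0 ≤ t * δ := by positivity
  have hlt1 : ‖w - t • (w' - w)‖ < 1 := by
    rw [pi_norm_lt_iff one_pos]
    intro k
    simp only [Pi.sub_apply, Pi.smul_apply, smul_eq_mul, Real.norm_eq_abs]
    by_cases hki : k = i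
    · subst hki
      rw [← hr, abs_lt]
      constructor <;> linarith
    · rcases hk k hki with ⟨ha, hb⟩ | ⟨ha, hb⟩
      · calc |w k - t * (w' k - w k)| ≤ |w k| + |t * (w' k - w k)| := abs_sub _ _
          _ = |w k| + t * |w' k - w k| := by rw [abs_mul, abs_of_pos htpos]
          _ ≤ 1 / 2 + t * δ := by gcongr
          _ < 1 := by linarith
      · simpa [hb] using ha
  have hcomb : (1 + t) • S w = t • S w' + S (w - t • (w' - w)) := by
    simp only [map_sub, map_smul]
    module
  have hle := norm_add_le (t • S w') (S (w - t • (w' - w)))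
  rw [← hcomb, norm_smul, norm_smul, hw, hw', Real.norm_of_nonneg htpos.le,
    Real.norm_of_nonneg (by positivity)] at hle
  linarith [hS (w - t • (w' - w))]

/-- If `H` is nonexpansive on a nonempty complete set `Q` and `c • H` maps `Q` to itself for some
`0 ≤ c < 1`, then `c • H` has a fixed point in `Q`. -/
lemma exists_eq_smul_of_lipschitzOnWith_one {E : Type*} [NormedAddCommGroup E] [NormedSpace ℝ E]
    {Q : Set E} (hQ : IsComplete Q) (hne : Q.Nonempty) {H : E → E} (hH : LipschitzOnWith 1 H Q)
    {c : ℝ} (hc0 : 0 ≤ c) (hc1 : c < 1) (hmaps : ∀ y ∈ Q, c • H y ∈ Q) :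
    ∃ y ∈ Q, y = c • H y := by
  obtain ⟨x, hx⟩ := hne
  have hf : ContractingWith c.toNNReal
      (MapsTo.restrict (fun y => c • H y) Q Q hmaps) := by
    refine ⟨by simpa using hc1, ?_⟩
    refine LipschitzWith.of_dist_le_mul fun a b => ?_
    have hab := hH.dist_le_mul a a.2 b b.2
    change dist (c • H a) (c • H b) ≤ _
    rw [dist_smul₀, Real.norm_of_nonneg hc0, Real.coe_toNNReal c hc0]
    have : dist (H a) (H b) ≤ dist a b := by simpa [Subtype.dist_eq] using hab
    gcongr
  obtain ⟨y, hy, hfix, -⟩ := hf.exists_fixedPoint' hQ hmaps hx (edist_ne_top _ _)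
  exact ⟨y, hy, hfix.symm⟩

lemma update_mem_Icc {y : Fin n → ℝ} (hy : y ∈ Icc (0 : Fin n → ℝ) (fun _ => 1 / 2)) (i : Fin n)
    {s : ℝ} (hs : s ∈ Icc (0 : ℝ) (1 / 2)) :
    Function.update y i s ∈ Icc (0 : Fin n → ℝ) (fun _ => 1 / 2) := by
  constructor <;> intro k <;> by_cases hk : k = i
  · subst hk; simpa using hs.1
  · simpa [hk] using hy.1 k
  · subst hk; simpa using hs.2
  · simpa [hk] using hy.2 k

lemma simplexPoint_sub_apply_self {i : Fin n} {j : ℕ} (hij : (i : ℕ) < j) (b : ℝ)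
    (y z : Fin n → ℝ) : (simplexPoint j b y - simplexPoint i 1 z) i = y i + 1 := by
  simp [simplexPoint, hij]

lemma abs_simplexPoint_sub_apply_le {i k : Fin n} {j : ℕ} (hki : k ≠ i)
    (hkj : (k : ℕ) ≠ j) (b : ℝ) {y z : Fin n → ℝ}
    (hy : y ∈ Icc (0 : Fin n → ℝ) (fun _ => 1 / 2))
    (hz : z ∈ Icc (0 : Fin n → ℝ) (fun _ => 1 / 2)) :
    |(simplexPoint j b y - simplexPoint i 1 z) k| ≤ 1 / 2 := by
  have hki' : (k : ℕ) ≠ i := fun h => hki (Fin.ext h)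
  have h1 := hy.1 k
  have h2 := hy.2 k
  have h3 := hz.1 k
  have h4 := hz.2 k
  simp only [Pi.zero_apply] at h1 h3
  simp only [simplexPoint, Pi.sub_apply, hki', hkj, if_false]
  rw [abs_le]
  split_ifs <;> constructor <;> linarith

lemma simplexPoint_sub_apply_of_eq {i k : Fin n} {j : ℕ} (hij : (i : ℕ) < j)
    (hkj : (k : ℕ) = j) (b : ℝ) (y z : Fin n → ℝ) :
    (simplexPoint j b y - simplexPoint i 1 z) k = -b := by
  have h1 : ¬ (k : ℕ) < i := by omega
  have h2 : (k : ℕ) ≠ i := by omega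
  have h3 : ¬ (k : ℕ) < j := by omega
  simp only [simplexPoint, Pi.sub_apply, if_neg h1, if_neg h2, if_neg h3, if_pos hkj, sub_zero]

/-- The `i`-th coordinate of a vertex can be adjusted so that its distance to the `i`-th vertex
becomes one. -/
lemma exists_update_norm_eq_one (S : (Fin n → ℝ) →L[ℝ] X) (hS : ∀ v, ‖S v‖ ≤ ‖v‖)
    (hS' : ∀ v, ‖v‖ ≤ 3 / 2 * ‖S v‖) {i : Fin n} {j : ℕ} (hij : (i : ℕ) < j) {b : ℝ}
    (hb0 : 0 ≤ b) (hb1 : b ≤ 1) {y z : Fin n → ℝ}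
    (hy : y ∈ Icc (0 : Fin n → ℝ) (fun _ => 1 / 2))
    (hz : z ∈ Icc (0 : Fin n → ℝ) (fun _ => 1 / 2)) :
    ∃ s ∈ Icc (0 : ℝ) (1 / 2),
      ‖S (simplexPoint j b (Function.update y i s) - simplexPoint i 1 z)‖ = 1 := by
  have hcont : Continuous fun s : ℝ =>
      ‖S (simplexPoint j b (Function.update y i s) - simplexPoint i 1 z)‖ := by
    have := (continuous_simplexPoint (n := n) j b).comp
      (continuous_const.update i continuous_id : Continuous fun s : ℝ => Function.update y i s)
    exact (S.continuous.comp (this.sub continuous_const)).norm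
  refine intermediate_value_Icc (by norm_num) hcont.continuousOn ⟨?_, ?_⟩
  · refine (hS _).trans ((pi_norm_le_iff_of_nonneg zero_le_one).2 fun k => ?_)
    rw [Real.norm_eq_abs]
    by_cases hki : k = i
    · subst hki
      rw [simplexPoint_sub_apply_self hij]
      simp
    by_cases hkj : (k : ℕ) = j
    · rw [simplexPoint_sub_apply_of_eq hij hkj, abs_neg, abs_of_nonneg hb0]
      exact hb1
    · have := abs_simplexPoint_sub_apply_le hki hkj b
        (update_mem_Icc hy i (by norm_num : (0 : ℝ) ∈ Icc (0 : ℝ) (1 / 2))) hz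
      linarith
  · have h1 := norm_le_pi_norm
      (simplexPoint j b (Function.update y i (1 / 2)) - simplexPoint i 1 z) i
    rw [simplexPoint_sub_apply_self hij, Function.update_self, Real.norm_eq_abs] at h1
    have h2 := hS' (simplexPoint j b (Function.update y i (1 / 2)) - simplexPoint i 1 z)
    have h3 := le_abs_self (1 / 2 + 1 : ℝ)
    linarith

/-- The adjusted coordinate depends on the other ones in a nonexpansive way. -/
lemma sub_le_of_update_norm_eq_one (S : (Fin n → ℝ) →L[ℝ] X) (hS : ∀ v, ‖S v‖ ≤ ‖v‖)
    {i : Fin n} {j : ℕ} (hij : (i : ℕ) < j) {b : ℝ} (hb0 : 0 ≤ b) (hb1 : b < 1)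
    {y y' z : Fin n → ℝ} (hy : y ∈ Icc (0 : Fin n → ℝ) (fun _ => 1 / 2))
    (hz : z ∈ Icc (0 : Fin n → ℝ) (fun _ => 1 / 2)) {s s' : ℝ} (hs : s ∈ Icc (0 : ℝ) (1 / 2))
    (h : ‖S (simplexPoint j b (Function.update y i s) - simplexPoint i 1 z)‖ = 1)
    (h' : ‖S (simplexPoint j b (Function.update y' i s') - simplexPoint i 1 z)‖ = 1) :
    s' - s ≤ dist y' y := by
  have hself := simplexPoint_sub_apply_self (n := n) hij b
  have key := apply_sub_le_of_norm_map_eq_one S hS (i := i) (δ := dist y' y) dist_nonneg h h'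
    (by rw [hself, Function.update_self]; linarith [hs.1])
    (by rw [hself, Function.update_self]; linarith [hs.2]) ?_
  · rw [hself, hself, Function.update_self, Function.update_self] at key
    linarith
  intro k hki
  by_cases hkj : (k : ℕ) = j
  · right
    rw [simplexPoint_sub_apply_of_eq hij hkj, simplexPoint_sub_apply_of_eq hij hkj, abs_neg,
      abs_of_nonneg hb0]
    exact ⟨hb1, rfl⟩
  · left
    refine ⟨abs_simplexPoint_sub_apply_le hki hkj b (update_mem_Icc hy i hs) hz, ?_⟩
    rw [Pi.sub_apply, Pi.sub_apply, sub_sub_sub_cancel_right]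
    simp only [simplexPoint, hkj, if_false]
    split_ifs
    · rw [Function.update_of_ne hki, Function.update_of_ne hki, ← Real.dist_eq]
      exact dist_le_pi_dist y' y k
    · simp

/-- A new vertex can be placed at distance arbitrarily close to one from all previous ones. -/
lemma exists_simplexPoint_norm_near_one (S : (Fin n → ℝ) →L[ℝ] X) (hS : ∀ v, ‖S v‖ ≤ ‖v‖)
    (hS' : ∀ v, ‖v‖ ≤ 3 / 2 * ‖S v‖) (j : ℕ) {q : ℕ → Fin n → ℝ}
    (hq : ∀ i, q i ∈ Icc (0 : Fin n → ℝ) (fun _ => 1 / 2)) {η : ℝ} (hη0 : 0 < η) (hη1 : η ≤ 1) :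
    ∃ y ∈ Icc (0 : Fin n → ℝ) (fun _ => 1 / 2), ∀ i : Fin n, (i : ℕ) < j →
      |‖S (simplexPoint j 1 y - simplexPoint i 1 (q i))‖ - 1| ≤ η := by
  have hex : ∀ (y : Fin n → ℝ) (i : Fin n), ∃ s ∈ Icc (0 : ℝ) (1 / 2),
      (j ≤ i → s = 0) ∧ (y ∈ Icc (0 : Fin n → ℝ) (fun _ => 1 / 2) → (i : ℕ) < j →
        ‖S (simplexPoint j (1 - η) (Function.update y i s) - simplexPoint i 1 (q i))‖ = 1) := by
    intro y i
    by_cases hyi : y ∈ Icc (0 : Fin n → ℝ) (fun _ => 1 / 2) ∧ (i : ℕ) < j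
    · obtain ⟨s, hs, h⟩ := exists_update_norm_eq_one S hS hS' hyi.2 (b := 1 - η)
        (by linarith) (by linarith) hyi.1 (hq i)
      exact ⟨s, hs, fun h => absurd hyi.2 (by omega), fun _ _ => h⟩
    · exact ⟨0, by norm_num, fun _ => rfl, fun h1 h2 => absurd ⟨h1, h2⟩ hyi⟩
  choose H hHmem hHzero hH using hex
  have hLip : LipschitzOnWith 1 H (Icc (0 : Fin n → ℝ) (fun _ => 1 / 2)) := by
    refine LipschitzOnWith.of_dist_le_mul fun y hy y' hy' => ?_
    rw [NNReal.coe_one, one_mul, dist_pi_le_iff dist_nonneg]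
    intro i
    by_cases hij : (i : ℕ) < j
    · have h1 := sub_le_of_update_norm_eq_one S hS hij (by linarith) (by linarith) hy (hq i)
        (hHmem y i) (hH y i hy hij) (hH y' i hy' hij)
      have h2 := sub_le_of_update_norm_eq_one S hS hij (by linarith) (by linarith) hy' (hq i)
        (hHmem y' i) (hH y' i hy' hij) (hH y i hy hij)
      rw [dist_comm] at h1
      rw [Real.dist_eq, abs_le]
      constructor <;> linarith
    · rw [hHzero y i (by omega), hHzero y' i (by omega), dist_self]
      exact dist_nonneg
  obtain ⟨y, hy, hfix⟩ := exists_eq_smul_of_lipschitzOnWith_one isClosed_Icc.isComplete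
    ⟨_, hq 0⟩ hLip (c := 1 - η) (by linarith) (by linarith) (fun y _ => by
      constructor <;> intro k <;>
        simp only [Pi.smul_apply, smul_eq_mul, Pi.zero_apply] <;>
        nlinarith [(hHmem y k).1, (hHmem y k).2])
  refine ⟨y, hy, fun i hij => ?_⟩
  have hdist := abs_norm_sub_norm_le (S (simplexPoint j 1 y - simplexPoint i 1 (q i)))
    (S (simplexPoint j (1 - η) (Function.update y i (H y i)) - simplexPoint i 1 (q i)))
  rw [hH y i hy hij] at hdist
  refine hdist.trans ?_
  rw [← map_sub, sub_sub_sub_cancel_right]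
  refine (hS _).trans (norm_simplexPoint_sub_le j hη0.le ?_ ?_)
  · rw [sub_sub_cancel, abs_of_pos hη0]
  · rw [pi_norm_le_iff_of_nonneg hη0.le]
    intro k
    by_cases hk : k = i
    · subst hk
      have h1 : y k = (1 - η) * H y k := congrFun hfix k
      have h2 := (hHmem y k).1
      have h3 := (hHmem y k).2
      rw [Pi.sub_apply, Function.update_self, Real.norm_eq_abs, abs_le]
      constructor <;> nlinarith
    · simpa [hk] using hη0.le

/-- A new vertex can be placed at distance exactly one from all previous ones. -/
lemma exists_simplexPoint_norm_eq_one (S : (Fin n → ℝ) →L[ℝ] X) (hS : ∀ v, ‖S v‖ ≤ ‖v‖)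
    (hS' : ∀ v, ‖v‖ ≤ 3 / 2 * ‖S v‖) (j : ℕ) {q : ℕ → Fin n → ℝ}
    (hq : ∀ i, q i ∈ Icc (0 : Fin n → ℝ) (fun _ => 1 / 2)) :
    ∃ y ∈ Icc (0 : Fin n → ℝ) (fun _ => 1 / 2), ∀ i : Fin n, (i : ℕ) < j →
      ‖S (simplexPoint j 1 y - simplexPoint i 1 (q i))‖ = 1 := by
  let F : (Fin n → ℝ) → Fin n → ℝ := fun y i =>
    if (i : ℕ) < j then ‖S (simplexPoint j 1 y - simplexPoint i 1 (q i))‖ - 1 else 0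
  have hF : Continuous F := by
    refine continuous_pi fun i => ?_
    simp only [F]
    split_ifs
    · exact (S.continuous.comp
        ((continuous_simplexPoint j 1).sub continuous_const)).norm.sub continuous_const
    · exact continuous_const
  obtain ⟨y, hy, hmin⟩ := isCompact_Icc.exists_isMinOn ⟨_, hq 0⟩ hF.norm.continuousOn
  have hle : ‖F y‖ ≤ 0 := by
    refine le_of_forall_gt_imp_ge_of_dense fun η hη => ?_
    obtain ⟨y', hy', h⟩ := exists_simplexPoint_norm_near_one S hS hS' j hq
      (lt_min hη one_pos) (min_le_right η 1)
    refine (hmin hy').trans ((pi_norm_le_iff_of_nonneg hη.le).2 fun i => ?_)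
    simp only [F]
    split_ifs with hij
    · exact (h i hij).trans (min_le_left _ _)
    · simpa using hη.le
  refine ⟨y, hy, fun i hij => ?_⟩
  have h0 : F y i = 0 := congrFun (norm_le_zero_iff.1 hle) i
  simp only [F, hij, if_true] at h0
  linarith

lemma exists_simplexPoint_pairwise_norm_eq_one (S : (Fin n → ℝ) →L[ℝ] X)
    (hS : ∀ v, ‖S v‖ ≤ ‖v‖) (hS' : ∀ v, ‖v‖ ≤ 3 / 2 * ‖S v‖) (m : ℕ) :
    ∃ q : ℕ → Fin n → ℝ, (∀ i, q i ∈ Icc (0 : Fin n → ℝ) (fun _ => 1 / 2)) ∧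
      ∀ j < m, ∀ i : Fin n, (i : ℕ) < j →
        ‖S (simplexPoint j 1 (q j) - simplexPoint i 1 (q i))‖ = 1 := by
  induction m with
  | zero =>
    refine ⟨fun _ => 0, fun _ => ⟨le_rfl, fun _ => ?_⟩, fun j hj => absurd hj j.not_lt_zero⟩
    norm_num
  | succ m ih =>
    obtain ⟨q, hq, h⟩ := ih
    obtain ⟨y, hy, hy1⟩ := exists_simplexPoint_norm_eq_one S hS hS' m hq
    refine ⟨Function.update q m y, fun i => ?_, fun j hj i hij => ?_⟩
    · by_cases him : i = m
      · subst him; simpa using hy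
      · simpa [him] using hq i
    · rw [Function.update_of_ne (by omega : (i : ℕ) ≠ m)]
      by_cases hjm : j = m
      · subst hjm
        rw [Function.update_self]
        exact hy1 i hij
      · rw [Function.update_of_ne hjm]
        exact h j (by omega) i hij

/-- The infimum defining the Banach–Mazur distance is attained, in a normalized form. -/
lemma exists_norm_map_le_and_le_of_BMdist_le [FiniteDimensional ℝ X]
    (hdim : Module.finrank ℝ X = n) {D : ℝ} (hBM : BMdist X (Fin n → ℝ) ≤ D) :
    ∃ S : (Fin n → ℝ) →L[ℝ] X, (∀ v, ‖S v‖ ≤ ‖v‖) ∧ ∀ v, ‖v‖ ≤ D * ‖S v‖ := by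
  have happrox : ∀ k : ℕ, ∃ S ∈ Metric.closedBall (0 : (Fin n → ℝ) →L[ℝ] X) 1,
      ∀ v, ‖v‖ ≤ (D + 1 / ((k : ℝ) + 1)) * ‖S v‖ := by
    intro k
    have hne : {r : ℝ | ∃ T : X ≃L[ℝ] (Fin n → ℝ), r = ‖(T : X →L[ℝ] (Fin n → ℝ))‖ *
        ‖(T.symm : (Fin n → ℝ) →L[ℝ] X)‖}.Nonempty :=
      ⟨_, ContinuousLinearEquiv.ofFinrankEq (by simpa using hdim), rfl⟩
    obtain ⟨_, ⟨T, rfl⟩, hT⟩ := exists_lt_of_csInf_lt hne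
      (lt_of_le_of_lt hBM (lt_add_of_pos_right D (by positivity : 0 < 1 / ((k : ℝ) + 1))))
    refine ⟨‖(T.symm : (Fin n → ℝ) →L[ℝ] X)‖⁻¹ • (T.symm : (Fin n → ℝ) →L[ℝ] X), ?_, fun v => ?_⟩
    · rw [mem_closedBall_zero_iff, norm_smul, norm_inv, norm_norm]
      exact inv_mul_le_one
    · have h1 := (T : X →L[ℝ] (Fin n → ℝ)).le_opNorm (T.symm v)
      simp only [ContinuousLinearEquiv.coe_coe, ContinuousLinearEquiv.apply_symm_apply] at h1
      rcases eq_or_ne ‖(T.symm : (Fin n → ℝ) →L[ℝ] X)‖ 0 with h0 | h0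
      · have h2 : T.symm v = 0 := by
          have := (T.symm : (Fin n → ℝ) →L[ℝ] X).le_opNorm v
          rw [h0, zero_mul] at this
          exact norm_le_zero_iff.1 this
        rw [h2, norm_zero, mul_zero] at h1
        simpa [h2] using h1
      · have h3 : ‖(‖(T.symm : (Fin n → ℝ) →L[ℝ] X)‖⁻¹ • (T.symm : (Fin n → ℝ) →L[ℝ] X)) v‖ =
            ‖(T.symm : (Fin n → ℝ) →L[ℝ] X)‖⁻¹ * ‖T.symm v‖ := by
          rw [smul_apply, norm_smul, norm_inv, norm_norm]
          rfl
        calc ‖v‖ ≤ ‖(T : X →L[ℝ] (Fin n → ℝ))‖ * ‖T.symm v‖ := h1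
          _ = ‖(T : X →L[ℝ] (Fin n → ℝ))‖ * ‖(T.symm : (Fin n → ℝ) →L[ℝ] X)‖ *
              (‖(T.symm : (Fin n → ℝ) →L[ℝ] X)‖⁻¹ * ‖T.symm v‖) := by field_simp
          _ ≤ _ := by
            rw [h3]
            gcongr
  choose S hSball hSk using happrox
  obtain ⟨L, hL, φ, hφ, hlim⟩ := (isCompact_closedBall _ _).tendsto_subseq hSball
  refine ⟨L, fun v => ?_, fun v => ?_⟩
  · have := L.le_of_opNorm_le (mem_closedBall_zero_iff.1 hL) v
    simpa using this
  · have hv : Tendsto (fun k => ‖S (φ k) v‖) atTop (𝓝 ‖L v‖) :=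
      (((ContinuousLinearMap.apply ℝ X v).continuous.tendsto L).comp hlim).norm
    have hD : Tendsto (fun k => D + 1 / ((φ k : ℝ) + 1)) atTop (𝓝 (D + 0)) :=
      tendsto_const_nhds.add
        ((tendsto_one_div_add_atTop_nhds_zero_nat (𝕜 := ℝ)).comp hφ.tendsto_atTop)
    rw [add_zero] at hD
    exact ge_of_tendsto' (hD.mul hv) fun k => hSk (φ k) v

end

/-- If `X` is an `n`-dimensional real normed space with Banach–Mazur distance at most
`3/2` from `ℓ∞ⁿ` (which is `ℝⁿ = Fin n → ℝ` with the sup norm), then `X` contains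
an equilateral set of `n + 1` points, i.e. `e(X) ≥ n + 1`. -/
theorem equilateral_of_bmdist_linf_le (n : ℕ) (X : Type*) [NormedAddCommGroup X]
    [NormedSpace ℝ X] [FiniteDimensional ℝ X] (hdim : Module.finrank ℝ X = n)
    (hBM : BMdist X (Fin n → ℝ) ≤ 3 / 2) :
    ∃ S : Finset X, S.card = n + 1 ∧ IsEquilateral (S : Set X) := by
  obtain ⟨S, hS, hS'⟩ := exists_norm_map_le_and_le_of_BMdist_le hdim hBM
  obtain ⟨q, -, hq⟩ := exists_simplexPoint_pairwise_norm_eq_one S hS hS' (n + 1)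
  let p : Fin (n + 1) → X := fun j => S (simplexPoint j 1 (q j))
  have hlt : ∀ i j : Fin (n + 1), i < j → ‖p j - p i‖ = 1 := by
    intro i j hij
    have hin : (i : ℕ) < n := by omega
    simpa [p] using hq j j.2 ⟨i, hin⟩ hij
  have hne : ∀ i j : Fin (n + 1), i ≠ j → ‖p i - p j‖ = 1 := by
    intro i j hij
    rcases lt_or_gt_of_ne hij with h | h
    · rw [norm_sub_rev, hlt i j h]
    · exact hlt j i h
  have hinj : Function.Injective p := by
    intro i j hij
    by_contra h
    simpa [hij] using hne i j h
  refine ⟨Finset.univ.map ⟨p, hinj⟩, by simp, 1, one_pos, ?_⟩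
  intro x hx y hy hxy
  simp only [Finset.coe_map, Finset.coe_univ, image_univ, mem_range,
    Function.Embedding.coeFn_mk] at hx hy
  obtain ⟨i, rfl⟩ := hx
  obtain ⟨j, rfl⟩ := hy
  exact hne i j fun h => hxy (congrArg p h)
end

section
/- Let ‖·‖ be a norm on ℝ^n satisfying ‖x‖ ≤ ‖x‖_∞ ≤ (3/2)‖x‖ for all x ∈ ℝ^n. Then there exist n + 1 points q₁, …, q_{n+1} in ℝ^n such that ‖q_i − q_j‖ = 1 for all 1 ≤ i < j ≤ n + 1. -/
open Set Metric MeasureTheory Filter Topology Polynomial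
open scoped NNReal

section Brouwer

/-- The radial retraction of a normed space onto its closed unit ball. -/
noncomputable def radialProj {E : Type*} [NormedAddCommGroup E] [NormedSpace ℝ E] (x : E) : E :=
  (max 1 ‖x‖)⁻¹ • x

variable {E : Type*} [NormedAddCommGroup E]

theorem bijective_add_of_lipschitzWith [CompleteSpace E] {K : ℝ≥0} {g : E → E}
    (hg : LipschitzWith K g) (hK : K < 1) : Function.Bijective fun x => x + g x := by
  have hc (y : E) : ContractingWith K fun x => y - g x :=
    ⟨hK, LipschitzWith.of_dist_le_mul fun a b => by
      rw [dist_sub_left]; exact hg.dist_le_mul a b⟩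
  refine ⟨fun a b hab => ?_, fun y => ?_⟩
  · refine (hc (a + g a)).fixedPoint_unique' (add_sub_cancel_right _ _) ?_
    simp only at hab
    rw [hab]
    exact add_sub_cancel_right _ _
  · refine ⟨(hc y).fixedPoint, ?_⟩
    exact (eq_sub_iff_add_eq.1 (hc y).fixedPoint_isFixedPt.symm)

section NormedSpace

variable [NormedSpace ℝ E]

theorem radialProj_of_norm_le_one {x : E} (hx : ‖x‖ ≤ 1) : radialProj x = x := by
  simp [radialProj, max_eq_left hx]

theorem norm_radialProj_of_one_le {x : E} (hx : 1 ≤ ‖x‖) : ‖radialProj x‖ = 1 := by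
  have h : ‖x‖ ≠ 0 := by positivity
  simp [radialProj, max_eq_right hx, norm_smul, h]

theorem norm_radialProj_le_one (x : E) : ‖radialProj x‖ ≤ 1 := by
  rcases le_total ‖x‖ 1 with h | h
  · rwa [radialProj_of_norm_le_one h]
  · exact (norm_radialProj_of_one_le h).le

theorem lipschitzWith_radialProj : LipschitzWith 2 (radialProj : E → E) := by
  refine LipschitzWith.of_dist_le_mul fun x y => ?_
  rw [dist_eq_norm, dist_eq_norm]
  have ha : 1 ≤ max 1 ‖x‖ := le_max_left _ _
  have hb : 1 ≤ max 1 ‖y‖ := le_max_left _ _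
  have hby : ‖y‖ ≤ max 1 ‖y‖ := le_max_right _ _
  have hab : |max 1 ‖y‖ - max 1 ‖x‖| ≤ ‖x - y‖ := by
    refine (abs_max_sub_max_le_max 1 ‖y‖ 1 ‖x‖).trans ?_
    rw [norm_sub_rev]
    simpa using abs_norm_sub_norm_le y x
  unfold radialProj
  set a := max 1 ‖x‖
  set b := max 1 ‖y‖
  have hsplit : a⁻¹ • x - b⁻¹ • y = a⁻¹ • (x - y) + (a⁻¹ - b⁻¹) • y := by module
  have hinv : a⁻¹ - b⁻¹ = (b - a) * (a⁻¹ * b⁻¹) := by field_simp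
  have ha' : a⁻¹ ≤ 1 := inv_le_one_of_one_le₀ ha
  have hyb : b⁻¹ * ‖y‖ ≤ 1 := by
    rw [inv_mul_le_iff₀ (by positivity)]; linarith
  calc ‖a⁻¹ • x - b⁻¹ • y‖ ≤ a⁻¹ * ‖x - y‖ + |b - a| * (a⁻¹ * (b⁻¹ * ‖y‖)) := by
        rw [hsplit, hinv]
        refine (norm_add_le _ _).trans (le_of_eq ?_)
        rw [norm_smul, norm_smul, Real.norm_eq_abs, Real.norm_eq_abs, abs_mul,
          abs_of_nonneg (by positivity : 0 ≤ a⁻¹), abs_of_nonneg (by positivity : 0 ≤ a⁻¹ * b⁻¹)]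
        ring
    _ ≤ 1 * ‖x - y‖ + ‖x - y‖ * (1 * 1) := by gcongr
    _ = ((2 : ℝ≥0) : ℝ) * ‖x - y‖ := by push_cast; ring

/-- A small Lipschitz perturbation of the identity that fixes the unit sphere maps the open unit
ball bijectively onto itself. -/
theorem injOn_and_image_ball_of_lipschitzOnWith [CompleteSpace E] {K : ℝ≥0} {g : E → E}
    (hg : LipschitzOnWith K g (closedBall 0 1)) (hK : K * 2 < 1)
    (h0 : ∀ x, ‖x‖ = 1 → g x = 0) :
    InjOn (fun x => x + g x) (ball 0 1) ∧ (fun x => x + g x) '' ball 0 1 = ball 0 1 := by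
  have hlip : LipschitzWith (K * 2) (g ∘ radialProj) := by
    rw [← lipschitzOnWith_univ]
    exact hg.comp lipschitzWith_radialProj.lipschitzOnWith
      fun x _ => by simpa using norm_radialProj_le_one x
  obtain ⟨hinj, hsurj⟩ := bijective_add_of_lipschitzWith hlip hK
  have hin : ∀ x ∈ ball (0 : E) 1, x + g x = x + (g ∘ radialProj) x := fun x hx => by
    rw [Function.comp_apply, radialProj_of_norm_le_one (mem_ball_zero_iff.1 hx).le]
  have hout : ∀ x ∉ ball (0 : E) 1, x + (g ∘ radialProj) x = x := fun x hx => by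
    rw [Function.comp_apply, h0 _ (norm_radialProj_of_one_le (by simpa using hx)), add_zero]
  refine ⟨fun a ha b hb hab => hinj ?_, Subset.antisymm ?_ fun y hy => ?_⟩
  · simpa only [← hin a ha, ← hin b hb] using hab
  · rintro _ ⟨x, hx, rfl⟩
    by_contra hy
    have hy' := hout _ hy
    simp only [hin x hx] at hy hy'
    exact hy (by rw [hinj hy']; exact hx)
  · obtain ⟨x, rfl⟩ := hsurj y
    by_cases hx : x ∈ ball (0 : E) 1
    · exact ⟨x, hx, hin x hx⟩
    · exact absurd hy (by simp only [hout x hx]; exact hx)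

variable [FiniteDimensional ℝ E]

theorem exists_polynomial_eval_eq_det_one_add_smul (A : E →L[ℝ] E) :
    ∃ p : ℝ[X], p.natDegree ≤ Module.finrank ℝ E ∧
      ∀ t : ℝ, p.eval t = (1 + t • A : E →L[ℝ] E).det := by
  obtain ⟨M, hM⟩ : ∃ M, M = LinearMap.toMatrix (Module.finBasis ℝ E) (Module.finBasis ℝ E)
    (A : E →ₗ[ℝ] E) := ⟨_, rfl⟩
  refine ⟨((X : ℝ[X]) • M.map C + (1 : Matrix _ _ ℝ).map C).det, ?_, fun t => ?_⟩
  · simpa only [Fintype.card_fin] using natDegree_det_X_add_C_le M 1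
  have hcoe : LinearMap.toMatrix (Module.finBasis ℝ E) (Module.finBasis ℝ E)
      ((1 + t • A : E →L[ℝ] E) : E →ₗ[ℝ] E) = 1 + t • M := by
    rw [hM, ← LinearMap.toMatrix_one (Module.finBasis ℝ E), ← map_smul, ← map_add]
    rfl
  rw [← coe_evalRingHom, RingHom.map_det, ContinuousLinearMap.det,
    ← LinearMap.det_toMatrix (Module.finBasis ℝ E), hcoe, add_comm]
  congr 1
  ext i j
  simp only [RingHom.mapMatrix_apply, Matrix.map_apply, Matrix.add_apply, Matrix.smul_apply,
    coe_evalRingHom, smul_eq_mul, eval_add, eval_mul, eval_X, eval_C]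

/-- A linear combination of the values `det (1 + t • A)` at small parameters `t` that recovers
`det (1 + A)`, with coefficients independent of `A`. -/
theorem exists_sum_det_one_add_smul_eq {τ : ℝ} (hτ : 0 < τ) :
    ∃ (s : Finset ℕ) (t c : ℕ → ℝ), (∀ k, 0 < t k ∧ t k ≤ τ) ∧ ∑ k ∈ s, c k = 1 ∧
      ∀ A : E →L[ℝ] E, (1 + A).det = ∑ k ∈ s, c k * (1 + t k • A).det := by
  let s := Finset.range (Module.finrank ℝ E + 1)
  let t : ℕ → ℝ := fun k => τ / (k + 1)
  have hinj : InjOn t s := fun a _ b _ hab => by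
    have h : (a : ℝ) + 1 = b + 1 := by
      simp only [t] at hab
      field_simp at hab
      exact hab.symm
    exact_mod_cast add_right_cancel h
  refine ⟨s, t, fun k => (Lagrange.basis s t k).eval 1, fun k => ⟨by positivity, ?_⟩, ?_,
    fun A => ?_⟩
  · exact div_le_self hτ.le (by simp)
  · rw [← eval_finsetSum, Lagrange.sum_basis hinj ⟨0, by simp [s]⟩, eval_one]
  · obtain ⟨p, hp, hpe⟩ := exists_polynomial_eval_eq_det_one_add_smul A
    have hdeg : p.degree < s.card := by
      refine (degree_le_natDegree).trans_lt ?_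
      rw [Finset.card_range]
      exact_mod_cast Nat.lt_succ_of_le hp
    have h := congrArg (eval 1) (Lagrange.eq_interpolate hinj hdeg)
    rw [hpe, one_smul, Lagrange.interpolate_apply, eval_finsetSum] at h
    rw [h]
    refine Finset.sum_congr rfl fun k _ => ?_
    rw [eval_mul, eval_C, hpe, mul_comm]

theorem exists_lipschitzOnWith_closedBall_of_contDiffAt {g : E → E}
    (hg : ∀ x ∈ closedBall (0 : E) 1, ContDiffAt ℝ 1 g x) :
    ∃ K, LipschitzOnWith K g (closedBall 0 1) := by
  refine LocallyLipschitzOn.exists_lipschitzOnWith_of_compact (isCompact_closedBall 0 1)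
    fun x hx => ?_
  obtain ⟨K, t, ht, hK⟩ := (hg x hx).exists_lipschitzOnWith
  exact ⟨K, t, mem_nhdsWithin_of_mem_nhds ht, hK⟩

/-- If `x ↦ x + g x` is `C¹` on the closed unit ball and fixes the unit sphere, then its Jacobian
integrates over the ball to the volume of the ball. -/
theorem setIntegral_det_one_add_fderiv [MeasurableSpace E] [BorelSpace E] (μ : Measure E)
    [μ.IsAddHaarMeasure] {g : E → E}
    (hg : ∀ x ∈ closedBall (0 : E) 1, ContDiffAt ℝ 1 g x) (h0 : ∀ x, ‖x‖ = 1 → g x = 0) :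
    ∫ x in ball 0 1, (1 + fderiv ℝ g x).det ∂μ = μ.real (ball 0 1) := by
  obtain ⟨K, hK⟩ := exists_lipschitzOnWith_closedBall_of_contDiffAt hg
  obtain ⟨δ, hδ, hdet⟩ : ∃ δ > 0, ∀ A : E →L[ℝ] E, ‖A‖ < δ → 0 < (1 + A).det := by
    have hc : Continuous fun A : E →L[ℝ] E => (1 + A).det :=
      ContinuousLinearMap.continuous_det.comp (continuous_const.add continuous_id)
    have h1 : ∀ᶠ A in 𝓝 (0 : E →L[ℝ] E), 0 < (1 + A).det := by
      refine hc.continuousAt.eventually_const_lt ?_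
      simp [ContinuousLinearMap.det]
    obtain ⟨δ, hδ, h⟩ := Metric.eventually_nhds_iff.1 h1
    exact ⟨δ, hδ, fun A hA => h (by simpa using hA)⟩
  have hsmall (t : ℝ) (ht : 0 < t) (ht1 : t * K * 2 < 1) (ht2 : t * K < δ) :
      IntegrableOn (fun x => (1 + t • fderiv ℝ g x).det) (ball 0 1) μ ∧
        ∫ x in ball 0 1, (1 + t • fderiv ℝ g x).det ∂μ = μ.real (ball 0 1) := by
    have hlip : LipschitzOnWith (t.toNNReal * K) (fun x => t • g x) (closedBall 0 1) := by
      refine LipschitzOnWith.of_dist_le_mul fun x hx y hy => ?_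
      rw [dist_smul₀, Real.norm_of_nonneg ht.le, NNReal.coe_mul, Real.coe_toNNReal _ ht.le,
        mul_assoc]
      exact mul_le_mul_of_nonneg_left (hK.dist_le_mul x hx y hy) ht.le
    obtain ⟨hinj, him⟩ := injOn_and_image_ball_of_lipschitzOnWith hlip
      (by rw [← NNReal.coe_lt_coe]; simpa [ht.le] using ht1) (fun x hx => by simp [h0 x hx])
    have hder : ∀ x ∈ ball (0 : E) 1, HasFDerivWithinAt (fun x => x + t • g x)
        (1 + t • fderiv ℝ g x) (ball 0 1) x := fun x hx =>
      ((hasFDerivAt_id x).add (((hg x (ball_subset_closedBall hx)).differentiableAt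
        one_ne_zero).hasFDerivAt.const_smul t)).hasFDerivWithinAt
    have habs : EqOn (fun x => |(1 + t • fderiv ℝ g x).det| • (1 : ℝ))
        (fun x => (1 + t • fderiv ℝ g x).det) (ball 0 1) := fun x hx => by
      have hle : ‖fderiv ℝ g x‖ ≤ K := norm_fderiv_le_of_lipschitzOn ℝ
        (Filter.mem_of_superset (isOpen_ball.mem_nhds hx) ball_subset_closedBall) hK
      have : ‖t • fderiv ℝ g x‖ < δ := by
        rw [norm_smul, Real.norm_of_nonneg ht.le]
        exact (mul_le_mul_of_nonneg_left hle ht.le).trans_lt ht2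
      simp [abs_of_pos (hdet _ this)]
    have hint := integrableOn_image_iff_integrableOn_abs_det_fderiv_smul μ measurableSet_ball hder
      hinj (fun _ => (1 : ℝ))
    have heq := integral_image_eq_integral_abs_det_fderiv_smul μ measurableSet_ball hder
      hinj (fun _ => (1 : ℝ))
    rw [him] at hint heq
    refine ⟨(hint.1 ?_).congr_fun habs measurableSet_ball, ?_⟩
    · exact integrableOn_const measure_ball_lt_top.ne
    · rw [← setIntegral_congr_fun measurableSet_ball habs, ← heq]
      simp
  have hτ : 0 < min 1 δ / (4 * (K + 1)) := by positivity
  obtain ⟨s, t, c, ht, hc, hsum⟩ := exists_sum_det_one_add_smul_eq (E := E) hτ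
  have htK (k : ℕ) : t k * K * 2 < 1 ∧ t k * K < δ := by
    have h1 : t k * (4 * (K + 1)) ≤ min 1 δ := (le_div_iff₀ (by positivity)).1 (ht k).2
    have h2 := min_le_left 1 δ
    have h3 := min_le_right 1 δ
    have h4 : 0 ≤ t k * K := mul_nonneg (ht k).1.le K.2
    constructor <;> nlinarith [(ht k).1]
  have hs (k : ℕ) := hsmall (t k) (ht k).1 (htK k).1 (htK k).2
  rw [funext fun x => hsum (fderiv ℝ g x)]
  rw [integral_finsetSum _ fun k _ => (hs k).1.const_mul (c k)]
  simp_rw [integral_const_mul, (hs _).2]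
  rw [← Finset.sum_mul, hc, one_mul]

end NormedSpace

section InnerProductSpace

variable [InnerProductSpace ℝ E] [FiniteDimensional ℝ E]

/-- There is no `C¹` retraction of the unit ball onto the unit sphere. -/
theorem not_exists_contDiff_retraction {g : E → E}
    (hg : ∀ x ∈ closedBall (0 : E) 1, ContDiffAt ℝ 1 g x) (h0 : ∀ x, ‖x‖ = 1 → g x = 0)
    (h1 : ∀ x ∈ closedBall (0 : E) 1, ‖x + g x‖ = 1) : False := by
  borelize E
  let μ : Measure E := Measure.addHaar
  have hzero : ∀ x ∈ ball (0 : E) 1, (1 + fderiv ℝ g x).det = 0 := fun x hx => by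
    have hx' := ball_subset_closedBall hx
    have hder : HasFDerivAt (fun x => x + g x) (1 + fderiv ℝ g x) x :=
      (hasFDerivAt_id x).add ((hg x hx').differentiableAt one_ne_zero).hasFDerivAt
    have hconst : HasFDerivAt (fun x => ‖x + g x‖ ^ 2) (0 : E →L[ℝ] ℝ) x := by
      refine (hasFDerivAt_const (1 : ℝ) x).congr_of_eventuallyEq ?_
      filter_upwards [isOpen_ball.mem_nhds hx] with y hy
      simp [h1 y (ball_subset_closedBall hy)]
    have horth := hder.norm_sq.unique hconst
    by_contra hne
    have hsurj : Function.Surjective (1 + fderiv ℝ g x : E →L[ℝ] E) :=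
      (LinearMap.equivOfDetNeZero (1 + fderiv ℝ g x : E →L[ℝ] E).toLinearMap hne).surjective
    obtain ⟨v, hv⟩ := hsurj (x + g x)
    have := DFunLike.congr_fun horth v
    rw [smul_apply, ContinuousLinearMap.comp_apply, hv, innerSL_apply_apply,
      real_inner_self_eq_norm_sq, h1 x hx'] at this
    norm_num at this
  have h := setIntegral_det_one_add_fderiv μ hg h0
  rw [setIntegral_congr_fun measurableSet_ball hzero] at h
  have hpos : 0 < μ.real (ball 0 1) :=
    ENNReal.toReal_pos (measure_ball_pos μ 0 one_pos).ne' measure_ball_lt_top.ne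
  simp at h
  linarith

theorem exists_fixedPoint_of_contDiff {f : E → E} (hf : ContDiff ℝ 1 f) (hf1 : ∀ x, ‖f x‖ < 1) :
    ∃ x, f x = x := by
  by_contra! hne
  let u : E → E := fun x => x - f x
  let a : E → ℝ := fun x => inner ℝ x (u x)
  let D : E → ℝ := fun x => a x ^ 2 + ‖u x‖ ^ 2 * (1 - ‖x‖ ^ 2)
  -- `x + g x` is the point where the ray from `f x` through `x` leaves the unit ball
  let g : E → E := fun x => ((-a x + √(D x)) / ‖u x‖ ^ 2) • u x
  have hu (x : E) : 0 < ‖u x‖ ^ 2 := by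
    have : u x ≠ 0 := sub_ne_zero.2 (hne x).symm
    positivity
  have ha {x : E} (hx : ‖x‖ = 1) : 0 < a x := by
    have h := real_inner_le_norm x (f x)
    have h1 := hf1 x
    simp only [a, u, inner_sub_right, real_inner_self_eq_norm_sq, hx] at h ⊢
    linarith
  have hD {x : E} (hx : ‖x‖ ≤ 1) : 0 < D x := by
    rcases hx.eq_or_lt with h | h
    · have := ha h
      simp only [D, h]
      positivity
    · have : 0 < 1 - ‖x‖ ^ 2 := by nlinarith [norm_nonneg x]
      have := mul_pos (hu x) this
      positivity
  refine not_exists_contDiff_retraction (g := g) (fun x hx => ?_) (fun x hx => ?_) fun x hx => ?_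
  · have hu' : ContDiff ℝ 1 u := contDiff_id.sub hf
    have ha' : ContDiff ℝ 1 a := contDiff_id.inner ℝ hu'
    have hD' : ContDiff ℝ 1 D :=
      (ha'.pow 2).add ((hu'.norm_sq ℝ).mul (contDiff_const.sub (contDiff_id.norm_sq ℝ)))
    exact ((ha'.neg.contDiffAt.add (hD'.contDiffAt.sqrt (hD (by simpa using hx)).ne')).div
      (hu'.norm_sq ℝ).contDiffAt (hu x).ne').smul hu'.contDiffAt
  · have : √(D x) = a x := by simp [D, hx, (ha hx).le]
    simp [g, this]
  · have hsq := Real.sq_sqrt (hD (by simpa using hx)).le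
    have h1 : ‖x + g x‖ ^ 2 = 1 := by
      rw [norm_add_sq_real, inner_smul_right, norm_smul, mul_pow, Real.norm_eq_abs, sq_abs]
      change ‖x‖ ^ 2 + 2 * ((-a x + √(D x)) / ‖u x‖ ^ 2 * a x) +
        ((-a x + √(D x)) / ‖u x‖ ^ 2) ^ 2 * ‖u x‖ ^ 2 = 1
      have hw := (hu x).ne'
      replace hsq : √(D x) ^ 2 = a x ^ 2 + ‖u x‖ ^ 2 * (1 - ‖x‖ ^ 2) := hsq
      generalize ‖u x‖ ^ 2 = w at hw hsq ⊢
      field_simp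
      linear_combination hsq
    exact (sq_eq_sq₀ (norm_nonneg _) zero_le_one).1 (by rw [h1, one_pow])

theorem exists_fixedPoint_of_norm_le_half {f : E → E} (hf : Continuous f)
    (hf1 : ∀ x, ‖f x‖ ≤ 1 / 2) : ∃ x, f x = x := by
  by_contra! hne
  obtain ⟨x₀, -, hmin⟩ := (isCompact_closedBall (0 : E) 1).exists_isMinOn
    ⟨0, by simp⟩ (continuous_id.sub hf).norm.continuousOn
  have hδ : 0 < ‖x₀ - f x₀‖ := norm_pos_iff.2 (sub_ne_zero.2 (hne x₀).symm)
  obtain ⟨h, hh, happ, -⟩ := hf.exists_contDiff_approx 1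
    (ε := fun _ => min (1 / 2) ‖x₀ - f x₀‖) continuous_const fun _ => by positivity
  have hh1 (x : E) : ‖h x‖ < 1 := by
    have h1 := (happ x).trans_le (min_le_left _ _)
    rw [dist_eq_norm] at h1
    linarith [norm_le_norm_add_norm_sub' (h x) (f x), hf1 x]
  obtain ⟨x, hx⟩ := exists_fixedPoint_of_contDiff (by exact_mod_cast hh) hh1
  have h2 := (happ x).trans_le (min_le_right _ _)
  rw [hx, dist_eq_norm] at h2
  have h3 : ‖x‖ < 1 := by simpa [hx] using hh1 x
  exact (isMinOn_iff.1 hmin x (by simpa using h3.le)).not_gt h2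

theorem exists_fixedPoint_of_bounded {f : E → E} (hf : Continuous f) {R : ℝ}
    (hR : ∀ x, ‖f x‖ ≤ R) : ∃ x, f x = x := by
  have hR0 : 0 ≤ R := (norm_nonneg _).trans (hR 0)
  have hc : (0 : ℝ) < 2 * (R + 1) := by positivity
  obtain ⟨x, hx⟩ := exists_fixedPoint_of_norm_le_half
    (f := fun x => (2 * (R + 1))⁻¹ • f ((2 * (R + 1)) • x)) (by fun_prop) fun x => by
      rw [norm_smul, Real.norm_of_nonneg (by positivity), inv_mul_le_iff₀ hc]
      linarith [hR ((2 * (R + 1)) • x)]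
  exact ⟨(2 * (R + 1)) • x, (inv_smul_eq_iff₀ hc.ne').1 hx⟩

end InnerProductSpace

/-- **Brouwer's fixed point theorem** for boxes. -/
theorem exists_fixedPoint_Icc {ι : Type*} [Fintype ι] {a b : ι → ℝ} (hab : a ≤ b)
    {f : (ι → ℝ) → ι → ℝ} (hf : Continuous f) (hmaps : MapsTo f (Icc a b) (Icc a b)) :
    ∃ x ∈ Icc a b, f x = x := by
  let clamp : (ι → ℝ) → ι → ℝ := fun x => a ⊔ (x ⊓ b)
  have hclamp (x : ι → ℝ) : clamp x ∈ Icc a b := ⟨le_sup_left, sup_le hab inf_le_right⟩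
  have hcont : Continuous clamp := continuous_pi fun i =>
    continuous_const.sup ((continuous_apply i).inf continuous_const)
  let F : EuclideanSpace ℝ ι → EuclideanSpace ℝ ι := fun x => WithLp.toLp 2 (f (clamp x.ofLp))
  have hF : Continuous F := by fun_prop
  obtain ⟨R, hR⟩ := ((isCompact_Icc (a := a) (b := b)).image_of_continuousOn
    ((PiLp.continuous_toLp 2 fun _ : ι => ℝ).comp hf).continuousOn).isBounded.exists_norm_le
  obtain ⟨x, hx⟩ := exists_fixedPoint_of_bounded hF fun x =>
    hR _ (mem_image_of_mem _ (hclamp x.ofLp))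
  have hx' : f (clamp x.ofLp) = x.ofLp := congrArg WithLp.ofLp hx
  have hmem : x.ofLp ∈ Icc a b := hx' ▸ hmaps (hclamp _)
  refine ⟨x.ofLp, hmem, ?_⟩
  have : clamp x.ofLp = x.ofLp := by simp [clamp, hmem.1, hmem.2]
  rwa [this] at hx'

end Brouwer

/-- The configuration of `n + 1` points of `ℝⁿ` whose sup-norm distances are `1 + ε (i, j)`
for `i < j`, provided that all entries of `ε` lie in `[0, 1/2]`. -/
def linfConfig {n : ℕ} (ε : Fin (n + 1) × Fin (n + 1) → ℝ) (j : Fin (n + 1)) (k : Fin n) : ℝ :=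
  if k.castSucc < j then ε (k.castSucc, j) else if k.castSucc = j then -1 else 0

theorem continuous_linfConfig {n : ℕ} (j : Fin (n + 1)) :
    Continuous fun ε : Fin (n + 1) × Fin (n + 1) → ℝ => linfConfig ε j := by
  refine continuous_pi fun k => ?_
  unfold linfConfig
  split_ifs <;> fun_prop

theorem norm_linfConfig_sub {n : ℕ} {ε : Fin (n + 1) × Fin (n + 1) → ℝ}
    (h0 : ∀ p, 0 ≤ ε p) (h1 : ∀ p, ε p ≤ 1 / 2) {i j : Fin (n + 1)} (hij : i < j) :
    ‖linfConfig ε i - linfConfig ε j‖ = 1 + ε (i, j) := by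
  have hpos : 0 ≤ 1 + ε (i, j) := by linarith [h0 (i, j)]
  refine le_antisymm ((pi_norm_le_iff_of_nonneg hpos).2 fun k => ?_) ?_
  · rw [Pi.sub_apply, Real.norm_eq_abs, abs_le]
    have hi0 := h0 (k.castSucc, i)
    have hi1 := h1 (k.castSucc, i)
    have hj0 := h0 (k.castSucc, j)
    have hj1 := h1 (k.castSucc, j)
    have hij0 := h0 (i, j)
    unfold linfConfig
    rcases lt_trichotomy k.castSucc i with hk | hk | hk
    · simp only [hk, hk.trans hij, if_true]
      constructor <;> linarith
    · simp only [hk, hij, lt_irrefl, if_true, if_false]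
      constructor <;> linarith
    · simp only [hk.not_gt, hk.ne', if_false]
      split_ifs <;> constructor <;> linarith
  · obtain ⟨k, rfl⟩ := Fin.exists_castSucc_eq.2 (Fin.ne_last_of_lt hij)
    refine le_trans ?_ (norm_le_pi_norm _ k)
    simp only [Pi.sub_apply, linfConfig, lt_irrefl, if_false, if_true, hij, Real.norm_eq_abs]
    exact le_abs.2 (Or.inr (by linarith))

/-- If `ν` is a norm on `ℝⁿ` (given by its triangle inequality and absolute
homogeneity) satisfying `ν x ≤ ‖x‖_∞ ≤ (3/2) ν x` for all `x` (here `‖·‖` is the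
sup norm on `Fin n → ℝ`), then there are `n + 1` points in `ℝⁿ` that are pairwise at
`ν`-distance `1`. -/
theorem exists_equilateral_points_of_sandwich_linf (n : ℕ) (ν : (Fin n → ℝ) → ℝ)
    (hν_add : ∀ x y : Fin n → ℝ, ν (x + y) ≤ ν x + ν y)
    (hν_smul : ∀ (a : ℝ) (x : Fin n → ℝ), ν (a • x) = |a| * ν x)
    (h_le : ∀ x : Fin n → ℝ, ν x ≤ ‖x‖)
    (h_ge : ∀ x : Fin n → ℝ, ‖x‖ ≤ (3 / 2) * ν x) :
    ∃ q : Fin (n + 1) → (Fin n → ℝ),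
      ∀ i j : Fin (n + 1), i < j → ν (q i - q j) = 1 := by
  have hν_cont : Continuous ν := by
    refine (LipschitzWith.of_le_add fun x y => ?_).continuous
    calc ν x = ν (y + (x - y)) := by rw [add_sub_cancel]
      _ ≤ ν y + ν (x - y) := hν_add _ _
      _ ≤ ν y + dist x y := by rw [dist_eq_norm]; gcongr; exact h_le _
  let f : (Fin (n + 1) × Fin (n + 1) → ℝ) → Fin (n + 1) × Fin (n + 1) → ℝ := fun ε p =>
    if p.1 < p.2 then 1 + ε p - ν (linfConfig ε p.1 - linfConfig ε p.2) else 0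
  have hf : Continuous f := by
    refine continuous_pi fun p => ?_
    simp only [f]
    split_ifs
    · exact (continuous_const.add (continuous_apply p)).sub
        (hν_cont.comp ((continuous_linfConfig p.1).sub (continuous_linfConfig p.2)))
    · exact continuous_const
  obtain ⟨ε, -, hfix⟩ := exists_fixedPoint_Icc (a := fun _ => 0) (b := fun _ => 1 / 2)
    (fun _ => by norm_num) hf fun ε hε => by
      have key (p : Fin (n + 1) × Fin (n + 1)) : 0 ≤ f ε p ∧ f ε p ≤ 1 / 2 := by
        simp only [f]
        split_ifs with hp
        · have hnorm := norm_linfConfig_sub hε.1 hε.2 hp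
          have hle := h_le (linfConfig ε p.1 - linfConfig ε p.2)
          have hge := h_ge (linfConfig ε p.1 - linfConfig ε p.2)
          have hp2 := hε.2 p
          simp only [Prod.mk.eta] at hnorm
          constructor <;> linarith
        · norm_num
      exact ⟨fun p => (key p).1, fun p => (key p).2⟩
  refine ⟨linfConfig ε, fun i j hij => ?_⟩
  have h := congrFun hfix (i, j)
  simp only [f, hij, if_true] at h
  linarith
end

section
/- Let n > 2 and p ∈ (1, ∞), and set R(p, n) = sup_{θ>0} ((1 + (1 + θ)^p) / (2 + (n − 2)·θ^p))^{1/p}. If X is an n-dimensional real normed space with Banach–Mazur distance d(X, ℓ_p^n) ≤ R(p, n), then e(X) ≥ n, i.e., X contains an equilateral set of n points. -/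
/-- `R(p, n) = sup_{θ>0} ((1 + (1 + θ)^p) / (2 + (n - 2) θ^p))^{1/p}`. -/
noncomputable def Rpn (p : ℝ) (n : ℕ) : ℝ :=
  sSup {r : ℝ | ∃ θ : ℝ, 0 < θ ∧
    r = ((1 + (1 + θ) ^ p) / (2 + ((n : ℝ) - 2) * θ ^ p)) ^ (1 / p)}

/-- The indicator of a finite set `S ⊆ ℕ` as a lattice vector: the displacement from the least to
the greatest vertex of a lattice cube with set of directions `S`. -/
def cubeDiag (S : Finset ℕ) (i : ℕ) : ℕ := if i ∈ S then 1 else 0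

/-- The value of the mod 2 cup product `δg₀ ∪ ⋯ ∪ δgₖ₋₁` of coboundaries of functions on lattice
points on the lattice cube with least vertex `v` and set of directions `S`. -/
def cupCoboundary (g : ℕ → (ℕ → ℕ) → ZMod 2) : ℕ → Finset ℕ → (ℕ → ℕ) → ZMod 2
  | 0, _, _ => 1
  | k + 1, S, v => ∑ s ∈ S,
      (g k (v + cubeDiag S) + g k (v + cubeDiag (S.erase s))) * cupCoboundary g k (S.erase s) v

/-- The mod 2 coboundary of a cubical cochain on the lattice. -/
def cubeCoboundary (V : Finset ℕ → (ℕ → ℕ) → ZMod 2) (S : Finset ℕ) (v : ℕ → ℕ) : ZMod 2 :=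
  ∑ s ∈ S, (V (S.erase s) (v + Pi.single s 1) + V (S.erase s) v)

/-- The sum of `F` over the lattice points that agree with `v` except in the first `k`
coordinates, which range over `{0, …, N - 1}`. -/
def boxSum (N : ℕ) : ℕ → ((ℕ → ℕ) → ZMod 2) → (ℕ → ℕ) → ZMod 2
  | 0, F, v => F v
  | k + 1, F, v => ∑ a ∈ Finset.range N, boxSum N k F (Function.update v k a)

theorem sum_sum_erase_eq_zero {S : Finset ℕ} {f : ℕ → ℕ → ZMod 2} (hf : ∀ s t, f s t = f t s) :
    ∑ s ∈ S, ∑ t ∈ S.erase s, f s t = 0 := by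
  rw [Finset.sum_sigma']
  refine Finset.sum_involution (fun x _ => ⟨x.2, x.1⟩) ?_ ?_ ?_ ?_
  · intro x _
    rw [hf x.2 x.1]
    exact CharTwo.add_self_eq_zero _
  · rintro ⟨s, t⟩ h _ h'
    simp only [Finset.mem_sigma, Finset.mem_erase] at h
    simp only [Sigma.mk.injEq] at h'
    exact h.2.1 h'.1
  · rintro ⟨s, t⟩ h
    simp only [Finset.mem_sigma, Finset.mem_erase] at h ⊢
    exact ⟨h.2.2, fun h' => h.2.1 h'.symm, h.1⟩
  · intro x _
    rfl

theorem cubeCoboundary_cubeCoboundary (V : Finset ℕ → (ℕ → ℕ) → ZMod 2) (S : Finset ℕ)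
    (v : ℕ → ℕ) : cubeCoboundary (cubeCoboundary V) S v = 0 := by
  simp only [cubeCoboundary, ← Finset.sum_add_distrib]
  refine sum_sum_erase_eq_zero fun s t => ?_
  rw [Finset.erase_right_comm, add_right_comm v (Pi.single s 1)]
  ring

theorem single_add_cubeDiag_erase {S : Finset ℕ} {s : ℕ} (hs : s ∈ S) :
    Pi.single s 1 + cubeDiag (S.erase s) = cubeDiag S := by
  funext i
  by_cases h : i = s
  · subst h; simp [cubeDiag, hs]
  · simp [cubeDiag, h]

/-- The cochain `δg₀ ∪ ⋯ ∪ δgₖ₋₁ ∪ gₖ`. -/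
def cupPrimitive (g : ℕ → (ℕ → ℕ) → ZMod 2) (k : ℕ) (S : Finset ℕ) (v : ℕ → ℕ) : ZMod 2 :=
  cupCoboundary g k S v * g k (v + cubeDiag S)

theorem cupCoboundary_succ_of_closed (g : ℕ → (ℕ → ℕ) → ZMod 2) (k : ℕ)
    (h : ∀ S v, cubeCoboundary (cupCoboundary g k) S v = 0) (S : Finset ℕ) (v : ℕ → ℕ) :
    cupCoboundary g (k + 1) S v = cubeCoboundary (cupPrimitive g k) S v := by
  have key : cubeCoboundary (cupPrimitive g k) S v =
      ∑ s ∈ S, (cupCoboundary g k (S.erase s) (v + Pi.single s 1) * g k (v + cubeDiag S)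
        + cupCoboundary g k (S.erase s) v * g k (v + cubeDiag (S.erase s))) := by
    refine Finset.sum_congr rfl fun s hs => ?_
    rw [cupPrimitive, cupPrimitive, add_assoc, single_add_cubeDiag_erase hs]
  have h0 := congrArg (· * g k (v + cubeDiag S)) (h S v)
  simp only [cubeCoboundary, Finset.sum_mul, zero_mul] at h0
  rw [key, cupCoboundary, ← add_zero (Finset.sum _ _), ← h0, ← Finset.sum_add_distrib]
  refine Finset.sum_congr rfl fun s _ => ?_
  linear_combination cupCoboundary g k (S.erase s) v * g k (v + cubeDiag S) *
    (CharTwo.two_eq_zero : (2 : ZMod 2) = 0)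

theorem cubeCoboundary_cupCoboundary (g : ℕ → (ℕ → ℕ) → ZMod 2) (k : ℕ) (S : Finset ℕ)
    (v : ℕ → ℕ) : cubeCoboundary (cupCoboundary g k) S v = 0 := by
  induction k generalizing S v with
  | zero =>
    refine Finset.sum_eq_zero fun s _ => ?_
    simp only [cupCoboundary]
    exact CharTwo.add_self_eq_zero _
  | succ k ih =>
    rw [funext₂ (cupCoboundary_succ_of_closed g k ih)]
    exact cubeCoboundary_cubeCoboundary _ S v

theorem cupCoboundary_succ (g : ℕ → (ℕ → ℕ) → ZMod 2) (k : ℕ) (S : Finset ℕ) (v : ℕ → ℕ) :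
    cupCoboundary g (k + 1) S v = cubeCoboundary (cupPrimitive g k) S v :=
  cupCoboundary_succ_of_closed g k (cubeCoboundary_cupCoboundary g k) S v

theorem cupCoboundary_eq_zero {g : ℕ → (ℕ → ℕ) → ZMod 2} {k i : ℕ} (hi : i < k) {S : Finset ℕ}
    {v : ℕ → ℕ} {c : ZMod 2} (hc : ∀ T ⊆ S, g i (v + cubeDiag T) = c) :
    cupCoboundary g k S v = 0 := by
  induction k generalizing S with
  | zero => omega
  | succ k ih =>
    refine Finset.sum_eq_zero fun s _ => ?_
    have hsub : S.erase s ⊆ S := Finset.erase_subset s S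
    rcases Nat.lt_succ_iff_lt_or_eq.mp hi with h | rfl
    · rw [ih h fun T hT => hc T (hT.trans hsub), mul_zero]
    · rw [hc S subset_rfl, hc _ hsub, CharTwo.add_self_eq_zero, zero_mul]

theorem boxSum_sum {ι : Type*} (N k : ℕ) (t : Finset ι) (F : ι → (ℕ → ℕ) → ZMod 2) (v : ℕ → ℕ) :
    boxSum N k (fun w => ∑ i ∈ t, F i w) v = ∑ i ∈ t, boxSum N k (F i) v := by
  induction k generalizing v with
  | zero => rfl
  | succ k ih =>
    simp only [boxSum, ih]
    exact Finset.sum_comm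

theorem boxSum_update (N : ℕ) {k j : ℕ} (hj : k ≤ j) (F : (ℕ → ℕ) → ZMod 2) (v : ℕ → ℕ) (a : ℕ) :
    boxSum N k F (Function.update v j a) = boxSum N k (fun w => F (Function.update w j a)) v := by
  induction k generalizing v with
  | zero => rfl
  | succ k ih =>
    refine Finset.sum_congr rfl fun b _ => ?_
    rw [Function.update_comm (by omega), ih (by omega)]

theorem boxSum_succ_telescope (N k : ℕ) (H : (ℕ → ℕ) → ZMod 2) (v : ℕ → ℕ) :
    boxSum N (k + 1) (fun w => H (w + Pi.single k 1) + H w) v =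
      boxSum N k (fun w => H (Function.update w k N) + H (Function.update w k 0)) v := by
  simp only [boxSum, boxSum_update N le_rfl]
  rw [← boxSum_sum]
  congr 1
  funext w
  have hup (a : ℕ) : Function.update w k a + Pi.single k 1 = Function.update w k (a + 1) := by
    funext i
    by_cases h : i = k
    · subst h; simp
    · simp [h]
  simp only [hup, ← CharTwo.sub_eq_add]
  exact Finset.sum_range_sub (fun a => H (Function.update w k a)) N

theorem boxSum_eq_zero {N k : ℕ} {F : (ℕ → ℕ) → ZMod 2} (hF : ∀ w, F w = 0) (v : ℕ → ℕ) :
    boxSum N k F v = 0 := by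
  induction k generalizing v with
  | zero => exact hF v
  | succ k ih => exact Finset.sum_eq_zero fun a _ => ih _

theorem boxSum_telescope_eq_zero {N k s : ℕ} (hs : s < k) {H : (ℕ → ℕ) → ZMod 2}
    (hH : ∀ w, w s = 0 ∨ w s = N → H w = 0) (v : ℕ → ℕ) :
    boxSum N k (fun w => H (w + Pi.single s 1) + H w) v = 0 := by
  induction k generalizing v with
  | zero => omega
  | succ k ih =>
    rcases Nat.lt_succ_iff_lt_or_eq.mp hs with h | rfl
    · exact Finset.sum_eq_zero fun a _ => ih h _
    · rw [boxSum_succ_telescope]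
      exact boxSum_eq_zero (fun w => by rw [hH _ (by simp), hH _ (by simp), add_zero]) v

theorem boxSum_cupCoboundary {N m : ℕ} {g : ℕ → (ℕ → ℕ) → ZMod 2}
    (h0 : ∀ i < m, ∀ w : ℕ → ℕ, w i = 0 → g i w = 0)
    (h1 : ∀ i < m, ∀ w : ℕ → ℕ, w i = N → g i w = 1) {k : ℕ} (hk : k ≤ m) (v : ℕ → ℕ) :
    boxSum N k (cupCoboundary g k (Finset.range k)) v = 1 := by
  induction k generalizing v with
  | zero => rfl
  | succ k ih =>
    have hd : cupCoboundary g (k + 1) (Finset.range (k + 1)) =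
        fun w => ∑ s ∈ Finset.range (k + 1),
          (cupPrimitive g k ((Finset.range (k + 1)).erase s) (w + Pi.single s 1) +
            cupPrimitive g k ((Finset.range (k + 1)).erase s) w) :=
      funext (cupCoboundary_succ g k _)
    rw [hd, boxSum_sum, Finset.sum_range_succ, Finset.sum_eq_zero, zero_add, boxSum_succ_telescope]
    · have herase : (Finset.range (k + 1)).erase k = Finset.range k := by
        rw [Finset.range_add_one, Finset.erase_insert (by simp)]
      rw [← ih (by omega) (Function.update v k N), boxSum_update N le_rfl, herase]
      congr 1
      funext w
      rw [cupPrimitive, cupPrimitive, h1 k (by omega) _ (by simp [cubeDiag]),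
        h0 k (by omega) _ (by simp [cubeDiag]), mul_one, mul_zero, add_zero]
    · intro s hs
      have hsk : s < k := Finset.mem_range.mp hs
      refine boxSum_telescope_eq_zero (by omega) (fun w hw => ?_) v
      have hT {T : Finset ℕ} (hT : T ⊆ (Finset.range (k + 1)).erase s) :
          (w + cubeDiag T) s = w s := by
        have : s ∉ T := fun h => Finset.notMem_erase s _ (hT h)
        simp [cubeDiag, this]
      rw [cupPrimitive]
      rcases hw with hw | hw
      · rw [cupCoboundary_eq_zero hsk fun T h => h0 s (by omega) _ ((hT h).trans hw), zero_mul]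
      · rw [cupCoboundary_eq_zero hsk fun T h => h1 s (by omega) _ ((hT h).trans hw), zero_mul]

/-- A discrete Poincaré–Miranda theorem: if `gᵢ` is `0` on the face `wᵢ = 0` and `1` on the
opposite face `wᵢ = N`, then all the `gᵢ` are nonconstant on a common unit lattice cube. -/
theorem exists_cube_forall_ne {N m : ℕ} {g : ℕ → (ℕ → ℕ) → ZMod 2}
    (h0 : ∀ i < m, ∀ w : ℕ → ℕ, w i = 0 → g i w = 0)
    (h1 : ∀ i < m, ∀ w : ℕ → ℕ, w i = N → g i w = 1) :
    ∃ v : ℕ → ℕ, ∀ i < m, ∀ c, ∃ T, g i (v + cubeDiag T) ≠ c := by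
  by_contra! hcon
  have h := boxSum_cupCoboundary h0 h1 le_rfl 0
  rw [boxSum_eq_zero fun w => ?_] at h
  · exact zero_ne_one h
  · obtain ⟨i, hi, c, hc⟩ := hcon w
    exact cupCoboundary_eq_zero hi fun T _ => hc T

theorem exists_approx_zero_of_cube {ι : Type*} [Fintype ι] {θ : ℝ} (hθ : 0 ≤ θ)
    {F : ι → (ι → ℝ) → ℝ}
    (h0 : ∀ i x, (∀ j, x j ∈ Set.Icc 0 θ) → x i = 0 → F i x ≤ 0)
    (h1 : ∀ i x, (∀ j, x j ∈ Set.Icc 0 θ) → x i = θ → 0 ≤ F i x) {N : ℕ} (hN : 0 < N) :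
    ∃ x : ι → ℝ, (∀ j, x j ∈ Set.Icc 0 θ) ∧
      ∀ i, ∃ a b, dist a x ≤ θ / N ∧ dist b x ≤ θ / N ∧ F i a ≤ 0 ∧ 0 ≤ F i b := by
  classical
  have hN' : (0 : ℝ) < N := Nat.cast_pos.mpr hN
  let e := Fintype.equivFin ι
  let pt : (ℕ → ℕ) → ι → ℝ := fun w i => θ * ((min (w (e i)) N : ℕ) / N)
  have hpt (w : ℕ → ℕ) (j : ι) : pt w j ∈ Set.Icc 0 θ := by
    have : ((min (w (e j)) N : ℕ) : ℝ) / N ≤ 1 :=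
      (div_le_one hN').mpr (Nat.cast_le.mpr (min_le_right _ _))
    exact ⟨by positivity, mul_le_of_le_one_right hθ this⟩
  have hdist (v : ℕ → ℕ) (T : Finset ℕ) : dist (pt (v + cubeDiag T)) (pt v) ≤ θ / N := by
    refine (dist_pi_le_iff (by positivity)).mpr fun j => ?_
    have hd : cubeDiag T (e j) ≤ 1 := by unfold cubeDiag; split_ifs <;> simp
    have h2 : min ((v + cubeDiag T) (e j)) N ≤ min (v (e j)) N + 1 := by
      simp only [Pi.add_apply]; omega
    have h3 : min (v (e j)) N ≤ min ((v + cubeDiag T) (e j)) N := by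
      simp only [Pi.add_apply]; omega
    have h2' : ((min ((v + cubeDiag T) (e j)) N : ℕ) : ℝ) ≤ (min (v (e j)) N : ℕ) + 1 := by
      exact_mod_cast h2
    have h3' : ((min (v (e j)) N : ℕ) : ℝ) ≤ (min ((v + cubeDiag T) (e j)) N : ℕ) := by
      exact_mod_cast h3
    simp only [pt]
    rw [Real.dist_eq, ← mul_sub, ← sub_div, mul_div_assoc', abs_of_nonneg
      (div_nonneg (mul_nonneg hθ (sub_nonneg.mpr h3')) hN'.le)]
    exact div_le_div_of_nonneg_right (mul_le_of_le_one_right hθ (by linarith)) hN'.le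
  let g : ℕ → (ℕ → ℕ) → ZMod 2 := fun k w =>
    if h : k < Fintype.card ι then
      if w k = 0 then 0 else if w k = N then 1 else if F (e.symm ⟨k, h⟩) (pt w) ≤ 0 then 0 else 1
    else 0
  obtain ⟨v, hv⟩ := exists_cube_forall_ne (N := N) (m := Fintype.card ι) (g := g)
    (fun i hi w hw => by simp [g, hw]) (fun i hi w hw => by simp [g, hi, hw, hN.ne'])
  have hg (i : ι) (w : ℕ → ℕ) : g (e i) w =
      if w (e i) = 0 then 0 else if w (e i) = N then 1 else if F i (pt w) ≤ 0 then 0 else 1 := by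
    simp [g]
  refine ⟨pt v, hpt v, fun i => ?_⟩
  obtain ⟨S, hS⟩ := hv (e i) (e i).2 1
  obtain ⟨T, hT⟩ := hv (e i) (e i).2 0
  refine ⟨pt (v + cubeDiag S), pt (v + cubeDiag T), hdist v S, hdist v T, ?_, ?_⟩
  · rw [hg] at hS
    split_ifs at hS with c1 c2 c3
    · exact h0 i _ (hpt _) (by simp only [pt]; rw [c1]; simp)
    · exact absurd rfl hS
    · exact c3
    · exact absurd rfl hS
  · rw [hg] at hT
    split_ifs at hT with c1 c2 c3
    · exact absurd rfl hT
    · exact h1 i _ (hpt _) (by simp only [pt]; rw [c2]; simp [hN.ne'])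
    · exact absurd rfl hT
    · exact (not_le.mp c3).le

/-- The Poincaré–Miranda theorem. -/
theorem poincare_miranda {ι : Type*} [Fintype ι] {θ : ℝ} (hθ : 0 ≤ θ)
    {F : ι → (ι → ℝ) → ℝ} (hF : ∀ i, Continuous (F i))
    (h0 : ∀ i x, (∀ j, x j ∈ Set.Icc 0 θ) → x i = 0 → F i x ≤ 0)
    (h1 : ∀ i x, (∀ j, x j ∈ Set.Icc 0 θ) → x i = θ → 0 ≤ F i x) :
    ∃ x : ι → ℝ, (∀ j, x j ∈ Set.Icc 0 θ) ∧ ∀ i, F i x = 0 := by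
  have happrox := fun N : ℕ => exists_approx_zero_of_cube hθ h0 h1 N.succ_pos
  choose u hu a b ha hb hFa hFb using happrox
  obtain ⟨x, hx, φ, hφ, hlim⟩ :=
    (isCompact_univ_pi fun _ : ι => isCompact_Icc (a := (0 : ℝ)) (b := θ)).tendsto_subseq
      (x := u) fun N j _ => hu N j
  have hsmall : Filter.Tendsto (fun k => θ / ((φ k).succ : ℕ)) Filter.atTop (nhds (0 : ℝ)) := by
    have := (tendsto_const_div_atTop_nhds_zero_nat θ).comp
      ((Filter.tendsto_add_atTop_nat 1).comp hφ.tendsto_atTop)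
    exact this
  have hclose {c : ℕ → ι → ℝ} (hc : ∀ N : ℕ, dist (c N) (u N) ≤ θ / (N.succ : ℕ)) :
      Filter.Tendsto (c ∘ φ) Filter.atTop (nhds x) := by
    refine (tendsto_iff_of_dist (squeeze_zero (fun _ => dist_nonneg) (fun k => ?_) hsmall)).mpr hlim
    exact hc (φ k)
  refine ⟨x, fun j => hx j trivial, fun i => le_antisymm ?_ ?_⟩
  · exact le_of_tendsto' (((hF i).tendsto x).comp (hclose fun N => ha N i)) fun k => hFa _ i
  · exact ge_of_tendsto' (((hF i).tendsto x).comp (hclose fun N => hb N i)) fun k => hFb _ i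

/-- Between finite-dimensional spaces of the same dimension, the Banach–Mazur distance is
attained. -/
theorem exists_norm_mul_norm_symm_le_BMdist {X Y : Type*} [NormedAddCommGroup X]
    [NormedSpace ℝ X] [NormedAddCommGroup Y] [NormedSpace ℝ Y] [FiniteDimensional ℝ X]
    [FiniteDimensional ℝ Y] [Nontrivial X]
    (h : Module.finrank ℝ X = Module.finrank ℝ Y) :
    ∃ T : X ≃L[ℝ] Y, ‖(T : X →L[ℝ] Y)‖ * ‖(T.symm : Y →L[ℝ] X)‖ ≤ BMdist X Y := by
  let K (C : ℝ) : Set ((X →L[ℝ] Y) × (Y →L[ℝ] X)) :=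
    {q | ‖q.1‖ ≤ 1 ∧ ‖q.2‖ ≤ C ∧ q.2.comp q.1 = .id ℝ X ∧ q.1.comp q.2 = .id ℝ Y}
  have hK (C : ℝ) : IsCompact (K C) := by
    refine Metric.isCompact_of_isClosed_isBounded ?_ ?_
    · refine (isClosed_le continuous_fst.norm continuous_const).inter
        ((isClosed_le continuous_snd.norm continuous_const).inter
          ((isClosed_eq ?_ continuous_const).inter (isClosed_eq ?_ continuous_const)))
      · exact continuous_snd.clm_comp continuous_fst
      · exact continuous_fst.clm_comp continuous_snd
    · refine (Metric.isBounded_closedBall (x := 0) (r := max 1 C)).subset fun q hq => ?_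
      rw [mem_closedBall_zero_iff, Prod.norm_def]
      exact max_le_max hq.1 hq.2.1
  have hnormalize (T : X ≃L[ℝ] Y) :
      ∃ q ∈ K (‖(T : X →L[ℝ] Y)‖ * ‖(T.symm : Y →L[ℝ] X)‖),
        ‖q.1‖ * ‖q.2‖ = ‖(T : X →L[ℝ] Y)‖ * ‖(T.symm : Y →L[ℝ] X)‖ := by
    have hpos : 0 < ‖(T : X →L[ℝ] Y)‖ := T.norm_pos
    refine ⟨(‖(T : X →L[ℝ] Y)‖⁻¹ • (T : X →L[ℝ] Y), ‖(T : X →L[ℝ] Y)‖ • (T.symm : Y →L[ℝ] X)),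
      ⟨?_, ?_, ?_, ?_⟩, ?_⟩
    · simp [norm_smul, hpos.ne']
    · simp [norm_smul]
    · ext x; simp [smul_smul, hpos.ne']
    · ext x; simp [smul_smul, hpos.ne']
    · simp [norm_smul, hpos.ne']
  obtain ⟨T₀⟩ := FiniteDimensional.nonempty_continuousLinearEquiv_of_finrank_eq h
  obtain ⟨q₀, hq₀, hq₀'⟩ := hnormalize T₀
  obtain ⟨q, hq, hmin⟩ := (hK _).exists_isMinOn ⟨q₀, hq₀⟩
    (f := fun q => ‖q.1‖ * ‖q.2‖) (by fun_prop)
  refine ⟨.equivOfInverse q.1 q.2 (fun x => DFunLike.congr_fun hq.2.2.1 x)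
    (fun y => DFunLike.congr_fun hq.2.2.2 y), ?_⟩
  refine le_csInf ⟨_, T₀, rfl⟩ ?_
  rintro r ⟨T, rfl⟩
  rcases le_total (‖(T : X →L[ℝ] Y)‖ * ‖(T.symm : Y →L[ℝ] X)‖)
    (‖(T₀ : X →L[ℝ] Y)‖ * ‖(T₀.symm : Y →L[ℝ] X)‖) with hT | hT
  · obtain ⟨q', hq', hq''⟩ := hnormalize T
    rw [← hq'']
    exact hmin ⟨hq'.1, hq'.2.1.trans hT, hq'.2.2⟩
  · rw [← hq₀'] at hT
    exact (hmin hq₀).trans hT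

theorem exists_one_lt_lp_ratio {p c : ℝ} (hp : 1 < p) (hc : 1 ≤ c) :
    ∃ θ : ℝ, 0 < θ ∧ 1 < (1 + (1 + θ) ^ p) / (2 + c * θ ^ p) := by
  have hc0 : 0 < c := by linarith
  refine ⟨c⁻¹ ^ (1 / (p - 1)), by positivity, ?_⟩
  set θ : ℝ := c⁻¹ ^ (1 / (p - 1)) with hθ
  have hθ0 : 0 < θ := by positivity
  have h1 : θ ^ (p - 1) = c⁻¹ := by
    rw [hθ, one_div, Real.rpow_inv_rpow (by positivity) (by linarith)]
  have h2 : θ ^ p = c⁻¹ * θ := by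
    rw [← h1, ← Real.rpow_add_one hθ0.ne', sub_add_cancel]
  have h3 := one_add_mul_self_le_rpow_one_add (by linarith : -1 ≤ θ) hp.le
  rw [one_lt_div (by positivity), h2, mul_inv_cancel_left₀ hc0.ne']
  nlinarith

theorem tendsto_lp_ratio_atTop {p c : ℝ} (hp : 1 < p) (hc : 1 ≤ c) :
    Filter.Tendsto (fun θ : ℝ => (1 + (1 + θ) ^ p) / (2 + c * θ ^ p)) Filter.atTop
      (nhds c⁻¹) := by
  have hp0 : p ≠ 0 := by linarith
  have hcont : ContinuousAt (fun s : ℝ => (s ^ p + (1 + s) ^ p) / (2 * s ^ p + c)) 0 := by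
    have hpow : Continuous fun s : ℝ => s ^ p := Real.continuous_rpow_const (by linarith)
    have hpow' : Continuous fun s : ℝ => (1 + s) ^ p := hpow.comp (by fun_prop)
    refine ContinuousAt.div (by fun_prop) (by fun_prop) ?_
    simp only [Real.zero_rpow hp0]
    linarith
  have hlim := hcont.tendsto.comp tendsto_inv_atTop_zero
  simp only [Real.zero_rpow hp0, add_zero, Real.one_rpow, mul_zero, zero_add, one_div] at hlim
  refine hlim.congr' ?_
  filter_upwards [Filter.eventually_gt_atTop 0] with θ hθ
  have h1 : (1 + θ⁻¹) ^ p = (1 + θ) ^ p / θ ^ p := by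
    rw [← Real.div_rpow (by positivity) hθ.le]
    congr 1
    field_simp
    ring
  have hpos : 0 < θ ^ p := by positivity
  simp only [Function.comp, Real.inv_rpow hθ.le, h1]
  field_simp

/-- The supremum defining `R(p, n)` is attained. -/
theorem exists_Rpn_le {n : ℕ} (hn : 2 < n) {p : ℝ} (hp : 1 < p) :
    ∃ θ : ℝ, 0 < θ ∧
      Rpn p n ≤ ((1 + (1 + θ) ^ p) / (2 + ((n : ℝ) - 2) * θ ^ p)) ^ (1 / p) := by
  have hc : (1 : ℝ) ≤ (n : ℝ) - 2 := by
    have : ((3 : ℕ) : ℝ) ≤ n := Nat.cast_le.mpr hn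
    push_cast at this
    linarith
  set c : ℝ := (n : ℝ) - 2
  obtain ⟨θ₀, hθ₀, hlt⟩ := exists_one_lt_lp_ratio hp hc
  have hcont : ContinuousOn (fun θ : ℝ => (1 + (1 + θ) ^ p) / (2 + c * θ ^ p)) (Set.Ici 0) := by
    have hpow : Continuous fun s : ℝ => s ^ p := Real.continuous_rpow_const (by linarith)
    have hpow' : Continuous fun s : ℝ => (1 + s) ^ p := hpow.comp (by fun_prop)
    refine ContinuousOn.div (by fun_prop) (by fun_prop) fun θ hθ => ?_
    have : 0 ≤ θ ^ p := Real.rpow_nonneg hθ p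
    positivity
  have hlarge : ∀ᶠ θ : ℝ in Filter.cocompact ℝ ⊓ Filter.principal (Set.Ici 0),
      (1 + (1 + θ) ^ p) / (2 + c * θ ^ p) ≤ (1 + (1 + θ₀) ^ p) / (2 + c * θ₀ ^ p) := by
    have hev := (tendsto_lp_ratio_atTop hp hc).eventually_lt_const
      ((inv_le_one_of_one_le₀ hc).trans_lt hlt)
    rw [cocompact_eq_atBot_atTop, Filter.eventually_inf_principal, Filter.eventually_sup]
    constructor
    · filter_upwards [Filter.eventually_lt_atBot 0] with θ hθ hθ'
      exact absurd hθ (not_lt.mpr hθ')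
    · filter_upwards [hev] with θ hθ _
      exact hθ.le
  obtain ⟨θ, hθ, hmax⟩ := hcont.exists_isMaxOn' isClosed_Ici (Set.mem_Ici.mpr hθ₀.le) hlarge
  have hmax' (t : ℝ) (ht : 0 ≤ t) :
      (1 + (1 + t) ^ p) / (2 + c * t ^ p) ≤ (1 + (1 + θ) ^ p) / (2 + c * θ ^ p) := hmax ht
  have hθpos : 0 < θ := by
    refine lt_of_le_of_ne hθ fun h => ?_
    have := hlt.trans_le (hmax' θ₀ hθ₀.le)
    rw [← h, Real.zero_rpow (by linarith)] at this
    norm_num at this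
  refine ⟨θ, hθpos, csSup_le ⟨_, θ, hθpos, rfl⟩ ?_⟩
  rintro r ⟨t, ht, rfl⟩
  have h0 : 0 ≤ t ^ p := by positivity
  exact Real.rpow_le_rpow (by positivity) (hmax' t ht.le) (by positivity)

/-- The vector `eⱼ - ∑_{i < j} xᵢⱼ eᵢ` of `ℓ_pⁿ`. -/
noncomputable def perturbedBasis {n : ℕ} (q : ENNReal) (x : Fin n × Fin n → ℝ) (j : Fin n) :
    PiLp q (fun _ : Fin n => ℝ) :=
  WithLp.toLp q fun i => if i = j then 1 else if i < j then -x (i, j) else 0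

theorem continuous_perturbedBasis {n : ℕ} (q : ENNReal) (j : Fin n) :
    Continuous fun x : Fin n × Fin n → ℝ => perturbedBasis q x j := by
  refine (PiLp.continuous_toLp q _).comp (continuous_pi fun i => ?_)
  split_ifs <;> fun_prop

theorem norm_perturbedBasis_sub {n : ℕ} {p : ℝ} (hp : 1 < p) (x : Fin n × Fin n → ℝ)
    {i j : Fin n} (hij : i < j) (hx : 0 ≤ x (i, j)) :
    ‖perturbedBasis (ENNReal.ofReal p) x i - perturbedBasis (ENNReal.ofReal p) x j‖ =
      (1 + (1 + x (i, j)) ^ p + ∑ k ∈ (Finset.univ.erase i).erase j,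
        ‖(perturbedBasis (ENNReal.ofReal p) x i - perturbedBasis (ENNReal.ofReal p) x j) k‖ ^ p)
        ^ (1 / p) := by
  have hp0 : 0 ≤ p := by linarith
  rw [PiLp.norm_eq_sum (by rw [ENNReal.toReal_ofReal hp0]; linarith), ENNReal.toReal_ofReal hp0,
    ← Finset.add_sum_erase _ _ (Finset.mem_univ i),
    ← Finset.add_sum_erase _ _ (Finset.mem_erase.mpr ⟨hij.ne', Finset.mem_univ j⟩)]
  congr 1
  have h1 : ‖(perturbedBasis (ENNReal.ofReal p) x i - perturbedBasis (ENNReal.ofReal p) x j) i‖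
      = 1 + x (i, j) := by
    simp [perturbedBasis, hij, hij.ne]
    linarith
  have h2 : ‖(perturbedBasis (ENNReal.ofReal p) x i - perturbedBasis (ENNReal.ofReal p) x j) j‖
      = 1 := by
    simp [perturbedBasis, hij.ne', not_lt.mpr hij.le]
  rw [h1, h2, Real.one_rpow]
  ring

theorem le_norm_perturbedBasis_sub {n : ℕ} {p : ℝ} (hp : 1 < p) {x : Fin n × Fin n → ℝ}
    {i j : Fin n} (hij : i < j) (hx : 0 ≤ x (i, j)) :
    (1 + (1 + x (i, j)) ^ p) ^ (1 / p) ≤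
      ‖perturbedBasis (ENNReal.ofReal p) x i - perturbedBasis (ENNReal.ofReal p) x j‖ := by
  rw [norm_perturbedBasis_sub hp x hij hx]
  refine Real.rpow_le_rpow (by positivity) ?_ (by positivity)
  exact le_add_of_nonneg_right (Finset.sum_nonneg fun k _ => by positivity)

theorem norm_perturbedBasis_sub_le {n : ℕ} {p θ : ℝ} (hp : 1 < p) {x : Fin n × Fin n → ℝ}
    (hx : ∀ q, x q ∈ Set.Icc 0 θ) {i j : Fin n} (hij : i < j) :
    ‖perturbedBasis (ENNReal.ofReal p) x i - perturbedBasis (ENNReal.ofReal p) x j‖ ≤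
      (1 + (1 + x (i, j)) ^ p + ((n : ℝ) - 2) * θ ^ p) ^ (1 / p) := by
  have hx0 := (hx (i, j)).1
  rw [norm_perturbedBasis_sub hp x hij hx0]
  refine Real.rpow_le_rpow (by positivity) ?_ (by positivity)
  have hcard : (((Finset.univ.erase i).erase j).card : ℝ) = (n : ℝ) - 2 := by
    have h2 : 2 ≤ n := by have := j.isLt; have : (i : ℕ) < j := hij; omega
    rw [Finset.card_erase_of_mem (Finset.mem_erase.mpr ⟨hij.ne', Finset.mem_univ j⟩),
      Finset.card_erase_of_mem (Finset.mem_univ i), Finset.card_univ, Fintype.card_fin,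
      Nat.sub_sub, Nat.cast_sub h2]
    norm_num
  rw [← hcard, ← nsmul_eq_mul]
  gcongr
  refine Finset.sum_le_card_nsmul _ _ _ fun k hk => ?_
  simp only [Finset.mem_erase] at hk
  refine Real.rpow_le_rpow (norm_nonneg _) ?_ (by linarith)
  have hki := hx (k, i)
  have hkj := hx (k, j)
  simp only [Set.mem_Icc] at hki hkj
  simp only [perturbedBasis, PiLp.sub_apply, hk.1, hk.2.1, if_false, Real.norm_eq_abs]
  rw [abs_le]
  split_ifs <;> constructor <;> linarith

theorem exists_equilateral_of_norm_mul_norm_symm_le {n : ℕ} (hn : 2 < n) {p : ℝ} (hp : 1 < p)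
    [Fact (1 ≤ ENNReal.ofReal p)] {X : Type*} [NormedAddCommGroup X] [NormedSpace ℝ X]
    [Nontrivial X] (T : X ≃L[ℝ] PiLp (ENNReal.ofReal p) (fun _ : Fin n => ℝ)) {θ : ℝ} (hθ : 0 < θ)
    (hT : ‖(T : X →L[ℝ] PiLp (ENNReal.ofReal p) (fun _ : Fin n => ℝ))‖ *
        ‖(T.symm : PiLp (ENNReal.ofReal p) (fun _ : Fin n => ℝ) →L[ℝ] X)‖ ≤
      ((1 + (1 + θ) ^ p) / (2 + ((n : ℝ) - 2) * θ ^ p)) ^ (1 / p)) :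
    ∃ S : Finset X, S.card = n ∧ IsEquilateral (S : Set X) := by
  classical
  have hc : (0 : ℝ) < (n : ℝ) - 2 := sub_pos.mpr (by exact_mod_cast hn)
  set A := ‖(T : X →L[ℝ] PiLp (ENNReal.ofReal p) (fun _ : Fin n => ℝ))‖
  set B := ‖(T.symm : PiLp (ENNReal.ofReal p) (fun _ : Fin n => ℝ) →L[ℝ] X)‖
  set D := (2 + ((n : ℝ) - 2) * θ ^ p) ^ (1 / p) with hD
  have hA : 0 < A := T.norm_pos
  have hB : 0 < B := T.norm_symm_pos
  have hD0 : 0 < D := by positivity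
  have hABD : A * (B * D) ≤ (1 + (1 + θ) ^ p) ^ (1 / p) := by
    rwa [Real.div_rpow (by positivity) (by positivity), ← hD, le_div_iff₀ hD0, mul_assoc] at hT
  let P (x : Fin n × Fin n → ℝ) (j : Fin n) : X := T.symm (perturbedBasis (ENNReal.ofReal p) x j)
  have hP (x : Fin n × Fin n → ℝ) (i j : Fin n) : P x i - P x j = T.symm
      (perturbedBasis (ENNReal.ofReal p) x i - perturbedBasis (ENNReal.ofReal p) x j) :=
    (map_sub T.symm _ _).symm
  have hPc (j : Fin n) : Continuous fun x => P x j :=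
    T.symm.continuous.comp (continuous_perturbedBasis _ j)
  -- The coordinates `x (i, j)` with `j ≤ i` are not used; they get a trivial equation.
  let F : Fin n × Fin n → (Fin n × Fin n → ℝ) → ℝ := fun q x =>
    if q.1 < q.2 then ‖P x q.1 - P x q.2‖ - B * D else x q - θ / 2
  obtain ⟨x, -, hx⟩ := poincare_miranda (F := F) hθ.le
    (fun q => by
      by_cases hq : q.1 < q.2
      · simp only [F, hq, if_true]
        have := hPc q.1
        have := hPc q.2
        fun_prop
      · simp only [F, hq, if_false]
        fun_prop)
    (fun q x hx hxq => by
      by_cases hq : q.1 < q.2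
      · simp only [F, hq, if_true, sub_nonpos, hP]
        refine ((T.symm : PiLp (ENNReal.ofReal p) (fun _ : Fin n => ℝ) →L[ℝ] X).le_opNorm
          _).trans (mul_le_mul_of_nonneg_left ?_ hB.le)
        refine (norm_perturbedBasis_sub_le hp hx hq).trans_eq ?_
        rw [Prod.mk.eta, hxq, add_zero, Real.one_rpow, one_add_one_eq_two]
      · simp only [F, hq, if_false, hxq]
        linarith)
    (fun q x hx hxq => by
      by_cases hq : q.1 < q.2
      · simp only [F, hq, if_true, sub_nonneg, hP]
        have h1 := le_norm_perturbedBasis_sub hp hq (hx (q.1, q.2)).1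
        rw [Prod.mk.eta, hxq] at h1
        have h2 := (T : X →L[ℝ] PiLp (ENNReal.ofReal p) (fun _ : Fin n => ℝ)).le_opNorm
          (T.symm (perturbedBasis (ENNReal.ofReal p) x q.1 -
            perturbedBasis (ENNReal.ofReal p) x q.2))
        rw [ContinuousLinearEquiv.coe_coe, T.apply_symm_apply] at h2
        exact le_of_mul_le_mul_left (hABD.trans (h1.trans h2)) hA
      · simp only [F, hq, if_false, hxq]
        linarith)
  have hd : 0 < B * D := mul_pos hB hD0
  have hlt {i j : Fin n} (hij : i < j) : ‖P x i - P x j‖ = B * D := by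
    have h := hx (i, j)
    simp only [F, hij, if_true] at h
    linarith
  have hne {i j : Fin n} (hij : i ≠ j) : ‖P x i - P x j‖ = B * D := by
    rcases lt_or_gt_of_ne hij with h | h
    · exact hlt h
    · rw [norm_sub_rev, hlt h]
  have hinj : Function.Injective (P x) := fun i j hij => by
    by_contra h
    have := hne h
    rw [hij, sub_self, norm_zero] at this
    exact hd.ne this
  refine ⟨Finset.univ.image (P x), ?_, B * D, hd, ?_⟩
  · rw [Finset.card_image_of_injective _ hinj, Finset.card_univ, Fintype.card_fin]
  · intro y hy z hz hyz
    simp only [Finset.coe_image, Finset.coe_univ, Set.image_univ, Set.mem_range] at hy hz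
    obtain ⟨i, rfl⟩ := hy
    obtain ⟨j, rfl⟩ := hz
    exact hne fun h => hyz (congrArg (P x) h)

/-- Let `n > 2` and `1 < p < ∞`.  If `X` is an `n`-dimensional real normed space with
Banach–Mazur distance at most `R(p, n)` from `ℓ_pⁿ` (realized as `PiLp` over `Fin n`),
then `X` contains an equilateral set of `n` points, i.e. `e(X) ≥ n`. -/
theorem equilateral_of_bmdist_lp_le (n : ℕ) (hn : 2 < n) (p : ℝ) (hp : 1 < p)
    [Fact (1 ≤ ENNReal.ofReal p)]
    (X : Type*) [NormedAddCommGroup X] [NormedSpace ℝ X] [FiniteDimensional ℝ X]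
    (hdim : Module.finrank ℝ X = n)
    (hBM : BMdist X (PiLp (ENNReal.ofReal p) (fun _ : Fin n => ℝ)) ≤ Rpn p n) :
    ∃ S : Finset X, S.card = n ∧ IsEquilateral (S : Set X) := by
  have : Nontrivial X := Module.nontrivial_of_finrank_pos (R := ℝ) (by omega)
  obtain ⟨T, hT⟩ := exists_norm_mul_norm_symm_le_BMdist (X := X)
    (Y := PiLp (ENNReal.ofReal p) (fun _ : Fin n => ℝ))
    (by rw [hdim, (WithLp.linearEquiv (ENNReal.ofReal p) ℝ (Fin n → ℝ)).finrank_eq,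
      Module.finrank_fin_fun])
  obtain ⟨θ, hθ, hR⟩ := exists_Rpn_le hn hp
  exact exists_equilateral_of_norm_mul_norm_symm_le hn hp T hθ (hT.trans (hBM.trans hR))
end
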